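/- arXiv:1810.08345 — 2 statements merged into one kernel-verified Lean document; each statement's English description precedes it below -/
import Mathlib

section
/- There exist absolute constants C > 0 and c > 0 such that the following holds. Let G be a connected undirected graph on n ≥ 2 vertices with positive edge weights w, let ε ∈ (0,1), and let t be an integer with t ≥ C·ε^{−2}·(ln n)². Let T_1, …, T_t be independent w-uniform random spanning trees of G, each with its inverse-leverage-score-weighted Laplacian L_{T_i}. Then with probability at least 1 − n^{−c}, (1−ε)·L_G ⪯ (1/t)·Σ_{i=1}^t L_{T_i} ⪯ (1+ε)·L_G. -/
open Matrix Finset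
attribute [local instance] Classical.propDecidable

noncomputable section

/-- Spectral norm expressed as the supremum of |xᵀAx| over unit vectors
(this agrees with the operator norm for symmetric matrices). -/
def specNorm {n : ℕ} (A : Matrix (Fin n) (Fin n) ℝ) : ℝ :=
  sSup { r | ∃ x : Fin n → ℝ, x ⬝ᵥ x = 1 ∧ |x ⬝ᵥ A.mulVec x| = r }

/-- A distribution on {0,1}^m is k-homogeneous if every support vector has exactly k ones. -/
def kHomogeneous (m k : ℕ) (π : (Fin m → Bool) → ℝ) : Prop :=
  ∀ ξ, π ξ ≠ 0 → (Finset.univ.filter fun i => ξ i = true).card = k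

/-- A distribution on {0,1}^m is Strongly Rayleigh if its generating polynomial
has no root with all coordinates of positive imaginary part. -/
def StronglyRayleigh (m : ℕ) (π : (Fin m → Bool) → ℝ) : Prop :=
  ∀ z : Fin m → ℂ, (∀ i, 0 < (z i).im) →
    (∑ ξ : Fin m → Bool, (π ξ : ℂ) * ∏ i ∈ Finset.univ.filter (fun i => ξ i = true), z i) ≠ 0

/-- The rank-one matrix b_e b_eᵀ for an edge e = {u,v}, where b_e = 1_u - 1_v. -/
def edgeMat (n : ℕ) (e : Sym2 (Fin n)) : Matrix (Fin n) (Fin n) ℝ :=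
  fun i j => (if i = j ∧ i ∈ e then 1 else 0) + (if i ≠ j ∧ i ∈ e ∧ j ∈ e then -1 else 0)

/-- Weighted graph Laplacian. -/
def lap (n : ℕ) (G : SimpleGraph (Fin n)) (w : Sym2 (Fin n) → ℝ) : Matrix (Fin n) (Fin n) ℝ :=
  ∑ e : Sym2 (Fin n), (if e ∈ G.edgeSet then w e else 0) • edgeMat n e

/-- T is a spanning tree of G: its edges lie in G, it is (spanning) connected,
and it has n - 1 edges. -/
def IsSpanningTree (n : ℕ) (G : SimpleGraph (Fin n)) (T : Finset (Sym2 (Fin n))) : Prop :=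
  ↑T ⊆ G.edgeSet ∧ (SimpleGraph.fromEdgeSet (↑T : Set (Sym2 (Fin n)))).Connected ∧
    T.card = n - 1

/-- Product of edge weights of a tree. -/
def treeWt (n : ℕ) (w : Sym2 (Fin n) → ℝ) (T : Finset (Sym2 (Fin n))) : ℝ := ∏ e ∈ T, w e

/-- w-uniform spanning tree distribution: Pr[T] ∝ ∏_{e ∈ T} w_e. -/
def treeProb (n : ℕ) (G : SimpleGraph (Fin n)) (w : Sym2 (Fin n) → ℝ)
    (T : Finset (Sym2 (Fin n))) : ℝ :=
  (if IsSpanningTree n G T then treeWt n w T else 0) /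
    ∑ T' ∈ Finset.univ.filter (fun T' => IsSpanningTree n G T'), treeWt n w T'

/-- Leverage score of an edge: marginal probability of appearing in the random spanning tree. -/
def lev (n : ℕ) (G : SimpleGraph (Fin n)) (w : Sym2 (Fin n) → ℝ) (e : Sym2 (Fin n)) : ℝ :=
  ∑ T ∈ Finset.univ.filter (fun T => IsSpanningTree n G T ∧ e ∈ T), treeProb n G w T

/-- Inverse-leverage-score-weighted Laplacian of a tree. -/
def treeLap (n : ℕ) (G : SimpleGraph (Fin n)) (w : Sym2 (Fin n) → ℝ)
    (T : Finset (Sym2 (Fin n))) : Matrix (Fin n) (Fin n) ℝ :=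
  ∑ e ∈ T, (w e / lev n G w e) • edgeMat n e



namespace SST

set_option linter.unusedSectionVars false
set_option linter.style.haveILetI false

open Matrix Filter Topology

section Trotter

variable {𝔸 : Type*} [NormedRing 𝔸] [NormOneClass 𝔸]

lemma norm_pow_sub_pow_le (X Y : 𝔸) (M : ℝ) (hM : 1 ≤ M) (hX : ‖X‖ ≤ M) (hY : ‖Y‖ ≤ M) (N : ℕ) :
    ‖X ^ N - Y ^ N‖ ≤ N * ‖X - Y‖ * M ^ N := by
  have hM0 : 0 ≤ M := by linarith
  induction N with
  | zero => simp
  | succ N ih =>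
    have e : X ^ (N + 1) - Y ^ (N + 1) = X * (X ^ N - Y ^ N) + (X - Y) * Y ^ N := by
      rw [pow_succ', pow_succ']; noncomm_ring
    rw [e]
    have h1 : ‖X * (X ^ N - Y ^ N)‖ ≤ M * (N * ‖X - Y‖ * M ^ N) :=
      (norm_mul_le _ _).trans (mul_le_mul hX ih (norm_nonneg _) hM0)
    have h2 : ‖(X - Y) * Y ^ N‖ ≤ ‖X - Y‖ * M ^ (N + 1) := by
      refine (norm_mul_le _ _).trans (mul_le_mul_of_nonneg_left ?_ (norm_nonneg _))
      refine (norm_pow_le _ _).trans ?_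
      exact (pow_le_pow_left₀ (norm_nonneg _) hY N).trans (pow_le_pow_right₀ hM (Nat.le_succ N))
    refine (norm_add_le _ _).trans ((add_le_add h1 h2).trans (le_of_eq ?_))
    push_cast
    ring

variable [NormedAlgebra ℝ 𝔸] [CompleteSpace 𝔸]

lemma tendsto_smul_of_hasDerivAt (f : ℝ → 𝔸) (f' : 𝔸) (h : HasDerivAt f f' 0) :
    Tendsto (fun N : ℕ => (N : ℝ) • (f ((N : ℝ)⁻¹) - f 0)) atTop (𝓝 f') := by
  have h1 := h.tendsto_slope
  have h2 : Tendsto (fun N : ℕ => ((N : ℝ)⁻¹)) atTop (𝓝[≠] (0:ℝ)) := by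
    refine tendsto_nhdsWithin_iff.2 ⟨tendsto_inv_atTop_nhds_zero_nat, ?_⟩
    filter_upwards [eventually_gt_atTop 0] with N hN
    simp; omega
  have h3 := h1.comp h2
  refine h3.congr ?_
  intro N
  simp [slope_def_module]

lemma norm_bound_of_hasDerivAt (f : ℝ → 𝔸) (f' : 𝔸) (h : HasDerivAt f f' 0) (h0 : f 0 = 1) :
    ∀ᶠ N : ℕ in atTop, ‖f ((N : ℝ)⁻¹)‖ ≤ 1 + (‖f'‖ + 1) / N := by
  have h1 := (tendsto_smul_of_hasDerivAt f f' h).norm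
  have h2 := h1.eventually (gt_mem_nhds (lt_add_one ‖f'‖))
  filter_upwards [h2, eventually_gt_atTop 0] with N hN hN0
  rw [norm_smul, h0] at hN
  have hN0' : (0:ℝ) < N := by exact_mod_cast hN0
  have h3 : ‖f ((N : ℝ)⁻¹) - 1‖ ≤ (‖f'‖ + 1) / N := by
    rw [le_div_iff₀ hN0']
    simp at hN
    nlinarith
  calc ‖f ((N : ℝ)⁻¹)‖ = ‖1 + (f ((N : ℝ)⁻¹) - 1)‖ := by congr 1; abel
    _ ≤ ‖(1:𝔸)‖ + ‖f ((N : ℝ)⁻¹) - 1‖ := norm_add_le _ _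
    _ ≤ _ := by rw [norm_one]; linarith

lemma trotter (A B : 𝔸) :
    Tendsto (fun N : ℕ => (NormedSpace.exp ((N : ℝ)⁻¹ • A) * NormedSpace.exp ((N : ℝ)⁻¹ • B)) ^ N)
      atTop (𝓝 (NormedSpace.exp (A + B))) := by
  letI : NormedAlgebra ℚ 𝔸 := NormedAlgebra.restrictScalars ℚ ℝ 𝔸
  have dA := hasDerivAt_exp_smul_const (𝕂 := ℝ) A (0:ℝ)
  have dB := hasDerivAt_exp_smul_const (𝕂 := ℝ) B (0:ℝ)
  have dC := hasDerivAt_exp_smul_const (𝕂 := ℝ) (A + B) (0:ℝ)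
  have dX := dA.mul dB
  simp only [zero_smul, NormedSpace.exp_zero, one_mul, mul_one] at dX dC
  set X : ℝ → 𝔸 := fun u => NormedSpace.exp (u • A) * NormedSpace.exp (u • B) with hXdef
  set Y : ℝ → 𝔸 := fun u => NormedSpace.exp (u • (A + B)) with hYdef
  have dX' : HasDerivAt X (A + B) 0 := dX
  have hX0 : X 0 = 1 := by simp [hXdef]
  have hY0 : Y 0 = 1 := by simp [hYdef]
  have bX := norm_bound_of_hasDerivAt X _ dX' hX0
  have bY := norm_bound_of_hasDerivAt Y _ dC hY0
  have dD := dX'.sub dC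
  have tD := (tendsto_smul_of_hasDerivAt _ _ dD).norm
  simp only [sub_self, norm_zero] at tD
  set c := ‖A + B‖ + 1 with hc
  have hc0 : 0 ≤ c := by positivity
  have key : ∀ᶠ N : ℕ in atTop, ‖X ((N:ℝ)⁻¹) ^ N - NormedSpace.exp (A + B)‖ ≤
      ‖(N : ℝ) • ((X - Y) ((N : ℝ)⁻¹) - (X - Y) 0)‖ * Real.exp c := by
    filter_upwards [bX, bY, eventually_gt_atTop 0] with N h1 h2 hN
    have hN0 : (0:ℝ) < N := by exact_mod_cast hN
    have hYN : Y ((N:ℝ)⁻¹) ^ N = NormedSpace.exp (A + B) := by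
      simp only [hYdef]
      rw [← NormedSpace.exp_nsmul, ← Nat.cast_smul_eq_nsmul ℝ, smul_smul,
        mul_inv_cancel₀ hN0.ne', one_smul]
    rw [← hYN]
    have h3 := norm_pow_sub_pow_le (X ((N:ℝ)⁻¹)) (Y ((N:ℝ)⁻¹)) (1 + c / N)
      (by have : 0 ≤ c / N := by positivity
          linarith) h1 h2 N
    refine h3.trans ?_
    have h4 : (1 + c / N) ^ N ≤ Real.exp c := by
      have : (1 + c / N) ≤ Real.exp (c / N) := by
        have := Real.add_one_le_exp (c / N); linarith
      calc (1 + c / N) ^ N ≤ Real.exp (c / N) ^ N := pow_le_pow_left₀ (by positivity) this N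
        _ = Real.exp c := by rw [← Real.exp_nat_mul]; congr 1; field_simp
    have h5 : ‖(N : ℝ) • ((X - Y) ((N : ℝ)⁻¹) - (X - Y) 0)‖ =
        N * ‖X ((N:ℝ)⁻¹) - Y ((N:ℝ)⁻¹)‖ := by
      rw [norm_smul]; simp [hX0, hY0]
    rw [h5]
    exact mul_le_mul_of_nonneg_left h4 (by positivity)
  rw [tendsto_iff_norm_sub_tendsto_zero]
  have tE := tD.mul_const (Real.exp c)
  rw [zero_mul] at tE
  exact squeeze_zero' (Eventually.of_forall fun _ => norm_nonneg _) key tE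

end Trotter

section GT

variable {m : Type*} [Fintype m] [DecidableEq m]

lemma trace_mul_pow_comm (A B : Matrix m m ℝ) (N : ℕ) :
    ((A * B) ^ N).trace = ((B * A) ^ N).trace := by
  cases N with
  | zero => simp
  | succ N =>
    have h : ∀ N : ℕ, (A * B) ^ N * A = A * (B * A) ^ N := by
      intro N
      induction N with
      | zero => simp
      | succ N ih => rw [pow_succ', mul_assoc, ih, pow_succ', ]; simp only [mul_assoc]
    rw [pow_succ, ← mul_assoc, Matrix.trace_mul_comm, h N, ← mul_assoc, ← pow_succ']

lemma trace_transpose_mul_le (A B : Matrix m m ℝ) :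
    (A * B).trace ≤ ((A * Aᵀ).trace + (B * Bᵀ).trace) / 2 := by
  have h : 0 ≤ ((A - Bᵀ) * (A - Bᵀ)ᵀ).trace := by
    simp only [Matrix.trace, Matrix.diag, Matrix.mul_apply, Matrix.transpose_apply]
    exact Finset.sum_nonneg fun i _ => Finset.sum_nonneg fun j _ => mul_self_nonneg _
  have e : ((A - Bᵀ) * (A - Bᵀ)ᵀ).trace = (A * Aᵀ).trace + (B * Bᵀ).trace - 2 * (A * B).trace := by
    rw [Matrix.transpose_sub, Matrix.transpose_transpose, Matrix.sub_mul, Matrix.mul_sub,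
      Matrix.mul_sub]
    simp only [Matrix.trace_sub]
    rw [Matrix.trace_mul_comm Bᵀ B]
    have : (Bᵀ * Aᵀ).trace = (A * B).trace := by
      rw [← Matrix.transpose_mul, Matrix.trace_transpose]
    rw [this]; ring
  linarith

lemma trace_pow_joint (j : ℕ) :
    (∀ M : Matrix m m ℝ, (M ^ 2 ^ (j + 1)).trace ≤ ((M * Mᵀ) ^ 2 ^ j).trace) ∧
    (∀ P Q : Matrix m m ℝ, Pᵀ = P → Qᵀ = Q →
      ((P * Q) ^ 2 ^ j).trace ≤ (P ^ 2 ^ j * Q ^ 2 ^ j).trace) := by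
  induction j with
  | zero =>
    refine ⟨fun M => ?_, fun P Q _ _ => by simp⟩
    have := trace_transpose_mul_le M M
    simp [pow_two]
    linarith
  | succ j ih =>
    obtain ⟨ih1, ih2⟩ := ih
    constructor
    · intro M
      have h1 := ih1 (M ^ 2)
      rw [← pow_mul, ← pow_succ'] at h1
      refine h1.trans ?_
      have e1 : M ^ 2 * (M ^ 2)ᵀ = M * (M * Mᵀ * Mᵀ) := by
        rw [Matrix.transpose_pow]; simp only [pow_two, mul_assoc]
      rw [e1, trace_mul_pow_comm]
      have e2 : M * Mᵀ * Mᵀ * M = (M * Mᵀ) * (Mᵀ * M) := by simp only [mul_assoc]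
      rw [e2]
      have hP : (M * Mᵀ)ᵀ = M * Mᵀ := by simp
      have hQ : (Mᵀ * M)ᵀ = Mᵀ * M := by simp
      refine (ih2 _ _ hP hQ).trans ?_
      refine (trace_transpose_mul_le _ _).trans (le_of_eq ?_)
      rw [Matrix.transpose_pow, Matrix.transpose_pow, hP, hQ, ← pow_add, ← pow_add,
        trace_mul_pow_comm Mᵀ M, pow_succ' 2 j, two_mul (2 ^ j)]
      ring
    · intro P Q hP hQ
      refine (ih1 (P * Q)).trans ?_
      have e1 : P * Q * (P * Q)ᵀ = P * (Q ^ 2 * P) := by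
        rw [Matrix.transpose_mul, hP, hQ]; simp only [pow_two, mul_assoc]
      rw [e1, trace_mul_pow_comm]
      have e2 : Q ^ 2 * P * P = Q ^ 2 * P ^ 2 := by simp only [pow_two, mul_assoc]
      rw [e2]
      refine (ih2 _ _ (by rw [Matrix.transpose_pow, hQ]) (by rw [Matrix.transpose_pow, hP])).trans
        (le_of_eq ?_)
      rw [← pow_mul, ← pow_mul, ← pow_succ', Matrix.trace_mul_comm]

open scoped Matrix.Norms.Operator in
/-- Golden–Thompson inequality for real symmetric matrices. -/
theorem golden_thompson (A B : Matrix m m ℝ) (hA : Aᵀ = A) (hB : Bᵀ = B) :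
    (NormedSpace.exp (A + B)).trace ≤ (NormedSpace.exp A * NormedSpace.exp B).trace := by
  cases isEmpty_or_nonempty m with
  | inl h => simp [Matrix.trace]
  | inr h =>
    have t1 := trotter A B
    have t2 : Tendsto (fun j : ℕ => 2 ^ j) atTop atTop :=
      tendsto_pow_atTop_atTop_of_one_lt (by norm_num)
    have t3 := t1.comp t2
    have hc : Continuous (fun M : Matrix m m ℝ => M.trace) := continuous_id.matrix_trace
    have t4 := (hc.tendsto _).comp t3
    refine le_of_tendsto t4 (Eventually.of_forall fun j => ?_)
    simp only [Function.comp]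
    have sA : (NormedSpace.exp (((2 ^ j : ℕ) : ℝ)⁻¹ • A))ᵀ = NormedSpace.exp (((2 ^ j : ℕ) : ℝ)⁻¹ • A) := by
      rw [← Matrix.exp_transpose, Matrix.transpose_smul, hA]
    have sB : (NormedSpace.exp (((2 ^ j : ℕ) : ℝ)⁻¹ • B))ᵀ = NormedSpace.exp (((2 ^ j : ℕ) : ℝ)⁻¹ • B) := by
      rw [← Matrix.exp_transpose, Matrix.transpose_smul, hB]
    refine ((trace_pow_joint j).2 _ _ sA sB).trans (le_of_eq ?_)
    have hN : ((2 ^ j : ℕ) : ℝ) ≠ 0 := by positivity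
    have e : ∀ C : Matrix m m ℝ, NormedSpace.exp (((2 ^ j : ℕ) : ℝ)⁻¹ • C) ^ 2 ^ j = NormedSpace.exp C := by
      intro C
      rw [← Matrix.exp_nsmul, ← Nat.cast_smul_eq_nsmul ℝ, smul_smul, mul_inv_cancel₀ hN, one_smul]
    rw [e, e]

end GT

section PSD

variable {m : Type*} [Fintype m]

lemma qf_nonneg {M : Matrix m m ℝ} (h : M.PosSemidef) (x : m → ℝ) : 0 ≤ x ⬝ᵥ (M *ᵥ x) := by
  simpa using h.dotProduct_mulVec_nonneg x

lemma psd_of_qf {M : Matrix m m ℝ} (hs : Mᵀ = M) (h : ∀ x : m → ℝ, 0 ≤ x ⬝ᵥ (M *ᵥ x)) :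
    M.PosSemidef :=
  .of_dotProduct_mulVec_nonneg (by simpa [Matrix.IsHermitian, Matrix.conjTranspose_eq_transpose_of_trivial] using hs)
    (by simpa using h)

lemma psd_symm {M : Matrix m m ℝ} (h : M.PosSemidef) : Mᵀ = M := by
  have := h.isHermitian
  simpa [Matrix.IsHermitian, Matrix.conjTranspose_eq_transpose_of_trivial] using this

variable [DecidableEq m]

lemma exists_factor {M : Matrix m m ℝ} (h : M.PosSemidef) : ∃ B : Matrix m m ℝ, M = Bᵀ * B := by
  have hH := h.isHermitian
  have hs := hH.spectral_theorem
  rw [Unitary.conjStarAlgAut_apply] at hs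
  set U : Matrix m m ℝ := (hH.eigenvectorUnitary : Matrix m m ℝ) with hU
  refine ⟨diagonal (fun i => √(hH.eigenvalues i)) * Uᵀ, ?_⟩
  rw [Matrix.transpose_mul, Matrix.transpose_transpose, Matrix.diagonal_transpose]
  conv_lhs => rw [hs]
  have : diagonal (RCLike.ofReal ∘ hH.eigenvalues) =
      diagonal (fun i => √(hH.eigenvalues i)) * diagonal (fun i => √(hH.eigenvalues i)) := by
    rw [Matrix.diagonal_mul_diagonal]
    congr 1; ext i
    simp [Real.mul_self_sqrt (h.eigenvalues_nonneg i)]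
  rw [this, Matrix.star_eq_conjTranspose, Matrix.conjTranspose_eq_transpose_of_trivial]
  simp only [mul_assoc]

lemma trace_mul_psd_nonneg {M N : Matrix m m ℝ} (hM : M.PosSemidef) (hN : N.PosSemidef) :
    0 ≤ (M * N).trace := by
  obtain ⟨B, rfl⟩ := exists_factor hM
  rw [Matrix.trace_mul_cycle, Matrix.trace_mul_comm, ← mul_assoc]
  have : (B * N * Bᵀ).PosSemidef := by
    simpa [Matrix.conjTranspose_eq_transpose_of_trivial] using hN.mul_mul_conjTranspose_same B
  have h2 := this.trace_nonneg
  rwa [mul_assoc] at h2 ⊢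

open scoped Matrix.Norms.Operator in
/-- Transfer rule: inequalities between eigenvalue functions. -/
lemma exp_spectral {M : Matrix m m ℝ} (h : Mᵀ = M) :
    ∃ (U : Matrix m m ℝ) (d : m → ℝ), U * Uᵀ = 1 ∧ Uᵀ * U = 1 ∧ M = U * diagonal d * Uᵀ ∧
      NormedSpace.exp M = U * diagonal (fun i => Real.exp (d i)) * Uᵀ := by
  have hH : M.IsHermitian := by
    simpa [Matrix.IsHermitian, Matrix.conjTranspose_eq_transpose_of_trivial] using h
  have hs := hH.spectral_theorem
  rw [Unitary.conjStarAlgAut_apply] at hs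
  set U : Matrix m m ℝ := (hH.eigenvectorUnitary : Matrix m m ℝ) with hU
  have h1 : U * Uᵀ = 1 := by
    have : U * star U = 1 := Unitary.coe_mul_star_self hH.eigenvectorUnitary
    rwa [Matrix.star_eq_conjTranspose, Matrix.conjTranspose_eq_transpose_of_trivial] at this
  have h2 : Uᵀ * U = 1 := by
    have : star U * U = 1 := Unitary.coe_star_mul_self hH.eigenvectorUnitary
    rwa [Matrix.star_eq_conjTranspose, Matrix.conjTranspose_eq_transpose_of_trivial] at this
  have h3 : M = U * diagonal hH.eigenvalues * Uᵀ := by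
    conv_lhs => rw [hs]
    rw [Matrix.star_eq_conjTranspose, Matrix.conjTranspose_eq_transpose_of_trivial]
    rfl
  refine ⟨U, hH.eigenvalues, h1, h2, h3, ?_⟩
  have hinv : U⁻¹ = Uᵀ := Matrix.inv_eq_right_inv h1
  have hu : IsUnit U := IsUnit.of_mul_eq_one _ h1
  conv_lhs => rw [h3, ← hinv]
  rw [Matrix.exp_conj _ _ hu, Matrix.exp_diagonal, hinv]
  congr 3
  ext i
  rw [Pi.coe_exp, Real.exp_eq_exp_ℝ]

lemma psd_conj_diag (U : Matrix m m ℝ) (d : m → ℝ) (hd : ∀ i, 0 ≤ d i) :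
    (U * diagonal d * Uᵀ).PosSemidef := by
  have : (diagonal d).PosSemidef := Matrix.PosSemidef.diagonal hd
  simpa [Matrix.conjTranspose_eq_transpose_of_trivial] using this.mul_mul_conjTranspose_same U

lemma exp_psd {M : Matrix m m ℝ} (h : Mᵀ = M) : (NormedSpace.exp M).PosSemidef := by
  obtain ⟨U, d, _, _, _, h4⟩ := exp_spectral h
  rw [h4]
  exact psd_conj_diag _ _ fun i => (Real.exp_pos _).le

lemma exp_ge {M : Matrix m m ℝ} (h : Mᵀ = M) : (NormedSpace.exp M - (1 + M)).PosSemidef := by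
  obtain ⟨U, d, h1, _, h3, h4⟩ := exp_spectral h
  have : NormedSpace.exp M - (1 + M) = U * diagonal (fun i => Real.exp (d i) - (1 + d i)) * Uᵀ := by
    rw [h4]
    conv_lhs => rw [h3, ← h1]
    rw [← Matrix.diagonal_sub, ← Matrix.diagonal_add, Matrix.diagonal_one]
    noncomm_ring
  rw [this]
  exact psd_conj_diag _ _ fun i => by have := Real.add_one_le_exp (d i); linarith

lemma exp_le {M : Matrix m m ℝ} (h : Mᵀ = M) (hu : (1 - M).PosSemidef) :
    ((1 + M + M * M) - NormedSpace.exp M).PosSemidef := by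
  obtain ⟨U, d, h1, h2, h3, h4⟩ := exp_spectral h
  have hd : ∀ i, d i ≤ 1 := by
    intro i
    have := hu.mul_mul_conjTranspose_same Uᵀ
    rw [Matrix.conjTranspose_eq_transpose_of_trivial, Matrix.transpose_transpose, h3] at this
    have e : Uᵀ * (1 - U * diagonal d * Uᵀ) * U = 1 - diagonal d := by
      have : Uᵀ * (1 - U * diagonal d * Uᵀ) * U = Uᵀ * U - (Uᵀ * U) * diagonal d * (Uᵀ * U) := by
        noncomm_ring
      rw [this, h2]; simp
    rw [e] at this
    have := this.diag_nonneg (i := i)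
    simpa using this
  have : (1 + M + M * M) - NormedSpace.exp M =
      U * diagonal (fun i => (1 + d i + d i * d i) - Real.exp (d i)) * Uᵀ := by
    rw [h4]
    have hMM : M * M = U * (diagonal d * diagonal d) * Uᵀ := by
      conv_lhs => rw [h3]
      have : U * diagonal d * Uᵀ * (U * diagonal d * Uᵀ) = U * diagonal d * (Uᵀ * U) * diagonal d * Uᵀ := by
        noncomm_ring
      rw [this, h2]; noncomm_ring
    rw [hMM]
    conv_lhs => rw [h3, ← h1]
    rw [← Matrix.diagonal_sub, ← Matrix.diagonal_add, ← Matrix.diagonal_add, Matrix.diagonal_one,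
      ← Matrix.diagonal_mul_diagonal]
    noncomm_ring
  rw [this]
  refine psd_conj_diag _ _ fun i => ?_
  have hx := hd i
  set x := d i
  by_cases h0 : -1 ≤ x
  · have := Real.abs_exp_sub_one_sub_id_le (x := x) (abs_le.2 ⟨h0, hx⟩)
    have := (abs_le.1 this).2
    nlinarith
  · push Not at h0
    have : Real.exp x ≤ 1 := Real.exp_le_one_iff.2 (by linarith)
    nlinarith

end PSD

end SST

namespace SST

set_option linter.unusedSectionVars false
set_option linter.unusedVariables false

open Matrix

section Proc

variable {m ι : Type*} [Fintype m] [DecidableEq m] [Fintype ι] 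

/-- normalised rank one matrix -/
noncomputable def Amat (v : ι → m → ℝ) (e : ι) : Matrix m m ℝ :=
  (v e ⬝ᵥ v e)⁻¹ • vecMulVec (v e) (v e)

/-- expected remaining sum -/
noncomputable def Rmat (v : ι → m → ℝ) (Q : Matrix m m ℝ) : Matrix m m ℝ :=
  ∑ f, (v f ⬝ᵥ (Q *ᵥ v f)) • Amat v f

/-- the projected square norm -/
noncomputable def lv (v : ι → m → ℝ) (Q : Matrix m m ℝ) (e : ι) : ℝ := v e ⬝ᵥ (Q *ᵥ v e)

/-- rank one matrix of the projected vector -/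
noncomputable def Pmat (v : ι → m → ℝ) (Q : Matrix m m ℝ) (e : ι) : Matrix m m ℝ :=
  vecMulVec (Q *ᵥ v e) (Q *ᵥ v e)

/-- updated projection -/
noncomputable def Qn (v : ι → m → ℝ) (Q : Matrix m m ℝ) (e : ι) : Matrix m m ℝ :=
  Q - (lv v Q e)⁻¹ • Pmat v Q e

lemma qf_vecMulVec (u x y : m → ℝ) : x ⬝ᵥ (vecMulVec u u *ᵥ y) = (u ⬝ᵥ x) * (u ⬝ᵥ y) := by
  rw [Matrix.vecMulVec_mulVec]
  simp [dotProduct_comm, mul_comm]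

lemma vecMulVec_symm (u : m → ℝ) : (vecMulVec u u)ᵀ = vecMulVec u u := by
  ext i j; simp [vecMulVec_apply, mul_comm]

lemma symm_dot {Q : Matrix m m ℝ} (h : Qᵀ = Q) (x y : m → ℝ) : x ⬝ᵥ (Q *ᵥ y) = (Q *ᵥ x) ⬝ᵥ y := by
  rw [Matrix.dotProduct_mulVec, ← Matrix.mulVec_transpose, h]

lemma dot_self_nonneg (x : m → ℝ) : 0 ≤ x ⬝ᵥ x :=
  Finset.sum_nonneg fun i _ => mul_self_nonneg _

lemma cauchy (x y : m → ℝ) : (x ⬝ᵥ y) ^ 2 ≤ (x ⬝ᵥ x) * (y ⬝ᵥ y) := by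
  have := Finset.sum_mul_sq_le_sq_mul_sq Finset.univ x y
  simpa [dotProduct, pow_two] using this

lemma vecMulVec_psd (u : m → ℝ) : (vecMulVec u u).PosSemidef :=
  psd_of_qf (vecMulVec_symm u) fun x => by rw [qf_vecMulVec]; exact mul_self_nonneg _

lemma Amat_psd (v : ι → m → ℝ) (e : ι) : (Amat v e).PosSemidef :=
  (vecMulVec_psd (v e)).smul (inv_nonneg.2 (dot_self_nonneg _))

lemma Amat_le (v : ι → m → ℝ) (e : ι) : (1 - Amat v e).PosSemidef := by
  refine psd_of_qf (by rw [Matrix.transpose_sub, psd_symm (Amat_psd v e), Matrix.transpose_one]) fun x => ?_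
  rw [Matrix.sub_mulVec, dotProduct_sub, Matrix.one_mulVec, Amat, Matrix.smul_mulVec,
    dotProduct_smul, qf_vecMulVec, smul_eq_mul]
  have h := cauchy (v e) x
  rcases (dot_self_nonneg (v e)).eq_or_lt with h0 | h0
  · rw [← h0]; simpa using dot_self_nonneg x
  · rw [sub_nonneg, inv_mul_le_iff₀ h0]; nlinarith

lemma smul_Amat (v : ι → m → ℝ) (e : ι) : (v e ⬝ᵥ v e) • Amat v e = vecMulVec (v e) (v e) := by
  rw [Amat, smul_smul]
  by_cases h : v e ⬝ᵥ v e = 0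
  · have : v e = 0 := dotProduct_self_eq_zero.1 h
    simp [this]
  · rw [mul_inv_cancel₀ h, one_smul]

lemma Rmat_sub (v : ι → m → ℝ) (P Q : Matrix m m ℝ) : Rmat v (P - Q) = Rmat v P - Rmat v Q := by
  simp [Rmat, Matrix.sub_mulVec, dotProduct_sub, sub_smul, Finset.sum_sub_distrib]

lemma Rmat_smul (v : ι → m → ℝ) (c : ℝ) (Q : Matrix m m ℝ) : Rmat v (c • Q) = c • Rmat v Q := by
  simp [Rmat, Matrix.smul_mulVec, dotProduct_smul, Finset.smul_sum, smul_smul]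

lemma Rmat_zero (v : ι → m → ℝ) : Rmat v 0 = 0 := by simp [Rmat]

lemma Rmat_sum (v : ι → m → ℝ) (f : ι → Matrix m m ℝ) :
    Rmat v (∑ e, f e) = ∑ e, Rmat v (f e) := by
  unfold Rmat
  rw [Finset.sum_comm]
  refine Finset.sum_congr rfl fun a _ => ?_
  rw [← Finset.sum_smul]
  congr 1
  rw [Matrix.sum_mulVec, dotProduct_sum]

lemma Rmat_psd (v : ι → m → ℝ) {Q : Matrix m m ℝ} (h : Q.PosSemidef) : (Rmat v Q).PosSemidef :=
  Matrix.posSemidef_sum _ fun f _ => (Amat_psd v f).smul (qf_nonneg h _)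

variable {v : ι → m → ℝ}

lemma Rmat_one (hv : ∑ e, vecMulVec (v e) (v e) = 1) : Rmat v 1 = 1 := by
  rw [Rmat]
  conv_rhs => rw [← hv]
  refine Finset.sum_congr rfl fun e _ => ?_
  rw [Matrix.one_mulVec, smul_Amat]

lemma Rmat_le (hv : ∑ e, vecMulVec (v e) (v e) = 1) {Q : Matrix m m ℝ} (h : (1 - Q).PosSemidef) :
    (1 - Rmat v Q).PosSemidef := by
  have := Rmat_psd v h
  rwa [Rmat_sub, Rmat_one hv] at this

lemma proj_psd {Q : Matrix m m ℝ} (h1 : Qᵀ = Q) (h2 : Q * Q = Q) : Q.PosSemidef := by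
  refine psd_of_qf h1 fun x => ?_
  rw [← h2, ← Matrix.mulVec_mulVec, symm_dot h1]
  exact dot_self_nonneg _

lemma proj_le {Q : Matrix m m ℝ} (h1 : Qᵀ = Q) (h2 : Q * Q = Q) : (1 - Q).PosSemidef := by
  refine proj_psd (by simp [h1]) ?_
  rw [Matrix.sub_mul, Matrix.mul_sub, Matrix.mul_sub, h2]; simp

lemma proj_zero {Q : Matrix m m ℝ} (h1 : Qᵀ = Q) (h2 : Q * Q = Q) (h3 : Q.trace = 0) : Q = 0 := by
  exact (proj_psd h1 h2).trace_eq_zero_iff.1 h3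

lemma lv_eq {Q : Matrix m m ℝ} (h1 : Qᵀ = Q) (h2 : Q * Q = Q) (e : ι) :
    lv v Q e = (Q *ᵥ v e) ⬝ᵥ (Q *ᵥ v e) := by
  rw [lv]; conv_lhs => rw [← h2, ← Matrix.mulVec_mulVec, symm_dot h1]

lemma lv_nonneg {Q : Matrix m m ℝ} (h1 : Qᵀ = Q) (h2 : Q * Q = Q) (e : ι) : 0 ≤ lv v Q e := by
  rw [lv_eq h1 h2]; exact dot_self_nonneg _

lemma lv_zero {Q : Matrix m m ℝ} (h1 : Qᵀ = Q) (h2 : Q * Q = Q) {e : ι} (h : lv v Q e = 0) :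
    Q *ᵥ v e = 0 := by
  rw [lv_eq h1 h2] at h; exact dotProduct_self_eq_zero.1 h

lemma sum_lv (hv : ∑ e, vecMulVec (v e) (v e) = 1) (Q : Matrix m m ℝ) :
    ∑ e, lv v Q e = Q.trace := by
  have : ∀ e, lv v Q e = (Q * vecMulVec (v e) (v e)).trace := by
    intro e
    rw [Matrix.mul_vecMulVec, Matrix.trace_vecMulVec, lv, dotProduct_comm]
  simp_rw [this]
  rw [← Matrix.trace_sum, ← Finset.mul_sum, hv, mul_one]

lemma sum_Pmat (hv : ∑ e, vecMulVec (v e) (v e) = 1) {Q : Matrix m m ℝ} (h1 : Qᵀ = Q)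
    (h2 : Q * Q = Q) : ∑ e, Pmat v Q e = Q := by
  have : ∀ e, Pmat v Q e = Q * vecMulVec (v e) (v e) * Q := by
    intro e
    rw [Pmat, Matrix.mul_vecMulVec, Matrix.vecMulVec_mul, ← Matrix.mulVec_transpose, h1]
  simp_rw [this]
  rw [← Finset.sum_mul, ← Finset.mul_sum, hv, mul_one, h2]

lemma lv_smul_inv {Q : Matrix m m ℝ} (h1 : Qᵀ = Q) (h2 : Q * Q = Q) (e : ι) :
    lv v Q e • ((lv v Q e)⁻¹ • Pmat v Q e) = Pmat v Q e := by
  rw [smul_smul]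
  by_cases h : lv v Q e = 0
  · have := lv_zero h1 h2 h
    simp [Pmat, this]
  · rw [mul_inv_cancel₀ h, one_smul]

lemma Qn_symm {Q : Matrix m m ℝ} (h1 : Qᵀ = Q) (e : ι) : (Qn v Q e)ᵀ = Qn v Q e := by
  rw [Qn, Matrix.transpose_sub, Matrix.transpose_smul, Pmat, vecMulVec_symm, h1]

lemma Qn_idem {Q : Matrix m m ℝ} (h1 : Qᵀ = Q) (h2 : Q * Q = Q) {e : ι} (h : lv v Q e ≠ 0) :
    Qn v Q e * Qn v Q e = Qn v Q e := by
  have a1 : Q * Pmat v Q e = Pmat v Q e := by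
    rw [Pmat, Matrix.mul_vecMulVec, Matrix.mulVec_mulVec, h2]
  have a2 : Pmat v Q e * Q = Pmat v Q e := by
    rw [Pmat, Matrix.vecMulVec_mul, ← Matrix.mulVec_transpose, h1, Matrix.mulVec_mulVec, h2]
  have a3 : Pmat v Q e * Pmat v Q e = lv v Q e • Pmat v Q e := by
    rw [lv_eq h1 h2, Pmat, Matrix.vecMulVec_mul_vecMulVec]
    ext i j
    simp [vecMulVec_apply]
    ring
  rw [Qn, Matrix.sub_mul, Matrix.mul_sub, Matrix.mul_sub, h2, Matrix.mul_smul, a1, Matrix.smul_mul, a2,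
    Matrix.smul_mul, Matrix.mul_smul, a3, smul_smul (lv v Q e)⁻¹ (lv v Q e), inv_mul_cancel₀ h, one_smul,
    sub_self, sub_zero]

lemma Qn_trace {Q : Matrix m m ℝ} (h1 : Qᵀ = Q) (h2 : Q * Q = Q) {e : ι} (h : lv v Q e ≠ 0) :
    (Qn v Q e).trace = Q.trace - 1 := by
  rw [Qn, Matrix.trace_sub, Matrix.trace_smul, Pmat, Matrix.trace_vecMulVec, ← lv_eq h1 h2,
    smul_eq_mul, inv_mul_cancel₀ h]

lemma unit_le {Q : Matrix m m ℝ} (h1 : Qᵀ = Q) (h2 : Q * Q = Q) (e : ι) :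
    (1 - (lv v Q e)⁻¹ • Pmat v Q e).PosSemidef := by
  have := Amat_le (fun e => Q *ᵥ v e) e
  rwa [Amat, ← lv_eq h1 h2] at this

lemma unit_psd {Q : Matrix m m ℝ} (h1 : Qᵀ = Q) (h2 : Q * Q = Q) (e : ι) :
    ((lv v Q e)⁻¹ • Pmat v Q e).PosSemidef :=
  (vecMulVec_psd _).smul (inv_nonneg.2 (lv_nonneg h1 h2 e))

lemma sub_sq_psd {A : Matrix m m ℝ} (h : A.PosSemidef) (h' : (1 - A).PosSemidef) :
    (A - A * A).PosSemidef := by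
  have e : A - A * A = A * (1 - A) * Aᴴ + (1 - A) * A * (1 - A)ᴴ := by
    rw [h.isHermitian, h'.isHermitian]; noncomm_ring
  rw [e]
  exact (h'.mul_mul_conjTranspose_same A).add (h.mul_mul_conjTranspose_same (1 - A))

lemma delta_sq {A R : Matrix m m ℝ} (h : A.PosSemidef) (h' : (1 - A).PosSemidef)
    (g : R.PosSemidef) (g' : (1 - R).PosSemidef) :
    ((2:ℝ) • (A + R) - (A - R) * (A - R)).PosSemidef := by
  have hs := h.add g
  have e : (2:ℝ) • (A + R) - (A - R) * (A - R) =
      (2:ℝ) • (A - A * A) + (2:ℝ) • (R - R * R) + (A + R) * 1 * (A + R)ᴴ := by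
    rw [hs.isHermitian]; simp only [two_smul]; noncomm_ring
  rw [e]
  exact ((((sub_sq_psd h h').smul (by norm_num)).add ((sub_sq_psd g g').smul (by norm_num)))).add
    (Matrix.PosSemidef.one.mul_mul_conjTranspose_same _)

lemma trace_mul_mono {Z M N : Matrix m m ℝ} (hZ : Z.PosSemidef) (h : (N - M).PosSemidef) :
    (Z * M).trace ≤ (Z * N).trace := by
  have := trace_mul_psd_nonneg hZ h
  rw [Matrix.mul_sub, Matrix.trace_sub] at this
  linarith

lemma exp_step {A R Z : Matrix m m ℝ} (hZ : Zᵀ = Z) (h : A.PosSemidef) (h' : (1 - A).PosSemidef)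
    (g : R.PosSemidef) (g' : (1 - R).PosSemidef) {θ : ℝ} (hθ : |θ| ≤ 1) :
    (NormedSpace.exp (Z + θ • (A - R))).trace ≤
      (NormedSpace.exp Z * (1 + θ • (A - R) + (2 * θ ^ 2) • (A + R))).trace := by
  have hs : (θ • (A - R))ᵀ = θ • (A - R) := by
    rw [Matrix.transpose_smul, Matrix.transpose_sub, psd_symm h, psd_symm g]
  refine (golden_thompson _ _ hZ hs).trans ?_
  refine trace_mul_mono (exp_psd hZ) ?_
  have h1 : (1 - θ • (A - R)).PosSemidef := by
    refine psd_of_qf (by rw [Matrix.transpose_sub, hs, Matrix.transpose_one]) fun x => ?_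
    have q1 := qf_nonneg h x
    have q2 := qf_nonneg h' x
    have q3 := qf_nonneg g x
    have q4 := qf_nonneg g' x
    simp only [Matrix.sub_mulVec, Matrix.one_mulVec, Matrix.smul_mulVec, dotProduct_sub,
      dotProduct_smul, smul_eq_mul] at *
    obtain ⟨t1, t2⟩ := abs_le.1 hθ
    nlinarith
  have h2 := exp_le hs h1
  have h3 := (delta_sq h h' g g').smul (sq_nonneg θ)
  have := h2.add h3
  convert this using 1
  rw [smul_sub (θ ^ 2), smul_smul, Matrix.smul_mul, Matrix.mul_smul, smul_smul, mul_comm 2, ← pow_two]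
  abel

lemma step (hv : ∑ e, vecMulVec (v e) (v e) = 1) {Q Z : Matrix m m ℝ} (h1 : Qᵀ = Q)
    (h2 : Q * Q = Q) (hZ : Zᵀ = Z) {θ : ℝ} (hθ : |θ| ≤ 1) :
    ∑ e, lv v Q e * (NormedSpace.exp (Z + θ • (Amat v e - Rmat v ((lv v Q e)⁻¹ • Pmat v Q e)))).trace ≤
      (Q.trace + 4 * θ ^ 2) * (NormedSpace.exp Z).trace := by
  have hb : ∀ e, lv v Q e * (NormedSpace.exp (Z + θ • (Amat v e - Rmat v ((lv v Q e)⁻¹ • Pmat v Q e)))).trace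
      ≤ (NormedSpace.exp Z * (lv v Q e • 1 + θ • (lv v Q e • Amat v e - Rmat v (Pmat v Q e)) +
        (2 * θ ^ 2) • (lv v Q e • Amat v e + Rmat v (Pmat v Q e)))).trace := by
    intro e
    have := exp_step hZ (Amat_psd v e) (Amat_le v e) (Rmat_psd v (unit_psd (v := v) h1 h2 e))
      (Rmat_le hv (unit_le (v := v) h1 h2 e)) hθ
    refine (mul_le_mul_of_nonneg_left this (lv_nonneg h1 h2 e)).trans (le_of_eq ?_)
    rw [← smul_eq_mul, ← Matrix.trace_smul, ← Matrix.mul_smul]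
    congr 2
    conv_rhs => rw [← lv_smul_inv (v := v) h1 h2 e, Rmat_smul]
    simp only [smul_add, smul_sub, smul_smul]
    simp only [mul_comm]
  refine (Finset.sum_le_sum fun e _ => hb e).trans ?_
  rw [← Matrix.trace_sum, ← Finset.mul_sum]
  have e1 : ∑ e, (lv v Q e • (1 : Matrix m m ℝ) + θ • (lv v Q e • Amat v e - Rmat v (Pmat v Q e)) +
        (2 * θ ^ 2) • (lv v Q e • Amat v e + Rmat v (Pmat v Q e))) =
        Q.trace • 1 + (4 * θ ^ 2) • Rmat v Q := by
    have a1 : ∑ e, lv v Q e • Amat v e = Rmat v Q := rfl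
    have a2 : ∑ e, Rmat v (Pmat v Q e) = Rmat v Q := by rw [← Rmat_sum, sum_Pmat hv h1 h2]
    rw [Finset.sum_add_distrib, Finset.sum_add_distrib, ← Finset.smul_sum, ← Finset.smul_sum,
      Finset.sum_sub_distrib, Finset.sum_add_distrib, a1, a2, ← Finset.sum_smul, sum_lv hv,
      sub_self, smul_zero, add_zero, ← two_smul ℝ, smul_smul]
    congr 2; ring
  rw [e1]
  have : (NormedSpace.exp Z * (Q.trace • 1 + (4 * θ ^ 2) • Rmat v Q)).trace ≤
      (NormedSpace.exp Z * (Q.trace • 1 + (4 * θ ^ 2) • 1)).trace := by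
    refine trace_mul_mono (exp_psd hZ) ?_
    have := (Rmat_le hv (proj_le h1 h2)).smul (show 0 ≤ 4 * θ ^ 2 by positivity)
    convert this using 1
    rw [smul_sub]; abel
  refine this.trans (le_of_eq ?_)
  rw [← add_smul, Matrix.mul_smul, Matrix.trace_smul, mul_one, smul_eq_mul]

/-- Gram determinant -/
noncomputable def Dt (v : ι → m → ℝ) (Q : Matrix m m ℝ) {k : ℕ} (e : Fin k → ι) : ℝ :=
  (Matrix.of fun i j => v (e i) ⬝ᵥ (Q *ᵥ v (e j))).det

lemma Qn_form {Q : Matrix m m ℝ} (h1 : Qᵀ = Q) (a : ι) (x y : m → ℝ) :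
    x ⬝ᵥ (Qn v Q a *ᵥ y) =
      x ⬝ᵥ (Q *ᵥ y) - (lv v Q a)⁻¹ * ((x ⬝ᵥ (Q *ᵥ v a)) * (v a ⬝ᵥ (Q *ᵥ y))) := by
  rw [Qn, Matrix.sub_mulVec, dotProduct_sub, Matrix.smul_mulVec, dotProduct_smul, Pmat,
    qf_vecMulVec, smul_eq_mul, symm_dot h1 (v a) y, dotProduct_comm (Q *ᵥ v a) x]

lemma Dt_cons {Q : Matrix m m ℝ} (h1 : Qᵀ = Q) (h2 : Q * Q = Q) {k : ℕ} (a : ι) (e : Fin k → ι) :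
    Dt v Q (Fin.cons a e : Fin (k + 1) → ι) = lv v Q a * Dt v (Qn v Q a) e := by
  by_cases h : lv v Q a = 0
  · rw [h, zero_mul, Dt]
    refine Matrix.det_eq_zero_of_row_eq_zero 0 fun j => ?_
    rw [Matrix.of_apply, Fin.cons_zero, symm_dot h1, lv_zero h1 h2 h, zero_dotProduct]
  · set G : Matrix (Fin (k+1)) (Fin (k+1)) ℝ :=
      Matrix.of fun i j => v ((Fin.cons a e : Fin (k + 1) → ι) i) ⬝ᵥ (Q *ᵥ v ((Fin.cons a e : Fin (k + 1) → ι) j)) with hG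
    set c : Fin (k+1) → ℝ := Fin.cons 0 (fun i => (lv v Q a)⁻¹ * (v (e i) ⬝ᵥ (Q *ᵥ v a))) with hc
    set B : Matrix (Fin (k+1)) (Fin (k+1)) ℝ := Matrix.of fun i j => G i j - c i * G 0 j with hB
    have hB0 : ∀ j, B 0 j = G 0 j := by intro j; simp [hB, hc]
    have hdet : G.det = B.det := by
      refine Matrix.det_eq_of_forall_row_eq_smul_add_const c 0 (by simp [hc]) ?_
      intro i j
      rw [hB0]; simp [hB]
    have hG00 : G 0 0 = lv v Q a := by simp [hG, lv]
    rw [Dt, hdet, Matrix.det_succ_column_zero, Fin.sum_univ_succ]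
    have hz : ∀ i : Fin k, B i.succ 0 = 0 := by
      intro i
      simp only [hB, Matrix.of_apply, hc, Fin.cons_succ, hG00]
      simp only [hG, Matrix.of_apply, Fin.cons_succ, Fin.cons_zero]
      field_simp
      ring
    simp only [hz]
    simp only [mul_zero, zero_mul, Finset.sum_const_zero, add_zero, Fin.val_zero, pow_zero, one_mul, hB0, hG00]
    congr 1
    rw [Dt]
    congr 1
    ext i j
    simp only [Matrix.submatrix_apply, Fin.succAbove_zero, Matrix.of_apply, Qn_form h1, hB, hc, hG, Fin.cons_succ, Fin.cons_zero]
    ring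

lemma sum_Dt_succ {Q : Matrix m m ℝ} (h1 : Qᵀ = Q) (h2 : Q * Q = Q) {k : ℕ}
    (F : (Fin (k + 1) → ι) → ℝ) :
    ∑ e : Fin (k + 1) → ι, Dt v Q e * F e =
      ∑ a, lv v Q a * ∑ e : Fin k → ι, Dt v (Qn v Q a) e * F (Fin.cons a e) := by
  rw [← (Fin.consEquiv (fun _ : Fin (k + 1) => ι)).sum_comp, Fintype.sum_prod_type]
  refine Finset.sum_congr rfl fun a _ => ?_
  rw [Finset.mul_sum]
  refine Finset.sum_congr rfl fun e _ => ?_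
  show Dt v Q (Fin.cons a e : Fin (k + 1) → ι) * F (Fin.cons a e) = _
  rw [Dt_cons h1 h2, mul_assoc]

lemma sum_Dt (hv : ∑ e, vecMulVec (v e) (v e) = 1) (k : ℕ) : ∀ (Q : Matrix m m ℝ), Qᵀ = Q →
    Q * Q = Q → Q.trace = k → ∑ e : Fin k → ι, Dt v Q e = k.factorial := by
  induction k with
  | zero => intro Q _ _ _; simp [Dt]
  | succ k ih =>
    intro Q h1 h2 h3
    have := sum_Dt_succ (v := v) h1 h2 (k := k) (fun _ => 1)
    simp only [mul_one] at this
    rw [this]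
    have : ∀ a, lv v Q a * ∑ e : Fin k → ι, Dt v (Qn v Q a) e = lv v Q a * k.factorial := by
      intro a
      by_cases h : lv v Q a = 0
      · rw [h]; simp
      · rw [ih _ (Qn_symm h1 a) (Qn_idem h1 h2 h) (by rw [Qn_trace h1 h2 h, h3]; push_cast; ring)]
    simp_rw [this]
    rw [← Finset.sum_mul, sum_lv hv, h3, Nat.factorial_succ]; push_cast; ring

lemma sum_Dt_marginal (hv : ∑ e, vecMulVec (v e) (v e) = 1) (g : ι → ℝ) (k : ℕ) :
    ∀ (Q : Matrix m m ℝ), Qᵀ = Q →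
    Q * Q = Q → Q.trace = k → ∑ e : Fin k → ι, Dt v Q e * ∑ i, g (e i) =
      k.factorial * ∑ f, g f * lv v Q f := by
  induction k with
  | zero =>
    intro Q h1 h2 h3
    have := proj_zero h1 h2 (by simpa using h3)
    simp [this, lv]
  | succ k ih =>
    intro Q h1 h2 h3
    rw [sum_Dt_succ (v := v) h1 h2 (k := k)]
    have : ∀ a, lv v Q a * ∑ e : Fin k → ι, Dt v (Qn v Q a) e *
        ∑ i, g ((Fin.cons a e : Fin (k + 1) → ι) i) =
        k.factorial * (g a * lv v Q a + ∑ f, g f *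
          (lv v Q a * lv v Q f - (v f ⬝ᵥ (Pmat v Q a *ᵥ v f)))) := by
      intro a
      by_cases h : lv v Q a = 0
      · rw [h]; simp [Pmat, lv_zero h1 h2 h]
      · have t : (Qn v Q a).trace = k := by rw [Qn_trace h1 h2 h, h3]; push_cast; ring
        simp only [Fin.sum_univ_succ, Fin.cons_zero, Fin.cons_succ, mul_add, Finset.sum_add_distrib]
        rw [ih _ (Qn_symm h1 a) (Qn_idem h1 h2 h) t, ← Finset.sum_mul,
          sum_Dt hv k _ (Qn_symm h1 a) (Qn_idem h1 h2 h) t]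
        rw [Finset.mul_sum, Finset.mul_sum, Finset.mul_sum]
        congr 1
        · ring
        · refine Finset.sum_congr rfl fun f _ => ?_
          have : lv v (Qn v Q a) f = lv v Q f - (lv v Q a)⁻¹ * (v f ⬝ᵥ (Pmat v Q a *ᵥ v f)) := by
            rw [lv, Qn, Matrix.sub_mulVec, dotProduct_sub, Matrix.smul_mulVec, dotProduct_smul]; rfl
          rw [this]
          field_simp
    simp_rw [this]
    rw [← Finset.mul_sum, Finset.sum_add_distrib, Finset.sum_comm]
    have : ∀ f, ∑ a, g f * (lv v Q a * lv v Q f - (v f ⬝ᵥ (Pmat v Q a *ᵥ v f))) =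
        g f * (k * lv v Q f) := by
      intro f
      rw [← Finset.mul_sum, Finset.sum_sub_distrib, ← Finset.sum_mul, sum_lv hv, ← dotProduct_sum,
        ← Matrix.sum_mulVec, sum_Pmat hv h1 h2, h3]
      rw [lv]; push_cast; ring
    simp_rw [this]
    rw [← Finset.sum_add_distrib, Nat.factorial_succ, Finset.mul_sum, Finset.mul_sum]
    refine Finset.sum_congr rfl fun f _ => ?_
    push_cast; ring

lemma sum_Dt_exp (hv : ∑ e, vecMulVec (v e) (v e) = 1) {θ : ℝ} (hθ : |θ| ≤ 1) (k : ℕ) :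
    ∀ (Q Y : Matrix m m ℝ), Qᵀ = Q →
    Q * Q = Q → Q.trace = k → Yᵀ = Y →
    ∑ e : Fin k → ι, Dt v Q e * (NormedSpace.exp (Y + θ • ∑ i, Amat v (e i))).trace ≤
      (∏ i ∈ Finset.range k, ((i:ℝ) + 1 + 4 * θ ^ 2)) * (NormedSpace.exp (Y + θ • Rmat v Q)).trace := by
  induction k with
  | zero =>
    intro Q Y h1 h2 h3 hY
    have := proj_zero h1 h2 (by simpa using h3)
    simp [this, Dt, Rmat_zero]
  | succ k ih =>
    intro Q Y h1 h2 h3 hY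
    rw [sum_Dt_succ (v := v) h1 h2 (k := k)]
    have hR : (Rmat v Q)ᵀ = Rmat v Q := psd_symm (Rmat_psd v (proj_psd h1 h2))
    have hZ : (Y + θ • Rmat v Q)ᵀ = Y + θ • Rmat v Q := by
      rw [Matrix.transpose_add, Matrix.transpose_smul, hY, hR]
    have hp : 0 ≤ ∏ i ∈ Finset.range k, ((i:ℝ) + 1 + 4 * θ ^ 2) :=
      Finset.prod_nonneg fun i _ => by positivity
    have : ∀ a, lv v Q a * ∑ e : Fin k → ι, Dt v (Qn v Q a) e *
        (NormedSpace.exp (Y + θ • ∑ i, Amat v ((Fin.cons a e : Fin (k + 1) → ι) i))).trace ≤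
        (∏ i ∈ Finset.range k, ((i:ℝ) + 1 + 4 * θ ^ 2)) * (lv v Q a *
         (NormedSpace.exp ((Y + θ • Rmat v Q) + θ • (Amat v a - Rmat v ((lv v Q a)⁻¹ • Pmat v Q a)))).trace) := by
      intro a
      by_cases h : lv v Q a = 0
      · rw [h]; simp
      · have t : (Qn v Q a).trace = k := by rw [Qn_trace h1 h2 h, h3]; push_cast; ring
        have hYa : (Y + θ • Amat v a)ᵀ = Y + θ • Amat v a := by
          rw [Matrix.transpose_add, Matrix.transpose_smul, hY, psd_symm (Amat_psd v a)]
        have := ih (Qn v Q a) (Y + θ • Amat v a) (Qn_symm h1 a) (Qn_idem h1 h2 h) t hYa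
        have h5 := mul_le_mul_of_nonneg_left this (lv_nonneg (v := v) h1 h2 a)
        simp only [Fin.sum_univ_succ, Fin.cons_zero, Fin.cons_succ]
        refine (le_of_eq ?_).trans (h5.trans (le_of_eq ?_))
        · simp only [smul_add, add_assoc]
        · rw [Qn, Rmat_sub]
          simp only [smul_sub]
          rw [mul_left_comm]
          congr 4
          abel
    refine (Finset.sum_le_sum fun a _ => this a).trans ?_
    rw [← Finset.mul_sum, Finset.prod_range_succ, mul_assoc]
    refine mul_le_mul_of_nonneg_left ?_ hp
    refine (step hv h1 h2 hZ hθ).trans (le_of_eq ?_)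
    rw [h3]; push_cast; ring

end Proc

end SST

namespace SST

open Matrix

section Tail

variable {m τ : Type*} [Fintype m] [DecidableEq m] [Fintype τ]

lemma exp_le_trace {M : Matrix m m ℝ} (h : Mᵀ = M) {s : ℝ} (hs : ¬ (s • (1 : Matrix m m ℝ) - M).PosSemidef) :
    Real.exp s ≤ (NormedSpace.exp M).trace := by
  obtain ⟨U, d, h1, h2, h3, h4⟩ := exp_spectral h
  have : ∃ i, s < d i := by
    by_contra hc
    push Not at hc
    apply hs
    have e : s • (1 : Matrix m m ℝ) - M = U * diagonal (fun i => s - d i) * Uᵀ := by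
      conv_lhs => rw [h3, ← h1]
      rw [← Matrix.diagonal_sub, Matrix.mul_sub, Matrix.sub_mul]
      congr 1
      have : diagonal (fun _ : m => s) = s • (1 : Matrix m m ℝ) := by
        rw [← Matrix.diagonal_one, ← Matrix.diagonal_smul]; congr 1; ext; simp
      rw [this]; simp
    rw [e]
    exact psd_conj_diag _ _ fun i => by linarith [hc i]
  obtain ⟨i, hi⟩ := this
  rw [h4, Matrix.trace_mul_cycle, h2, one_mul, Matrix.trace_diagonal]
  refine (Real.exp_le_exp.2 hi.le).trans ?_
  exact Finset.single_le_sum (f := fun i => Real.exp (d i)) (fun j _ => (Real.exp_pos _).le) (Finset.mem_univ i)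

lemma trace_exp_nonneg {M : Matrix m m ℝ} (h : Mᵀ = M) : 0 ≤ (NormedSpace.exp M).trace :=
  (exp_psd h).trace_nonneg

lemma prod_mgf (p : τ → ℝ) (hp : ∀ T, 0 ≤ p T) (X : τ → Matrix m m ℝ) (hX : ∀ T, (X T)ᵀ = X T)
    {θ K : ℝ} (hK : 0 ≤ K)
    (H : ∀ Y : Matrix m m ℝ, Yᵀ = Y → ∑ T, p T * (NormedSpace.exp (Y + θ • X T)).trace ≤
      K * (NormedSpace.exp (Y + θ • (1 : Matrix m m ℝ))).trace) (t : ℕ) :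
    ∀ Y : Matrix m m ℝ, Yᵀ = Y →
    ∑ Ts : Fin t → τ, (∏ i, p (Ts i)) * (NormedSpace.exp (Y + θ • ∑ i, (X (Ts i) - 1))).trace ≤
      K ^ t * (NormedSpace.exp Y).trace := by
  induction t with
  | zero => intro Y hY; simp
  | succ t ih =>
    intro Y hY
    rw [← (Fin.consEquiv (fun _ : Fin (t + 1) => τ)).sum_comp, Fintype.sum_prod_type]
    have h1 : ∀ T, ∑ Ts : Fin t → τ, (∏ i, p ((Fin.consEquiv (fun _ : Fin (t + 1) => τ)) (T, Ts) i)) *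
        (NormedSpace.exp (Y + θ • ∑ i, (X ((Fin.consEquiv (fun _ : Fin (t + 1) => τ)) (T, Ts) i) - 1))).trace
        ≤ K ^ t * (p T * (NormedSpace.exp ((Y - θ • (1 : Matrix m m ℝ)) + θ • X T)).trace) := by
      intro T
      have := ih ((Y - θ • (1 : Matrix m m ℝ)) + θ • X T) (by
        simp [Matrix.transpose_add, Matrix.transpose_sub, Matrix.transpose_smul, hY, hX])
      have := mul_le_mul_of_nonneg_left this (hp T)
      rw [mul_left_comm] at this
      refine (le_of_eq ?_).trans this
      rw [Finset.mul_sum]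
      refine Finset.sum_congr rfl fun Ts _ => ?_
      simp only [Fin.consEquiv_apply, Fin.prod_univ_succ, Fin.sum_univ_succ, Fin.cons_zero, Fin.cons_succ]
      rw [mul_assoc]
      congr 4
      rw [smul_add, smul_sub]
      generalize θ • ∑ i, (X (Ts i) - 1) = W
      abel
    refine (Finset.sum_le_sum fun T _ => h1 T).trans ?_
    rw [← Finset.mul_sum, pow_succ, mul_assoc]
    refine mul_le_mul_of_nonneg_left ?_ (pow_nonneg hK t)
    have := H (Y - θ • (1 : Matrix m m ℝ)) (by simp [Matrix.transpose_sub, Matrix.transpose_smul, hY])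
    simpa using this

theorem abstract_tail (p : τ → ℝ) (hp : ∀ T, 0 ≤ p T) (hsum : ∑ T, p T = 1)
    (X : τ → Matrix m m ℝ) (hX : ∀ T, (X T)ᵀ = X T) (n : ℕ) (hn : 2 ≤ n)
    (hm : Fintype.card m + 1 = n)
    (H : ∀ θ : ℝ, |θ| ≤ 1 → ∀ Y : Matrix m m ℝ, Yᵀ = Y →
      ∑ T, p T * (NormedSpace.exp (Y + θ • X T)).trace ≤
      Real.exp (12 * θ ^ 2 * Real.log n) * (NormedSpace.exp (Y + θ • (1 : Matrix m m ℝ))).trace)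
    (ε : ℝ) (h0 : 0 < ε) (h1 : ε < 1) (t : ℕ) (ht : 144 * ε⁻¹ ^ 2 * Real.log n ^ 2 ≤ t)
    (G : (Fin t → τ) → Prop) [DecidablePred G]
    (hG : ∀ Ts : Fin t → τ, (∀ i, p (Ts i) ≠ 0) →
      (((t : ℝ) * ε) • (1 : Matrix m m ℝ) - ∑ i, (X (Ts i) - 1)).PosSemidef →
      (((t : ℝ) * ε) • (1 : Matrix m m ℝ) + ∑ i, (X (Ts i) - 1)).PosSemidef → G Ts) :
    1 - (n : ℝ) ^ (-(1:ℝ)) ≤ ∑ Ts ∈ Finset.univ.filter G, ∏ i, p (Ts i) := by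
  set ℓ := Real.log n with hℓ
  have hn' : (2:ℝ) ≤ n := by exact_mod_cast hn
  have hl : 0.69 < ℓ := by
    have h2 : Real.log 2 ≤ ℓ := Real.log_le_log (by norm_num) hn'
    have := Real.log_two_gt_d9
    linarith
  have hl0 : 0 < ℓ := by linarith
  set θ := ε / (24 * ℓ) with hθ
  have hθ0 : 0 < θ := by positivity
  have hθ1 : θ ≤ 1 := by
    rw [hθ, div_le_one (by positivity)]; linarith
  set S : (Fin t → τ) → Matrix m m ℝ := fun Ts => ∑ i, (X (Ts i) - 1) with hS
  have hSs : ∀ Ts, (S Ts)ᵀ = S Ts := by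
    intro Ts
    simp only [hS, Matrix.transpose_sum, Matrix.transpose_sub, Matrix.transpose_one, hX]
  have hprod : ∀ Ts : Fin t → τ, 0 ≤ ∏ i, p (Ts i) := fun Ts => Finset.prod_nonneg fun i _ => hp _
  have hall : ∑ Ts : Fin t → τ, ∏ i, p (Ts i) = 1 := by
    have := Fintype.sum_pow p t
    rw [← this, hsum, one_pow]
  set s := θ * (t * ε) with hs
  -- pointwise bound
  have hpt : ∀ Ts, ¬ G Ts → ∏ i, p (Ts i) ≤ Real.exp (-s) * ((∏ i, p (Ts i)) *
      (NormedSpace.exp (0 + θ • S Ts)).trace + (∏ i, p (Ts i)) * (NormedSpace.exp (0 + (-θ) • S Ts)).trace) := by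
    intro Ts hTs
    have n1 : 0 ≤ (NormedSpace.exp (θ • S Ts)).trace := trace_exp_nonneg (by rw [Matrix.transpose_smul, hSs])
    have n2 : 0 ≤ (NormedSpace.exp ((-θ) • S Ts)).trace := trace_exp_nonneg (by rw [Matrix.transpose_smul, hSs])
    rw [zero_add, zero_add]
    by_cases hz : ∏ i, p (Ts i) = 0
    · rw [hz]; simp
    have hz' : ∀ i, p (Ts i) ≠ 0 := fun i => (Finset.prod_ne_zero_iff.1 hz) i (Finset.mem_univ i)
    have hor : Real.exp s ≤ (NormedSpace.exp (θ • S Ts)).trace + (NormedSpace.exp ((-θ) • S Ts)).trace := by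
      by_cases c1 : (((t : ℝ) * ε) • (1 : Matrix m m ℝ) - S Ts).PosSemidef
      · by_cases c2 : (((t : ℝ) * ε) • (1 : Matrix m m ℝ) + S Ts).PosSemidef
        · exact absurd (hG Ts hz' c1 c2) hTs
        · have := exp_le_trace (M := (-θ) • S Ts) (s := s) (by rw [Matrix.transpose_smul, hSs]) (by
            intro hc
            apply c2
            have := hc.smul (inv_nonneg.2 hθ0.le)
            convert this using 1
            rw [smul_sub, smul_smul, smul_smul, hs, mul_neg, inv_mul_cancel₀ hθ0.ne', inv_mul_cancel_left₀ hθ0.ne']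
            simp)
          linarith
      · have := exp_le_trace (M := θ • S Ts) (s := s) (by rw [Matrix.transpose_smul, hSs]) (by
            intro hc
            apply c1
            have := hc.smul (inv_nonneg.2 hθ0.le)
            convert this using 1
            rw [smul_sub, smul_smul, smul_smul, hs, inv_mul_cancel₀ hθ0.ne', inv_mul_cancel_left₀ hθ0.ne']
            simp)
        linarith
    rw [← mul_add, mul_left_comm]
    have : 1 ≤ Real.exp (-s) * ((NormedSpace.exp (θ • S Ts)).trace + (NormedSpace.exp ((-θ) • S Ts)).trace) := by
      calc (1:ℝ) = Real.exp (-s) * Real.exp s := by rw [← Real.exp_add]; simp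
        _ ≤ _ := mul_le_mul_of_nonneg_left hor (Real.exp_pos _).le
    exact le_mul_of_one_le_right (hprod Ts) this
  have tr0 : (NormedSpace.exp (0 : Matrix m m ℝ)).trace = Fintype.card m := by
    rw [NormedSpace.exp_zero, Matrix.trace_one]
  have m1 := prod_mgf p hp X hX (Real.exp_pos _).le (H θ (by rwa [abs_of_pos hθ0])) t 0 (by simp)
  have m2 := prod_mgf p hp X hX (Real.exp_pos _).le (H (-θ) (by rwa [abs_neg, abs_of_pos hθ0])) t 0 (by simp)
  rw [tr0] at m1 m2
  rw [neg_sq] at m2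
  have hsplit := Finset.sum_filter_add_sum_filter_not Finset.univ G (fun Ts : Fin t → τ => ∏ i, p (Ts i))
  rw [hall] at hsplit
  have hbad : ∑ Ts ∈ Finset.univ.filter (fun Ts => ¬ G Ts), ∏ i, p (Ts i) ≤
      Real.exp (-s) * (2 * (Real.exp (12 * θ ^ 2 * ℓ) ^ t * Fintype.card m)) := by
    refine (Finset.sum_le_sum fun Ts hTs => hpt Ts (Finset.mem_filter.1 hTs).2).trans ?_
    rw [← Finset.mul_sum]
    refine mul_le_mul_of_nonneg_left ?_ (Real.exp_pos _).le
    refine (Finset.sum_le_sum_of_subset_of_nonneg (Finset.filter_subset _ _) ?_).trans ?_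
    · intro Ts _ _
      have n1 : 0 ≤ (NormedSpace.exp (0 + θ • S Ts)).trace :=
        trace_exp_nonneg (by rw [zero_add, Matrix.transpose_smul, hSs])
      have n2 : 0 ≤ (NormedSpace.exp (0 + (-θ) • S Ts)).trace :=
        trace_exp_nonneg (by rw [zero_add, Matrix.transpose_smul, hSs])
      have := hprod Ts
      positivity
    · rw [Finset.sum_add_distrib]
      linarith
  have hexp : Real.exp (-s) * Real.exp (12 * θ ^ 2 * ℓ) ^ t ≤ Real.exp (-(3 * ℓ)) := by
    rw [← Real.exp_nat_mul, ← Real.exp_add]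
    apply Real.exp_le_exp.2
    have e1 : -s + t * (12 * θ ^ 2 * ℓ) = -(t * ε ^ 2 / (48 * ℓ)) := by
      rw [hs, hθ]; field_simp; ring
    rw [e1, neg_le_neg_iff, le_div_iff₀ (by positivity)]
    have : 144 * ε⁻¹ ^ 2 * ℓ ^ 2 * ε ^ 2 ≤ t * ε ^ 2 := mul_le_mul_of_nonneg_right ht (by positivity)
    have e2 : 144 * ε⁻¹ ^ 2 * ℓ ^ 2 * ε ^ 2 = 144 * ℓ ^ 2 := by field_simp
    nlinarith
  have hn0 : (0:ℝ) < n := by linarith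
  have hexp3 : Real.exp (-(3 * ℓ)) = ((n:ℝ) ^ 3)⁻¹ := by
    rw [Real.exp_neg, hℓ, show (3:ℝ) * Real.log n = ((3:ℕ):ℝ) * Real.log n by norm_num, Real.exp_nat_mul, Real.exp_log hn0]
  have hcard : (Fintype.card m : ℝ) ≤ n := by
    rw [← hm]; push_cast; linarith
  have hfin : Real.exp (-s) * (2 * (Real.exp (12 * θ ^ 2 * ℓ) ^ t * Fintype.card m)) ≤ (n:ℝ)⁻¹ := by
    calc Real.exp (-s) * (2 * (Real.exp (12 * θ ^ 2 * ℓ) ^ t * Fintype.card m))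
        = (Real.exp (-s) * Real.exp (12 * θ ^ 2 * ℓ) ^ t) * (2 * Fintype.card m) := by ring
      _ ≤ ((n:ℝ) ^ 3)⁻¹ * (n * n) := by
        rw [← hexp3]
        refine mul_le_mul hexp ?_ (by positivity) (Real.exp_pos _).le
        have : (0:ℝ) ≤ Fintype.card m := by positivity
        nlinarith
      _ = (n:ℝ)⁻¹ := by field_simp
  rw [Real.rpow_neg_one]
  linarith

lemma prod_bound (k : ℕ) (hk : 1 ≤ k) (θ : ℝ) :
    ∏ i ∈ Finset.range k, ((i:ℝ) + 1 + 4 * θ ^ 2) ≤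
      k.factorial * Real.exp (12 * θ ^ 2 * Real.log ((k + 1 : ℕ) : ℝ)) := by
  have h1 : ∏ i ∈ Finset.range k, ((i:ℝ) + 1 + 4 * θ ^ 2) ≤
      k.factorial * Real.exp (4 * θ ^ 2 * (harmonic k : ℝ)) := by
    clear hk
    induction k with
    | zero => simp
    | succ k ih =>
      rw [Finset.prod_range_succ, harmonic_succ, Nat.factorial_succ]
      push_cast
      have : ((k:ℝ) + 1 + 4 * θ ^ 2) ≤ (k + 1) * Real.exp (4 * θ ^ 2 * ((k:ℝ) + 1)⁻¹) := by
        have := Real.add_one_le_exp (4 * θ ^ 2 * ((k:ℝ) + 1)⁻¹)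
        have h2 := mul_le_mul_of_nonneg_left this (show (0:ℝ) ≤ k + 1 by positivity)
        refine (le_of_eq ?_).trans h2
        field_simp; ring
      refine (mul_le_mul ih this (by positivity) (by positivity)).trans (le_of_eq ?_)
      rw [mul_add, Real.exp_add]; ring
  refine h1.trans (mul_le_mul_of_nonneg_left ?_ (by positivity))
  apply Real.exp_le_exp.2
  have h2 := harmonic_le_one_add_log k
  have h3 : Real.log k ≤ Real.log ((k + 1 : ℕ) : ℝ) :=
    Real.log_le_log (by exact_mod_cast hk) (by exact_mod_cast Nat.le_succ k)
  have h4 : Real.log 2 ≤ Real.log ((k + 1 : ℕ) : ℝ) :=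
    Real.log_le_log (by norm_num) (by exact_mod_cast (by omega : 2 ≤ k + 1))
  have := Real.log_two_gt_d9
  nlinarith [sq_nonneg θ]

end Tail

end SST
namespace SST

lemma sum_injective {α : Type*} [Fintype α] [DecidableEq α] (k : ℕ) (f : Finset α → ℝ) :
    ∑ e : Fin k → α, (if Function.Injective e then f (Finset.univ.image e) else 0) =
      k.factorial * ∑ T : Finset α, (if T.card = k then f T else 0) := by
  classical
  rw [← Finset.sum_fiberwise Finset.univ (fun e : Fin k → α => Finset.univ.image e), Finset.mul_sum]
  refine Finset.sum_congr rfl fun T _ => ?_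
  have h1 : ∑ e ∈ Finset.univ.filter (fun e : Fin k → α => Finset.univ.image e = T),
      (if Function.Injective e then f (Finset.univ.image e) else 0) =
      ((Finset.univ.filter (fun e : Fin k → α => Finset.univ.image e = T ∧ Function.Injective e)).card : ℝ) * f T := by
    rw [← Finset.sum_filter, Finset.filter_filter, ← nsmul_eq_mul, ← Finset.sum_const]
    refine Finset.sum_congr rfl fun e he => ?_
    rw [(Finset.mem_filter.1 he).2.1]
  rw [h1]
  split_ifs with hT
  · congr 2
    have : Finset.univ.filter (fun e : Fin k → α => Finset.univ.image e = T ∧ Function.Injective e) =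
        (Finset.univ : Finset (Fin k ↪ T)).image (fun g i => (g i : α)) := by
      ext e
      simp only [Finset.mem_filter, Finset.mem_univ, true_and, Finset.mem_image]
      constructor
      · rintro ⟨h1, h2⟩
        refine ⟨⟨fun i => ⟨e i, by rw [← h1]; exact Finset.mem_image_of_mem _ (Finset.mem_univ i)⟩, ?_⟩, ?_⟩
        · intro i j hij
          exact h2 (by simpa using hij)
        · rfl
      · rintro ⟨g, rfl⟩
        have hinj : Function.Injective (fun i => (g i : α)) := fun i j hij => g.injective (Subtype.ext hij)
        refine ⟨?_, hinj⟩
        refine Finset.eq_of_subset_of_card_le ?_ ?_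
        · intro a ha
          obtain ⟨i, _, rfl⟩ := Finset.mem_image.1 ha
          exact (g i).2
        · rw [Finset.card_image_of_injective _ hinj, hT]; simp
    rw [this, Finset.card_image_of_injective, Finset.card_univ, Fintype.card_embedding_eq]
    · simp [hT, Nat.descFactorial_self]
    · intro g g' h
      ext i
      exact congrFun h i
  · have : Finset.univ.filter (fun e : Fin k → α => Finset.univ.image e = T ∧ Function.Injective e) = ∅ := by
      refine Finset.filter_eq_empty_iff.2 ?_
      rintro e - ⟨h1, h2⟩
      apply hT
      rw [← h1, Finset.card_image_of_injective _ h2]; simp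
    rw [this]; simp

section Graph

variable {k : ℕ}

/-- A chosen pair of endpoints. -/
def ends (e : Sym2 (Fin (k + 1))) : Fin (k + 1) × Fin (k + 1) :=
  Classical.choose (show ∃ p : Fin (k + 1) × Fin (k + 1), e = s(p.1, p.2) by
    induction e with | _ a b => exact ⟨(a, b), rfl⟩)

lemma ends_eq (e : Sym2 (Fin (k + 1))) : e = s((ends e).1, (ends e).2) :=
  Classical.choose_spec (show ∃ p : Fin (k + 1) × Fin (k + 1), e = s(p.1, p.2) by
    induction e with | _ a b => exact ⟨(a, b), rfl⟩)

/-- Grounded signed incidence vector. -/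
def bvec (e : Sym2 (Fin (k + 1))) (j : Fin k) : ℤ :=
  (if (ends e).1 = j.succ then 1 else 0) - (if (ends e).2 = j.succ then 1 else 0)

lemma sum_ite_succ {R : Type*} [CommRing R] (y : Fin (k + 1) → R) (h0 : y 0 = 0) (a : Fin (k + 1)) :
    ∑ j : Fin k, (if a = j.succ then (1:R) else 0) * y j.succ = y a := by
  have : ∑ j : Fin (k + 1), (if a = j then (1:R) else 0) * y j = y a := by simp
  rw [Fin.sum_univ_succ, h0, mul_zero, zero_add] at this
  exact this

lemma bvec_dot {R : Type*} [CommRing R] (y : Fin (k + 1) → R) (h0 : y 0 = 0) (e : Sym2 (Fin (k + 1))) :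
    ∑ j, ((bvec e j : ℤ) : R) * y j.succ = y (ends e).1 - y (ends e).2 := by
  rw [← sum_ite_succ y h0 (ends e).1, ← sum_ite_succ y h0 (ends e).2, ← Finset.sum_sub_distrib]
  refine Finset.sum_congr rfl fun j _ => ?_
  rw [bvec]; push_cast; ring

/-- grounded incidence matrix of a tuple of edges -/
def Bm (e : Fin k → Sym2 (Fin (k + 1))) : Matrix (Fin k) (Fin k) ℤ := Matrix.of fun i j => bvec (e i) j

lemma det_of_connected (e : Fin k → Sym2 (Fin (k + 1)))
    (h : (SimpleGraph.fromEdgeSet (Set.range e)).Connected) : (Bm e).det ^ 2 = 1 := by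
  have key : ∀ u : Fin (k + 1), ∃ c : Fin k → ℤ, ∀ j, ∑ i, c i * bvec (e i) j = if u = j.succ then 1 else 0 := by
    have step : ∀ a b : Fin (k + 1), (SimpleGraph.fromEdgeSet (Set.range e)).Walk a b →
        (∃ c : Fin k → ℤ, ∀ j, ∑ i, c i * bvec (e i) j = if b = j.succ then 1 else 0) →
        (∃ c : Fin k → ℤ, ∀ j, ∑ i, c i * bvec (e i) j = if a = j.succ then 1 else 0) := by
      intro a b p
      induction p with
      | nil => exact id
      | @cons u x y hadj p ih =>
        intro hy
        obtain ⟨c, hc⟩ := ih hy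
        rw [SimpleGraph.fromEdgeSet_adj] at hadj
        obtain ⟨⟨i, hi⟩, -⟩ := hadj
        have h2 := ends_eq (e i)
        rw [hi] at h2
        have hb : ∀ s : ℤ, ∀ j, ∑ l, (c + Pi.single i s : Fin k → ℤ) l * bvec (e l) j =
            (if x = j.succ then 1 else 0) + s * bvec (e i) j := by
          intro s j
          simp only [Pi.add_apply, add_mul, Finset.sum_add_distrib, hc]
          congr 1
          rw [Finset.sum_eq_single i]
          · simp
          · intro l _ hl; simp [hl]
          · simp
        rcases Sym2.eq_iff.1 h2 with ⟨h3, h4⟩ | ⟨h3, h4⟩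
        · refine ⟨c + Pi.single i 1, fun j => ?_⟩
          rw [hb, bvec, hi, ← h3, ← h4]; ring
        · refine ⟨c + Pi.single i (-1), fun j => ?_⟩
          rw [hb, bvec, hi, ← h3, ← h4]; ring
    intro u
    obtain ⟨p⟩ := h.preconnected u 0
    refine step u 0 p ⟨0, fun j => ?_⟩
    simp [(Fin.succ_ne_zero j).symm]
  choose c hc using key
  have hN : (Matrix.of fun (u : Fin k) i => c u.succ i) * Bm e = 1 := by
    ext u j
    rw [Matrix.mul_apply]
    simp only [Bm, Matrix.of_apply, hc, Matrix.one_apply, Fin.succ_inj]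
  have hd := congrArg Matrix.det hN
  rw [Matrix.det_mul, Matrix.det_one] at hd
  have := Int.isUnit_iff.1 (IsUnit.of_mul_eq_one_right _ hd)
  rcases this with h | h <;> rw [h] <;> norm_num

lemma det_of_not_connected (e : Fin k → Sym2 (Fin (k + 1)))
    (h : ¬ (SimpleGraph.fromEdgeSet (Set.range e)).Connected) : (Bm e).det = 0 := by
  set Γ := SimpleGraph.fromEdgeSet (Set.range e) with hΓ
  have hu : ∃ u, ¬ Γ.Reachable 0 u := by
    by_contra hc
    push Not at hc
    apply h
    exact { preconnected := fun a b => (hc a).symm.trans (hc b), nonempty := inferInstance }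
  obtain ⟨u, hu⟩ := hu
  have hu0 : u ≠ 0 := by rintro rfl; exact hu (SimpleGraph.Reachable.refl _)
  obtain ⟨u', rfl⟩ := Fin.exists_succ_eq.2 hu0
  rw [← Matrix.exists_mulVec_eq_zero_iff]
  set φ : Fin (k + 1) → ℤ := fun a => if Γ.Reachable 0 a then 0 else 1 with hφ
  have h0 : φ 0 = 0 := by simp [hφ]
  refine ⟨fun j => φ j.succ, ?_, ?_⟩
  · intro hz
    have := congrFun hz u'
    simp [hφ, hu] at this
  · ext i
    have := bvec_dot φ h0 (e i)
    simp only [Int.cast_id] at this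
    simp only [Matrix.mulVec, dotProduct, Bm, Matrix.of_apply, Pi.zero_apply]
    rw [this, sub_eq_zero]
    by_cases hab : (ends (e i)).1 = (ends (e i)).2
    · rw [hab]
    · have hadj : Γ.Adj (ends (e i)).1 (ends (e i)).2 := by
        rw [hΓ, SimpleGraph.fromEdgeSet_adj]
        exact ⟨⟨i, ends_eq (e i)⟩, hab⟩
      have : Γ.Reachable 0 (ends (e i)).1 ↔ Γ.Reachable 0 (ends (e i)).2 :=
        ⟨fun hr => hr.trans hadj.reachable, fun hr => hr.trans hadj.symm.reachable⟩
      simp only [hφ, this]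

end Graph

end SST

namespace SST

section Setup

variable {k : ℕ}

/-- Real grounded incidence vector. -/
def bR (e : Sym2 (Fin (k + 1))) : Fin k → ℝ := fun j => ((bvec e j : ℤ) : ℝ)

/-- Edge weights extended by zero. -/
def wx (G : SimpleGraph (Fin (k + 1))) (w : Sym2 (Fin (k + 1)) → ℝ) (e : Sym2 (Fin (k + 1))) : ℝ :=
  if e ∈ G.edgeSet then w e else 0

/-- Isotropic vectors. -/
def vv (G : SimpleGraph (Fin (k + 1))) (w : Sym2 (Fin (k + 1)) → ℝ) (B : Matrix (Fin k) (Fin k) ℝ)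
    (e : Sym2 (Fin (k + 1))) : Fin k → ℝ := Real.sqrt (wx G w e) • (bR e ᵥ* B⁻¹)

variable {G : SimpleGraph (Fin (k + 1))} {w : Sym2 (Fin (k + 1)) → ℝ}

lemma wx_nonneg (hw : ∀ e ∈ G.edgeSet, 0 < w e) (e : Sym2 (Fin (k + 1))) : 0 ≤ wx G w e := by
  unfold wx; split_ifs with h
  · exact (hw e h).le
  · exact le_rfl

lemma bR_dot (x : Fin (k + 1) → ℝ) (e : Sym2 (Fin (k + 1))) :
    bR e ⬝ᵥ (fun j : Fin k => x j.succ - x 0) = x (ends e).1 - x (ends e).2 := by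
  have := bvec_dot (fun a => x a - x 0) (by simp) e
  simp only [dotProduct, bR]
  rw [this]; ring

lemma exists_B (hG : G.Connected) (hw : ∀ e ∈ G.edgeSet, 0 < w e) :
    ∃ B : Matrix (Fin k) (Fin k) ℝ, B.det ≠ 0 ∧
      Bᵀ * B = ∑ e, wx G w e • vecMulVec (bR e) (bR e) := by
  have hpsd : (∑ e, wx G w e • vecMulVec (bR e) (bR e) : Matrix (Fin k) (Fin k) ℝ).PosSemidef := by
    refine Matrix.posSemidef_sum _ fun e _ => (vecMulVec_psd (bR e)).smul (wx_nonneg hw e)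
  obtain ⟨B, hB⟩ := exists_factor hpsd
  refine ⟨B, ?_, hB.symm⟩
  intro hdet
  obtain ⟨y, hy0, hy⟩ := Matrix.exists_mulVec_eq_zero_iff.2 hdet
  apply hy0
  have h1 : y ⬝ᵥ ((∑ e, wx G w e • vecMulVec (bR e) (bR e) : Matrix (Fin k) (Fin k) ℝ) *ᵥ y) = 0 := by
    rw [hB, ← Matrix.mulVec_mulVec, hy]; simp
  have h2 : ∑ e, wx G w e * (bR e ⬝ᵥ y) ^ 2 = 0 := by
    rw [← h1, Matrix.sum_mulVec, dotProduct_sum]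
    refine Finset.sum_congr rfl fun e _ => ?_
    rw [Matrix.smul_mulVec, dotProduct_smul, qf_vecMulVec, smul_eq_mul]; ring
  have h3 := (Finset.sum_eq_zero_iff_of_nonneg
    (fun e _ => mul_nonneg (wx_nonneg hw e) (sq_nonneg (bR e ⬝ᵥ y)))).1 h2
  set x : Fin (k + 1) → ℝ := Fin.cons 0 y with hx
  have hyx : y = fun j : Fin k => x j.succ - x 0 := by ext j; simp [hx]
  have hadj : ∀ a b, G.Adj a b → x a = x b := by
    intro a b hab
    have hm : s(a, b) ∈ G.edgeSet := hab
    have h4 := h3 s(a, b) (Finset.mem_univ _)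
    have h5 : wx G w s(a, b) ≠ 0 := by
      rw [wx, if_pos hm]; exact (hw _ hm).ne'
    have h6 : bR s(a, b) ⬝ᵥ y = 0 := by
      rcases mul_eq_zero.1 h4 with h | h
      · exact absurd h h5
      · exact pow_eq_zero_iff (two_ne_zero) |>.1 h
    rw [hyx, bR_dot] at h6
    rcases Sym2.eq_iff.1 (ends_eq s(a, b)) with ⟨h7, h8⟩ | ⟨h7, h8⟩
    · rw [← h7, ← h8] at h6; linarith
    · rw [← h7, ← h8] at h6; linarith
  have hwalk : ∀ a b, G.Walk a b → x a = x b := by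
    intro a b p
    induction p with
    | nil => rfl
    | cons h _ ih => exact (hadj _ _ h).trans ih
  ext j
  obtain ⟨p⟩ := hG.preconnected j.succ 0
  have := hwalk _ _ p
  simpa [hx] using this

variable {B : Matrix (Fin k) (Fin k) ℝ}

lemma vv_iso (hw : ∀ e ∈ G.edgeSet, 0 < w e) (hd : B.det ≠ 0)
    (hB : Bᵀ * B = ∑ e, wx G w e • vecMulVec (bR e) (bR e)) :
    ∑ e, vecMulVec (vv G w B e) (vv G w B e) = 1 := by
  have hu : IsUnit B.det := isUnit_iff_ne_zero.2 hd
  have : ∀ e, vecMulVec (vv G w B e) (vv G w B e) =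
      (B⁻¹)ᵀ * (wx G w e • vecMulVec (bR e) (bR e)) * B⁻¹ := by
    intro e
    rw [Matrix.mul_smul, Matrix.smul_mul, Matrix.mul_vecMulVec, Matrix.vecMulVec_mul, Matrix.mulVec_transpose]
    unfold vv
    rw [Matrix.vecMulVec_smul, Matrix.smul_vecMulVec, smul_smul, Real.mul_self_sqrt (wx_nonneg hw e)]
  simp only [this]
  rw [← Finset.sum_mul, ← Finset.mul_sum, ← hB, Matrix.mul_assoc, Matrix.mul_assoc,
    Matrix.mul_nonsing_inv _ hu, mul_one, ← Matrix.transpose_mul, Matrix.mul_nonsing_inv _ hu,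
    Matrix.transpose_one]

lemma vv_dot (hd : B.det ≠ 0) (e : Sym2 (Fin (k + 1))) (y : Fin k → ℝ) :
    vv G w B e ⬝ᵥ (B *ᵥ y) = Real.sqrt (wx G w e) * (bR e ⬝ᵥ y) := by
  have hu : IsUnit B.det := isUnit_iff_ne_zero.2 hd
  rw [vv, smul_dotProduct, Matrix.dotProduct_mulVec, Matrix.vecMul_vecMul,
    Matrix.nonsing_inv_mul _ hu, Matrix.vecMul_one, smul_eq_mul]

lemma Dt_vv (hw : ∀ e ∈ G.edgeSet, 0 < w e) (e : Fin k → Sym2 (Fin (k + 1))) :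
    Dt (vv G w B) 1 e = (B⁻¹).det ^ 2 * ((∏ i, wx G w (e i)) * (((Bm e).det ^ 2 : ℤ) : ℝ)) := by
  set V : Matrix (Fin k) (Fin k) ℝ :=
    Matrix.diagonal (fun i => Real.sqrt (wx G w (e i))) * (Bm e).map (Int.cast : ℤ → ℝ) * B⁻¹ with hV
  have hrow : ∀ i j, V i j = vv G w B (e i) j := by
    intro i j
    rw [hV, Matrix.mul_assoc, Matrix.diagonal_mul]
    simp only [vv, Pi.smul_apply, smul_eq_mul, Matrix.vecMul, Matrix.mul_apply, dotProduct,
      Matrix.map_apply, Bm, Matrix.of_apply, bR]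
  have h1 : (Matrix.of fun i j => vv G w B (e i) ⬝ᵥ ((1 : Matrix (Fin k) (Fin k) ℝ) *ᵥ vv G w B (e j))) =
      V * Vᵀ := by
    ext i j
    simp only [Matrix.of_apply, Matrix.one_mulVec, Matrix.mul_apply, Matrix.transpose_apply, hrow, dotProduct]
  have h2 : ((Bm e).map (Int.cast : ℤ → ℝ)).det = ((Bm e).det : ℝ) := by
    rw [Int.cast_det]
  have h3 : (∏ i, Real.sqrt (wx G w (e i))) ^ 2 = ∏ i, wx G w (e i) := by
    rw [← Finset.prod_pow]
    exact Finset.prod_congr rfl fun i _ => Real.sq_sqrt (wx_nonneg hw _)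
  unfold Dt
  rw [h1, Matrix.det_mul, Matrix.det_transpose, hV, Matrix.det_mul, Matrix.det_mul, Matrix.det_diagonal,
    h2, ← h3]
  push_cast
  ring

/-- Unnormalised tree weight. -/
def tw (G : SimpleGraph (Fin (k + 1))) (w : Sym2 (Fin (k + 1)) → ℝ) (T : Finset (Sym2 (Fin (k + 1)))) : ℝ :=
  if IsSpanningTree (k + 1) G T then treeWt (k + 1) w T else 0

lemma Dt_tree (hw : ∀ e ∈ G.edgeSet, 0 < w e) (e : Fin k → Sym2 (Fin (k + 1))) :
    Dt (vv G w B) 1 e = if Function.Injective e then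
      (B⁻¹).det ^ 2 * tw G w (Finset.univ.image e) else 0 := by
  split_ifs with hinj
  · rw [Dt_vv hw]
    congr 1
    have hcoe : ((Finset.univ.image e : Finset (Sym2 (Fin (k + 1)))) : Set (Sym2 (Fin (k + 1)))) = Set.range e := by
      simp
    have hcard : (Finset.univ.image e).card = k := by
      rw [Finset.card_image_of_injective _ hinj]; simp
    unfold tw
    by_cases hc : (SimpleGraph.fromEdgeSet (Set.range e)).Connected
    · rw [det_of_connected e hc]
      by_cases hs : Set.range e ⊆ G.edgeSet
      · rw [if_pos ⟨by rw [hcoe]; exact hs, by rw [hcoe]; exact hc, by rw [hcard]; rfl⟩]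
        rw [treeWt, Finset.prod_image (fun a _ b _ h => hinj h)]
        simp only [Int.cast_one, mul_one]
        exact Finset.prod_congr rfl fun i _ => if_pos (hs ⟨i, rfl⟩)
      · rw [if_neg (fun h => hs (by rw [← hcoe]; exact h.1))]
        rw [Set.not_subset] at hs
        obtain ⟨_, ⟨i, rfl⟩, hi⟩ := hs
        rw [Finset.prod_eq_zero (Finset.mem_univ i) (if_neg hi), zero_mul]
    · rw [det_of_not_connected e hc, if_neg (fun h => hc (by rw [← hcoe]; exact h.2.1))]
      simp
  · rw [Function.Injective] at hinj
    push Not at hinj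
    obtain ⟨i, j, hij, hne⟩ := hinj
    unfold Dt
    refine Matrix.det_zero_of_row_eq hne ?_
    ext l
    simp [hij]

lemma sum_Dt_tree (hw : ∀ e ∈ G.edgeSet, 0 < w e) (F : Finset (Sym2 (Fin (k + 1))) → ℝ)
    (F' : (Fin k → Sym2 (Fin (k + 1))) → ℝ)
    (hF : ∀ e, Function.Injective e → F' e = F (Finset.univ.image e)) :
    ∑ e, Dt (vv G w B) 1 e * F' e = k.factorial * ((B⁻¹).det ^ 2 * ∑ T, tw G w T * F T) := by
  have h1 : ∀ e : Fin k → Sym2 (Fin (k + 1)), Dt (vv G w B) 1 e * F' e =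
      if Function.Injective e then (fun T => (B⁻¹).det ^ 2 * (tw G w T * F T)) (Finset.univ.image e) else 0 := by
    intro e
    rw [Dt_tree hw]
    split_ifs with h
    · rw [hF e h]; ring
    · ring
  rw [Finset.sum_congr rfl fun e _ => h1 e]
  have h2 := sum_injective k (fun T : Finset (Sym2 (Fin (k + 1))) => (B⁻¹).det ^ 2 * (tw G w T * F T))
  rw [Finset.mul_sum]
  convert h2 using 1
  congr 1
  refine Finset.sum_congr rfl fun T _ => ?_
  split_ifs with h
  · rfl
  · unfold tw
    rw [if_neg (fun h' => h (by simpa using h'.2.2))]; ring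

lemma treeProb_eq (hw : ∀ e ∈ G.edgeSet, 0 < w e) (hv : ∑ e, vecMulVec (vv G w B e) (vv G w B e) = 1)
    (T : Finset (Sym2 (Fin (k + 1)))) :
    treeProb (k + 1) G w T = (B⁻¹).det ^ 2 * tw G w T := by
  have h1 := sum_Dt_tree (B := B) hw (fun _ => 1) (fun _ => 1) (fun _ _ => rfl)
  simp only [mul_one] at h1
  rw [sum_Dt hv k 1 (by simp) (by simp) (by simp)] at h1
  have hk : (k.factorial : ℝ) ≠ 0 := by exact_mod_cast k.factorial_ne_zero
  have h2 : (B⁻¹).det ^ 2 * ∑ T, tw G w T = 1 := by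
    have : (k.factorial : ℝ) * ((B⁻¹).det ^ 2 * ∑ T, tw G w T) = k.factorial * 1 := by rw [← h1, mul_one]
    exact mul_left_cancel₀ hk this
  have h3 : ∑ T' ∈ Finset.univ.filter (fun T' => IsSpanningTree (k + 1) G T'), treeWt (k + 1) w T' =
      ∑ T, tw G w T := by
    rw [Finset.sum_filter]; rfl
  unfold treeProb
  rw [h3]
  have h4 : ∑ T, tw G w T ≠ 0 := by intro h; rw [h] at h2; simp at h2
  rw [div_eq_iff h4]
  change tw G w T = _
  calc tw G w T = tw G w T * ((B⁻¹).det ^ 2 * ∑ T, tw G w T) := by rw [h2, mul_one]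
    _ = _ := by ring

lemma sum_Dt_prob (hw : ∀ e ∈ G.edgeSet, 0 < w e) (hv : ∑ e, vecMulVec (vv G w B e) (vv G w B e) = 1)
    (F : Finset (Sym2 (Fin (k + 1))) → ℝ) (F' : (Fin k → Sym2 (Fin (k + 1))) → ℝ)
    (hF : ∀ e, Function.Injective e → F' e = F (Finset.univ.image e)) :
    ∑ e, Dt (vv G w B) 1 e * F' e = k.factorial * ∑ T, treeProb (k + 1) G w T * F T := by
  rw [sum_Dt_tree hw F F' hF, Finset.mul_sum]
  congr 1
  refine Finset.sum_congr rfl fun T _ => ?_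
  rw [treeProb_eq hw hv]; ring

lemma tw_nonneg (hw : ∀ e ∈ G.edgeSet, 0 < w e) (T : Finset (Sym2 (Fin (k + 1)))) : 0 ≤ tw G w T := by
  unfold tw
  split_ifs with h
  · exact Finset.prod_nonneg fun e he => (hw e (h.1 he)).le
  · exact le_rfl

lemma treeProb_nonneg (hw : ∀ e ∈ G.edgeSet, 0 < w e) (hv : ∑ e, vecMulVec (vv G w B e) (vv G w B e) = 1)
    (T : Finset (Sym2 (Fin (k + 1)))) : 0 ≤ treeProb (k + 1) G w T := by
  rw [treeProb_eq hw hv]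
  exact mul_nonneg (sq_nonneg _) (tw_nonneg hw T)

lemma treeProb_sum (hw : ∀ e ∈ G.edgeSet, 0 < w e) (hv : ∑ e, vecMulVec (vv G w B e) (vv G w B e) = 1) :
    ∑ T, treeProb (k + 1) G w T = 1 := by
  have h1 := sum_Dt_prob hw hv (fun _ => 1) (fun _ => 1) (fun _ _ => rfl)
  simp only [mul_one] at h1
  rw [sum_Dt hv k 1 (by simp) (by simp) (by simp)] at h1
  have hk : (k.factorial : ℝ) ≠ 0 := by exact_mod_cast k.factorial_ne_zero
  refine mul_left_cancel₀ hk ?_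
  rw [← h1, mul_one]

lemma lev_eq (hw : ∀ e ∈ G.edgeSet, 0 < w e) (hv : ∑ e, vecMulVec (vv G w B e) (vv G w B e) = 1)
    (f : Sym2 (Fin (k + 1))) : lev (k + 1) G w f = vv G w B f ⬝ᵥ vv G w B f := by
  have h1 := sum_Dt_marginal hv (fun e => if e = f then (1:ℝ) else 0) k 1 (by simp) (by simp) (by simp)
  rw [sum_Dt_prob hw hv (fun T => if f ∈ T then 1 else 0)] at h1
  · have hk : (k.factorial : ℝ) ≠ 0 := by exact_mod_cast k.factorial_ne_zero
    have h2 := mul_left_cancel₀ hk h1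
    have h3 : lev (k + 1) G w f = ∑ T, treeProb (k + 1) G w T * (if f ∈ T then 1 else 0) := by
      unfold lev
      rw [Finset.sum_filter]
      refine Finset.sum_congr rfl fun T _ => ?_
      by_cases hT : IsSpanningTree (k + 1) G T
      · by_cases hf : f ∈ T <;> simp [hT, hf]
      · simp [treeProb, hT]
    rw [h3, h2, Finset.sum_eq_single f]
    · simp [lv]
    · intro b _ hb; simp [hb]
    · simp
  · intro e he
    by_cases hf : f ∈ Finset.univ.image e
    · rw [if_pos hf]
      obtain ⟨i, _, rfl⟩ := Finset.mem_image.1 hf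
      rw [Finset.sum_eq_single i]
      · simp
      · intro j _ hj; rw [if_neg (fun h => hj (he h))]
      · simp
    · rw [if_neg hf]
      refine Finset.sum_eq_zero fun i _ => if_neg ?_
      rintro rfl
      exact hf (Finset.mem_image_of_mem _ (Finset.mem_univ i))

lemma tree_mgf (hk : 1 ≤ k) (hw : ∀ e ∈ G.edgeSet, 0 < w e)
    (hv : ∑ e, vecMulVec (vv G w B e) (vv G w B e) = 1)
    (θ : ℝ) (hθ : |θ| ≤ 1) (Y : Matrix (Fin k) (Fin k) ℝ) (hY : Yᵀ = Y) :
    ∑ T, treeProb (k + 1) G w T * (NormedSpace.exp (Y + θ • ∑ e ∈ T, Amat (vv G w B) e)).trace ≤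
      Real.exp (12 * θ ^ 2 * Real.log ((k + 1 : ℕ) : ℝ)) *
        (NormedSpace.exp (Y + θ • (1 : Matrix (Fin k) (Fin k) ℝ))).trace := by
  have h1 := sum_Dt_exp hv hθ k 1 Y (by simp) (by simp) (by simp) hY
  rw [sum_Dt_prob hw hv (fun T => (NormedSpace.exp (Y + θ • ∑ e ∈ T, Amat (vv G w B) e)).trace),
    Rmat_one hv] at h1
  · have hkp : (0:ℝ) < k.factorial := by exact_mod_cast k.factorial_pos
    refine le_of_mul_le_mul_left ?_ hkp
    refine h1.trans ?_
    rw [← mul_assoc]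
    refine mul_le_mul_of_nonneg_right (prod_bound k hk θ) (trace_exp_nonneg ?_)
    rw [Matrix.transpose_add, hY, Matrix.transpose_smul, Matrix.transpose_one]
  · intro e he
    rw [Finset.sum_image (fun a _ b _ h => he h)]

lemma edgeMat_symm (n : ℕ) (e : Sym2 (Fin n)) : (edgeMat n e)ᵀ = edgeMat n e := by
  ext i j
  simp only [Matrix.transpose_apply, edgeMat]
  by_cases h : i = j
  · subst h; rfl
  · have h' : ¬ j = i := fun h2 => h h2.symm
    simp [h, h', and_comm]

lemma edgeMat_qf (n : ℕ) (a b : Fin n) (hab : a ≠ b) (x : Fin n → ℝ) :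
    x ⬝ᵥ (edgeMat n s(a, b) *ᵥ x) = (x a - x b) ^ 2 := by
  have h1 : edgeMat n s(a, b) = vecMulVec (Pi.single a 1 - Pi.single b 1) (Pi.single a 1 - Pi.single b 1) := by
    ext i j
    simp only [edgeMat, vecMulVec_apply, Pi.sub_apply, Pi.single_apply, Sym2.mem_iff]
    by_cases h1 : i = a <;> by_cases h2 : i = b <;> by_cases h3 : j = a <;> by_cases h4 : j = b <;>
      by_cases h5 : i = j <;> simp_all
  rw [h1, qf_vecMulVec, sub_dotProduct]
  simp [pow_two]

lemma edgeMat_qf' {e : Sym2 (Fin (k + 1))} (he : e ∈ G.edgeSet) (x : Fin (k + 1) → ℝ) :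
    x ⬝ᵥ (edgeMat (k + 1) e *ᵥ x) = (bR e ⬝ᵥ (fun j : Fin k => x j.succ - x 0)) ^ 2 := by
  rw [bR_dot]
  have h := ends_eq e
  have hne : (ends e).1 ≠ (ends e).2 := by
    rw [h] at he
    exact G.ne_of_adj he
  conv_lhs => rw [h]
  exact edgeMat_qf _ _ _ hne x

lemma lap_qf (hB : Bᵀ * B = ∑ e, wx G w e • vecMulVec (bR e) (bR e)) (x : Fin (k + 1) → ℝ) :
    x ⬝ᵥ (lap (k + 1) G w *ᵥ x) =
      (B *ᵥ (fun j : Fin k => x j.succ - x 0)) ⬝ᵥ (B *ᵥ (fun j : Fin k => x j.succ - x 0)) := by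
  set y : Fin k → ℝ := fun j : Fin k => x j.succ - x 0 with hy
  have h1 : (B *ᵥ y) ⬝ᵥ (B *ᵥ y) = y ⬝ᵥ ((Bᵀ * B) *ᵥ y) := by
    rw [← Matrix.mulVec_mulVec, Matrix.dotProduct_mulVec y, Matrix.vecMul_transpose]
  rw [h1, hB, lap, Matrix.sum_mulVec, Matrix.sum_mulVec, dotProduct_sum, dotProduct_sum]
  refine Finset.sum_congr rfl fun e _ => ?_
  rw [Matrix.smul_mulVec, Matrix.smul_mulVec, dotProduct_smul, dotProduct_smul, qf_vecMulVec]
  unfold wx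
  split_ifs with he
  · rw [edgeMat_qf' he, ← hy, pow_two]
  · simp

lemma treeLap_qf (hw : ∀ e ∈ G.edgeSet, 0 < w e) (hd : B.det ≠ 0)
    (hv : ∑ e, vecMulVec (vv G w B e) (vv G w B e) = 1)
    (T : Finset (Sym2 (Fin (k + 1)))) (hT : ↑T ⊆ G.edgeSet) (x : Fin (k + 1) → ℝ) :
    x ⬝ᵥ (treeLap (k + 1) G w T *ᵥ x) =
      (B *ᵥ (fun j : Fin k => x j.succ - x 0)) ⬝ᵥ ((∑ e ∈ T, Amat (vv G w B) e) *ᵥ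
        (B *ᵥ (fun j : Fin k => x j.succ - x 0))) := by
  set y : Fin k → ℝ := fun j : Fin k => x j.succ - x 0 with hy
  rw [treeLap, Matrix.sum_mulVec, Matrix.sum_mulVec, dotProduct_sum, dotProduct_sum]
  refine Finset.sum_congr rfl fun e he => ?_
  have heG : e ∈ G.edgeSet := hT he
  rw [Amat, Matrix.smul_mulVec, Matrix.smul_mulVec, dotProduct_smul, dotProduct_smul, qf_vecMulVec,
    edgeMat_qf' heG, ← hy, vv_dot hd, lev_eq hw hv, smul_eq_mul, smul_eq_mul]
  have h1 : Real.sqrt (wx G w e) * Real.sqrt (wx G w e) = w e := by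
    rw [Real.mul_self_sqrt (wx_nonneg hw e), wx, if_pos heG]
  calc _ = (vv G w B e ⬝ᵥ vv G w B e)⁻¹ * ((w e) * (bR e ⬝ᵥ y) ^ 2) := by
        rw [div_eq_mul_inv]; ring
    _ = _ := by rw [← h1]; ring

lemma lap_symm (n : ℕ) (G : SimpleGraph (Fin n)) (w : Sym2 (Fin n) → ℝ) : (lap n G w)ᵀ = lap n G w := by
  rw [lap, Matrix.transpose_sum]
  exact Finset.sum_congr rfl fun e _ => by rw [Matrix.transpose_smul, edgeMat_symm]

lemma treeLap_symm (n : ℕ) (G : SimpleGraph (Fin n)) (w : Sym2 (Fin n) → ℝ) (T : Finset (Sym2 (Fin n))) :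
    (treeLap n G w T)ᵀ = treeLap n G w T := by
  rw [treeLap, Matrix.transpose_sum]
  exact Finset.sum_congr rfl fun e _ => by rw [Matrix.transpose_smul, edgeMat_symm]

lemma good_event (hw : ∀ e ∈ G.edgeSet, 0 < w e) (hd : B.det ≠ 0)
    (hB : Bᵀ * B = ∑ e, wx G w e • vecMulVec (bR e) (bR e))
    (hv : ∑ e, vecMulVec (vv G w B e) (vv G w B e) = 1)
    (ε : ℝ) (t : ℕ) (ht : 0 < (t : ℝ)) (Ts : Fin t → Finset (Sym2 (Fin (k + 1))))
    (hTs : ∀ i, ↑(Ts i) ⊆ G.edgeSet)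
    (hU : (((t : ℝ) * ε) • (1 : Matrix (Fin k) (Fin k) ℝ) -
      ∑ i, (∑ e ∈ Ts i, Amat (vv G w B) e - 1)).PosSemidef)
    (hL : (((t : ℝ) * ε) • (1 : Matrix (Fin k) (Fin k) ℝ) +
      ∑ i, (∑ e ∈ Ts i, Amat (vv G w B) e - 1)).PosSemidef) :
    ((t : ℝ)⁻¹ • ∑ i, treeLap (k + 1) G w (Ts i) - (1 - ε) • lap (k + 1) G w).PosSemidef ∧
      ((1 + ε) • lap (k + 1) G w - (t : ℝ)⁻¹ • ∑ i, treeLap (k + 1) G w (Ts i)).PosSemidef := by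
  have hsy : (∑ i, treeLap (k + 1) G w (Ts i))ᵀ = ∑ i, treeLap (k + 1) G w (Ts i) := by
    rw [Matrix.transpose_sum]
    exact Finset.sum_congr rfl fun i _ => treeLap_symm _ _ _ _
  have main : ∀ x : Fin (k + 1) → ℝ, ∃ z : Fin k → ℝ,
      x ⬝ᵥ (lap (k + 1) G w *ᵥ x) = z ⬝ᵥ z ∧
      x ⬝ᵥ ((∑ i, treeLap (k + 1) G w (Ts i)) *ᵥ x) =
        z ⬝ᵥ ((∑ i, (∑ e ∈ Ts i, Amat (vv G w B) e - 1)) *ᵥ z) + t * (z ⬝ᵥ z) := by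
    intro x
    refine ⟨_, lap_qf hB x, ?_⟩
    rw [Matrix.sum_mulVec, dotProduct_sum, Finset.sum_congr rfl fun i _ => treeLap_qf hw hd hv (Ts i) (hTs i) x]
    rw [Matrix.sum_mulVec, dotProduct_sum]
    simp only [Matrix.sub_mulVec, dotProduct_sub, Matrix.one_mulVec]
    rw [Finset.sum_sub_distrib, Finset.sum_const, Finset.card_univ, Fintype.card_fin, nsmul_eq_mul,
      sub_add_cancel]
  have key : ∀ a b : ℝ, (t : ℝ)⁻¹ * (a + t * b) = (t : ℝ)⁻¹ * a + b := by
    intro a b; field_simp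
  have key2 : ∀ a : ℝ, ε * a = (t : ℝ)⁻¹ * (t * ε * a) := by
    intro a; field_simp
  constructor
  · refine psd_of_qf ?_ fun x => ?_
    · rw [Matrix.transpose_sub, Matrix.transpose_smul, Matrix.transpose_smul, hsy, lap_symm]
    · obtain ⟨z, h1, h2⟩ := main x
      have h3 := qf_nonneg hL z
      rw [Matrix.add_mulVec, dotProduct_add, Matrix.smul_mulVec, dotProduct_smul, Matrix.one_mulVec,
        smul_eq_mul] at h3
      rw [Matrix.sub_mulVec, dotProduct_sub, Matrix.smul_mulVec, Matrix.smul_mulVec, dotProduct_smul,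
        dotProduct_smul, h1, h2, smul_eq_mul, smul_eq_mul, key]
      have h4 := mul_nonneg (inv_nonneg.2 ht.le) h3
      rw [mul_add, ← key2] at h4
      linarith
  · refine psd_of_qf ?_ fun x => ?_
    · rw [Matrix.transpose_sub, Matrix.transpose_smul, Matrix.transpose_smul, hsy, lap_symm]
    · obtain ⟨z, h1, h2⟩ := main x
      have h3 := qf_nonneg hU z
      rw [Matrix.sub_mulVec, dotProduct_sub, Matrix.smul_mulVec, dotProduct_smul, Matrix.one_mulVec,
        smul_eq_mul] at h3
      rw [Matrix.sub_mulVec, dotProduct_sub, Matrix.smul_mulVec, Matrix.smul_mulVec, dotProduct_smul,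
        dotProduct_smul, h1, h2, smul_eq_mul, smul_eq_mul, key]
      have h4 := mul_nonneg (inv_nonneg.2 ht.le) h3
      rw [mul_sub, ← key2] at h4
      linarith

end Setup

end SST

/-- averaging O(ε⁻² log² n) independent inverse-leverage-score weighted random
spanning trees gives a (1 ± ε) spectral sparsifier with high probability. -/
theorem sum_spanning_trees_spectral_sparsifier :
    ∃ C > (0:ℝ), ∃ c > (0:ℝ), ∀ n : ℕ, 2 ≤ n →
    ∀ G : SimpleGraph (Fin n), G.Connected →
    ∀ w : Sym2 (Fin n) → ℝ, (∀ e ∈ G.edgeSet, 0 < w e) →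
    ∀ ε : ℝ, 0 < ε → ε < 1 →
    ∀ t : ℕ, C * ε⁻¹ ^ 2 * Real.log n ^ 2 ≤ t →
    1 - (n : ℝ) ^ (-c) ≤
      ∑ Ts ∈ Finset.univ.filter (fun Ts : Fin t → Finset (Sym2 (Fin n)) =>
        ((t : ℝ)⁻¹ • ∑ i, treeLap n G w (Ts i) - (1 - ε) • lap n G w).PosSemidef ∧
        ((1 + ε) • lap n G w - (t : ℝ)⁻¹ • ∑ i, treeLap n G w (Ts i)).PosSemidef),
        ∏ i, treeProb n G w (Ts i) := by
  refine ⟨144, by norm_num, 1, one_pos, ?_⟩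
  intro n hn G hG w hw ε h0 h1 t ht
  obtain ⟨k, rfl⟩ : ∃ k, n = k + 1 := ⟨n - 1, by omega⟩
  obtain ⟨B, hd, hB⟩ := SST.exists_B hG hw
  have hv := SST.vv_iso hw hd hB
  have htpos : 0 < (t : ℝ) := by
    refine lt_of_lt_of_le ?_ ht
    have hlog : 0 < Real.log ((k + 1 : ℕ) : ℝ) := Real.log_pos (by exact_mod_cast (by omega : 1 < k + 1))
    positivity
  refine SST.abstract_tail (fun T => treeProb (k + 1) G w T) (SST.treeProb_nonneg hw hv)
    (SST.treeProb_sum hw hv) (fun T => ∑ e ∈ T, SST.Amat (SST.vv G w B) e) ?_ (k + 1) hn (by simp)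
    (fun θ hθ Y hY => SST.tree_mgf (by omega) hw hv θ hθ Y hY) ε h0 h1 t ht _ ?_
  · intro T
    rw [Matrix.transpose_sum]
    exact Finset.sum_congr rfl fun e _ => SST.psd_symm (SST.Amat_psd _ e)
  · intro Ts hp hU hL
    refine SST.good_event hw hd hB hv ε t htpos Ts (fun i => ?_) hU hL
    by_contra hcon
    refine hp i ?_
    have : ¬ IsSpanningTree (k + 1) G (Ts i) := fun h => hcon h.1
    simp [treeProb, this]

end
end

section
/- There exist absolute constants C > 0 and c > 0 such that the following holds. Let G be a connected undirected graph on n ≥ 2 vertices with positive edge weights w, and let T be a w-uniform random spanning tree of G with inverse-leverage-score-weighted Laplacian L_T. Then with probability at least 1 − n^{−c}, L_T ⪯ C·(ln n)·L_G. -/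
open Matrix Finset
attribute [local instance] Classical.propDecidable

noncomputable section

theorem ost_spectral {d : ℕ} {Q : Matrix (Fin d) (Fin d) ℝ} (hQ : Q.PosSemidef) :
    ∃ (U : Matrix (Fin d) (Fin d) ℝ) (l : Fin d → ℝ), U * Uᵀ = 1 ∧ Uᵀ * U = 1 ∧
      Q = U * Matrix.diagonal l * Uᵀ ∧ ∀ k, 0 ≤ l k := by
  have hs := hQ.1.spectral_theorem
  refine ⟨(hQ.1.eigenvectorUnitary : Matrix (Fin d) (Fin d) ℝ), hQ.1.eigenvalues, ?_, ?_, ?_, hQ.eigenvalues_nonneg⟩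
  · have := Unitary.coe_mul_star_self hQ.1.eigenvectorUnitary
    simpa [Matrix.star_eq_conjTranspose] using this
  · have := Unitary.coe_star_mul_self hQ.1.eigenvectorUnitary
    simpa [Matrix.star_eq_conjTranspose] using this
  · rw [Unitary.conjStarAlgAut_apply] at hs
    simpa [Matrix.star_eq_conjTranspose] using hs

theorem ost_pow {d : ℕ} {U Q : Matrix (Fin d) (Fin d) ℝ} {l : Fin d → ℝ} (h1 : U * Uᵀ = 1)
    (h2 : Uᵀ * U = 1) (hQ : Q = U * Matrix.diagonal l * Uᵀ) (p : ℝ) (i : ℕ) :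
    (p • 1 + Q) ^ i = U * Matrix.diagonal (fun k => (p + l k) ^ i) * Uᵀ := by
  have hb : p • 1 + Q = U * Matrix.diagonal (fun k => p + l k) * Uᵀ := by
    have : (Matrix.diagonal (fun k => p + l k)) = p • 1 + Matrix.diagonal l := by
      ext a b
      by_cases hab : a = b
      · subst hab; simp
      · simp [hab]
    rw [this, Matrix.mul_add, Matrix.add_mul, hQ]
    simp [h1]
  induction i with
  | zero => simp [h1]
  | succ i ih =>
    rw [pow_succ, ih, hb]
    have : U * Matrix.diagonal (fun k => (p + l k) ^ i) * Uᵀ * (U * Matrix.diagonal (fun k => p + l k) * Uᵀ)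
      = U * Matrix.diagonal (fun k => (p + l k) ^ i) * (Uᵀ * U) * Matrix.diagonal (fun k => p + l k) * Uᵀ := by
      simp only [Matrix.mul_assoc]
    rw [this, h2, Matrix.mul_one, Matrix.mul_assoc U, Matrix.diagonal_mul_diagonal]
    simp only [pow_succ]

theorem ost_moment {d : ℕ} {Q : Matrix (Fin d) (Fin d) ℝ} (hQ : Q.PosSemidef) (p : ℝ)
    (v : Fin d → ℝ) :
    ∃ (l c : Fin d → ℝ), (∀ k, p ≤ l k) ∧ (∀ k, 0 ≤ c k) ∧
      ∀ i : ℕ, v ⬝ᵥ (((p • 1 + Q) ^ i) *ᵥ v) = ∑ k, l k ^ i * c k := by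
  obtain ⟨U, l, h1, h2, h3, h4⟩ := ost_spectral hQ
  refine ⟨fun k => p + l k, fun k => ((Uᵀ *ᵥ v) k) ^ 2, fun k => by linarith [h4 k],
    fun k => sq_nonneg _, fun i => ?_⟩
  rw [ost_pow h1 h2 h3, ← Matrix.mulVec_mulVec, ← Matrix.mulVec_mulVec, Matrix.dotProduct_mulVec,
    ← Matrix.mulVec_transpose]
  simp only [dotProduct, Matrix.mulVec_diagonal]
  exact Finset.sum_congr rfl fun k _ => by ring

theorem ost_cheb {d : ℕ} {Q : Matrix (Fin d) (Fin d) ℝ} (hQ : Q.PosSemidef) {p : ℝ} (hp : 0 ≤ p)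
    (v : Fin d → ℝ) (hv : v ⬝ᵥ v ≤ 1) (i j : ℕ) :
    (v ⬝ᵥ (((p • 1 + Q) ^ i) *ᵥ v)) * (v ⬝ᵥ (((p • 1 + Q) ^ j) *ᵥ v)) ≤
      v ⬝ᵥ (((p • 1 + Q) ^ (i + j)) *ᵥ v) := by
  obtain ⟨l, c, hl, hc, h⟩ := ost_moment hQ p v
  have h0 := h 0
  simp only [pow_zero, Matrix.one_mulVec, one_mul] at h0
  rw [h, h, h]
  have hl0 : ∀ k, 0 ≤ l k := fun k => hp.trans (hl k)
  have key : 0 ≤ ∑ a, ∑ b, c a * c b * ((l a ^ i - l b ^ i) * (l a ^ j - l b ^ j)) := by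
    refine Finset.sum_nonneg fun a _ => Finset.sum_nonneg fun b _ =>
      mul_nonneg (mul_nonneg (hc a) (hc b)) ?_
    rcases le_total (l a) (l b) with hab | hab
    · exact mul_nonneg_of_nonpos_of_nonpos
        (sub_nonpos.2 (pow_le_pow_left₀ (hl0 a) hab i)) (sub_nonpos.2 (pow_le_pow_left₀ (hl0 a) hab j))
    · exact mul_nonneg
        (sub_nonneg.2 (pow_le_pow_left₀ (hl0 b) hab i)) (sub_nonneg.2 (pow_le_pow_left₀ (hl0 b) hab j))
  have expand : ∑ a, ∑ b, c a * c b * ((l a ^ i - l b ^ i) * (l a ^ j - l b ^ j)) =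
      2 * ((∑ k, l k ^ (i + j) * c k) * ∑ k, c k) -
        2 * ((∑ k, l k ^ i * c k) * ∑ k, l k ^ j * c k) := by
    have e1 : (∑ k, l k ^ (i + j) * c k) * ∑ k, c k = ∑ a, ∑ b, l a ^ (i+j) * c a * c b :=
      Finset.sum_mul_sum _ _ _ _
    have e1' : (∑ k, l k ^ (i + j) * c k) * ∑ k, c k = ∑ a, ∑ b, l b ^ (i+j) * c b * c a := by
      rw [e1, Finset.sum_comm]
    have e2 : (∑ k, l k ^ i * c k) * ∑ k, l k ^ j * c k = ∑ a, ∑ b, l a ^ i * c a * (l b ^ j * c b) :=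
      Finset.sum_mul_sum _ _ _ _
    have e2' : (∑ k, l k ^ i * c k) * ∑ k, l k ^ j * c k = ∑ a, ∑ b, l b ^ i * c b * (l a ^ j * c a) := by
      rw [e2, Finset.sum_comm]
    rw [two_mul, two_mul]
    nth_rewrite 1 [e1]
    rw [e1']
    nth_rewrite 1 [e2]
    rw [e2']
    simp only [← Finset.sum_add_distrib, ← Finset.sum_sub_distrib]
    refine Finset.sum_congr rfl fun a _ => Finset.sum_congr rfl fun b _ => ?_
    ring
  have hnn : 0 ≤ ∑ k, l k ^ (i + j) * c k :=
    Finset.sum_nonneg fun k _ => mul_nonneg (pow_nonneg (hl0 k) _) (hc k)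
  have : (∑ k, l k ^ (i + j) * c k) * ∑ k, c k ≤ ∑ k, l k ^ (i + j) * c k := by
    rw [← h0]; exact mul_le_of_le_one_right hnn hv
  linarith

theorem ost_step {d : ℕ} {Q : Matrix (Fin d) (Fin d) ℝ} (hQ : Q.PosSemidef) {p : ℝ}
    (hp : 0 < p) (v : Fin d → ℝ) (i : ℕ) :
    v ⬝ᵥ (((p • 1 + Q) ^ i) *ᵥ v) ≤ (1 / p) * v ⬝ᵥ (((p • 1 + Q) ^ (i + 1)) *ᵥ v) := by
  obtain ⟨l, c, hl, hc, h⟩ := ost_moment hQ p v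
  rw [h, h, Finset.mul_sum]
  refine Finset.sum_le_sum fun k _ => ?_
  have hk : 0 ≤ l k := hp.le.trans (hl k)
  have : 0 ≤ l k ^ i * c k := mul_nonneg (pow_nonneg hk _) (hc k)
  have h1 : 1 ≤ (1 / p) * l k := by
    rw [one_div, inv_mul_eq_div, le_div_iff₀ hp]; simpa using hl k
  calc l k ^ i * c k = 1 * (l k ^ i * c k) := by ring
    _ ≤ ((1 / p) * l k) * (l k ^ i * c k) := mul_le_mul_of_nonneg_right h1 this
    _ = _ := by ring

theorem ost_mixed {d : ℕ} {Q : Matrix (Fin d) (Fin d) ℝ} (hQ : Q.PosSemidef) {p : ℝ}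
    (hp : 0 < p) (v : Fin d → ℝ) (hv : v ⬝ᵥ v ≤ 1) (i : ℕ) : ∀ j : ℕ,
    v ⬝ᵥ (((p • 1 + Q) ^ j * (p • 1 + Q + vecMulVec v v) ^ i) *ᵥ v) ≤
      (1 + 1 / p) ^ i * v ⬝ᵥ (((p • 1 + Q) ^ (j + i)) *ᵥ v) := by
  induction i with
  | zero => intro j; simp
  | succ i ih =>
    intro j
    set N := p • 1 + Q with hN
    set H := N + vecMulVec v v with hH
    have nn : ∀ i, 0 ≤ v ⬝ᵥ ((N ^ i) *ᵥ v) := by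
      intro i
      obtain ⟨l, c, hl, hc, h⟩ := ost_moment hQ p v
      rw [h]
      exact Finset.sum_nonneg fun k _ => mul_nonneg (pow_nonneg (hp.le.trans (hl k)) _) (hc k)
    have e : v ⬝ᵥ ((N ^ j * H ^ (i + 1)) *ᵥ v) =
        v ⬝ᵥ ((N ^ (j + 1) * H ^ i) *ᵥ v) +
        (v ⬝ᵥ ((N ^ j) *ᵥ v)) * (v ⬝ᵥ ((N ^ 0 * H ^ i) *ᵥ v)) := by
      have : N ^ j * H ^ (i + 1) = N ^ (j + 1) * H ^ i + N ^ j * vecMulVec v v * H ^ i := by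
        rw [pow_succ' H, pow_succ N]
        conv_lhs => rw [hH]
        simp only [Matrix.add_mul, Matrix.mul_add, Matrix.mul_assoc]
        rw [← hH]
      rw [this, Matrix.add_mulVec, dotProduct_add]
      congr 1
      rw [Matrix.mul_assoc, ← Matrix.mulVec_mulVec, ← Matrix.mulVec_mulVec, Matrix.vecMulVec_mulVec,
        pow_zero, Matrix.one_mul]
      simp [Matrix.mulVec_smul, mul_comm]
    rw [e]
    have a1 := ih (j + 1)
    have a2 := ih 0
    have a3 := ost_cheb hQ hp.le v hv j i
    have a4 := ost_step hQ hp v (j + i)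
    rw [← hN] at a3 a4
    have hpos : 0 ≤ (1 + 1 / p) ^ i := by positivity
    rw [zero_add] at a2
    have e2 : j + 1 + i = j + i + 1 := by ring
    have e3 : j + (i + 1) = j + i + 1 := by ring
    rw [e2] at a1
    rw [e3]
    calc _ ≤ (1 + 1 / p) ^ i * v ⬝ᵥ ((N ^ (j + i + 1)) *ᵥ v) +
          (v ⬝ᵥ ((N ^ j) *ᵥ v)) * ((1 + 1 / p) ^ i * v ⬝ᵥ ((N ^ i) *ᵥ v)) := by
          gcongr; exact nn j
      _ = (1 + 1 / p) ^ i * (v ⬝ᵥ ((N ^ (j + i + 1)) *ᵥ v) +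
          (v ⬝ᵥ ((N ^ j) *ᵥ v)) * (v ⬝ᵥ ((N ^ i) *ᵥ v))) := by ring
      _ ≤ (1 + 1 / p) ^ i * (v ⬝ᵥ ((N ^ (j + i + 1)) *ᵥ v) +
          (1 / p) * v ⬝ᵥ ((N ^ (j + i + 1)) *ᵥ v)) := by
          exact mul_le_mul_of_nonneg_left (by linarith [a3.trans a4]) hpos
      _ = _ := by ring

theorem ost_tele {R : Type*} [Ring R] (x y : R) (p : ℕ) :
    x ^ p - y ^ p = ∑ i ∈ Finset.range p, x ^ i * (x - y) * y ^ (p - 1 - i) := by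
  induction p with
  | zero => simp
  | succ p ih =>
    rw [Finset.sum_range_succ]
    have : ∑ i ∈ Finset.range p, x ^ i * (x - y) * y ^ (p + 1 - 1 - i) =
        (∑ i ∈ Finset.range p, x ^ i * (x - y) * y ^ (p - 1 - i)) * y := by
      rw [Finset.sum_mul]
      refine Finset.sum_congr rfl fun i hi => ?_
      have hi := Finset.mem_range.1 hi
      have : p + 1 - 1 - i = (p - 1 - i) + 1 := by omega
      simp only [this, pow_succ, mul_assoc]
    rw [this, ← ih]
    simp [pow_succ, mul_sub, sub_mul]

theorem ost_trace {d : ℕ} {Q : Matrix (Fin d) (Fin d) ℝ} (hQ : Q.PosSemidef) {p : ℕ}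
    (hp : 0 < p) (v : Fin d → ℝ) (hv : v ⬝ᵥ v ≤ 1) :
    (((p : ℝ) • 1 + Q + vecMulVec v v) ^ p).trace ≤
      (((p : ℝ) • 1 + Q) ^ p).trace + 2 * v ⬝ᵥ ((((p : ℝ) • 1 + Q) ^ p) *ᵥ v) := by
  have hp' : (0 : ℝ) < p := by exact_mod_cast hp
  set N := (p : ℝ) • 1 + Q with hN
  set H := N + vecMulVec v v with hH
  have nn : 0 ≤ v ⬝ᵥ ((N ^ p) *ᵥ v) := by
    obtain ⟨l, c, hl, hc, h⟩ := ost_moment hQ p v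
    rw [h]
    exact Finset.sum_nonneg fun k _ => mul_nonneg (pow_nonneg (hp'.le.trans (hl k)) _) (hc k)
  have h1 : (H ^ p).trace - (N ^ p).trace =
      ∑ i ∈ Finset.range p, v ⬝ᵥ ((N ^ (p - 1 - i) * H ^ i) *ᵥ v) := by
    rw [← Matrix.trace_sub, ost_tele, Matrix.trace_sum]
    refine Finset.sum_congr rfl fun i _ => ?_
    have : H - N = vecMulVec v v := by rw [hH]; simp
    rw [this, Matrix.trace_mul_comm, ← Matrix.mul_assoc, Matrix.mul_vecMulVec, Matrix.trace_vecMulVec,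
      dotProduct_comm]
  have h2 : ∀ i ∈ Finset.range p, v ⬝ᵥ ((N ^ (p - 1 - i) * H ^ i) *ᵥ v) ≤
      (1 + 1 / (p : ℝ)) ^ i * ((1 / p) * v ⬝ᵥ ((N ^ p) *ᵥ v)) := by
    intro i hi
    have hi := Finset.mem_range.1 hi
    have a := ost_mixed hQ hp' v hv i (p - 1 - i)
    rw [← hN, ← hH] at a
    refine a.trans ?_
    have b := ost_step hQ hp' v (p - 1)
    rw [← hN] at b
    have e1 : p - 1 - i + i = p - 1 := by omega
    have e2 : p - 1 + 1 = p := by omega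
    rw [e2] at b
    rw [e1]
    gcongr
  have h3 := Finset.sum_le_sum h2
  rw [← Finset.sum_mul] at h3
  have h4 : (∑ i ∈ Finset.range p, (1 + 1 / (p : ℝ)) ^ i) * (1 / p) = (1 + 1 / (p : ℝ)) ^ p - 1 := by
    have := geom_sum_mul (1 + 1 / (p : ℝ)) p
    simpa using this
  have h5 : (1 + 1 / (p : ℝ)) ^ p ≤ 3 := by
    have a : 1 + 1 / (p : ℝ) ≤ Real.exp (1 / p) := by
      have := Real.add_one_le_exp (1 / (p : ℝ)); linarith
    calc (1 + 1 / (p : ℝ)) ^ p ≤ (Real.exp (1 / p)) ^ p := by gcongr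
      _ = Real.exp 1 := by
        rw [← Real.exp_nat_mul]; congr 1; field_simp
      _ ≤ 3 := by linarith [Real.exp_one_lt_d9]
  rw [← mul_assoc, h4] at h3
  have : ((1 + 1 / (p : ℝ)) ^ p - 1) * v ⬝ᵥ ((N ^ p) *ᵥ v) ≤ 2 * v ⬝ᵥ ((N ^ p) *ᵥ v) := by
    gcongr; linarith
  linarith

theorem ost_double {E : Type*} [Fintype E] (g : Finset E → ℝ) (i : ℕ) :
    ∑ S ∈ Finset.powersetCard i (Finset.univ : Finset E), ∑ e ∈ Sᶜ, g (insert e S) =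
      ((i : ℝ) + 1) * ∑ S ∈ Finset.powersetCard (i + 1) (Finset.univ : Finset E), g S := by
  have h : ((i : ℝ) + 1) * ∑ S ∈ Finset.powersetCard (i + 1) (Finset.univ : Finset E), g S =
      ∑ S ∈ Finset.powersetCard (i + 1) (Finset.univ : Finset E), ∑ e ∈ S, g S := by
    rw [Finset.mul_sum]
    refine Finset.sum_congr rfl fun S hS => ?_
    rw [Finset.sum_const, (Finset.mem_powersetCard.1 hS).2, nsmul_eq_mul]
    push_cast; ring
  rw [h, Finset.sum_sigma', Finset.sum_sigma']
  refine Finset.sum_bij' (fun x _ => ⟨insert x.2 x.1, x.2⟩) (fun x _ => ⟨x.1.erase x.2, x.2⟩) ?_ ?_ ?_ ?_ ?_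
  · rintro ⟨S, e⟩ h
    simp only [Finset.mem_sigma, Finset.mem_powersetCard_univ, Finset.mem_compl] at h ⊢
    exact ⟨by rw [Finset.card_insert_of_notMem h.2, h.1], Finset.mem_insert_self _ _⟩
  · rintro ⟨S, e⟩ h
    simp only [Finset.mem_sigma, Finset.mem_powersetCard_univ, Finset.mem_compl] at h ⊢
    exact ⟨by rw [Finset.card_erase_of_mem h.2, h.1]; rfl, Finset.notMem_erase _ _⟩
  · rintro ⟨S, e⟩ h
    simp only [Finset.mem_sigma, Finset.mem_compl] at h
    simp [Finset.erase_insert h.2]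
  · rintro ⟨S, e⟩ h
    simp only [Finset.mem_sigma] at h
    simp [Finset.insert_erase h.2]
  · rintro ⟨S, e⟩ h
    rfl

/-- mass of the sets containing `S` -/
def ostUp {E : Type*} [Fintype E] (ν : Finset E → ℝ) (S : Finset E) : ℝ :=
  ∑ F ∈ Finset.univ.filter (fun F => S ⊆ F), ν F

theorem ostUp_sum {E : Type*} [Fintype E] (ν : Finset E → ℝ) (k : ℕ)
    (hk : ∀ F, ν F ≠ 0 → F.card = k) (S : Finset E) :
    ∑ e ∈ Sᶜ, ostUp ν (insert e S) = ((k : ℝ) - S.card) * ostUp ν S := by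
  unfold ostUp
  simp only [Finset.sum_filter]
  rw [Finset.sum_comm, Finset.mul_sum]
  refine Finset.sum_congr rfl fun F _ => ?_
  by_cases hS : S ⊆ F
  · by_cases h0 : ν F = 0
    · simp [h0]
    · rw [if_pos hS, ← Finset.sum_filter, Finset.sum_const, nsmul_eq_mul]
      congr 1
      have : Finset.filter (fun e => insert e S ⊆ F) Sᶜ = F \ S := by
        ext e
        simp only [Finset.mem_filter, Finset.mem_compl, Finset.mem_sdiff, Finset.insert_subset_iff]
        tauto
      rw [this, Finset.card_sdiff_of_subset hS, hk F h0, Nat.cast_sub]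
      rw [← hk F h0]; exact Finset.card_le_card hS
  · rw [if_neg hS, mul_zero]
    refine Finset.sum_eq_zero fun e _ => ?_
    rw [if_neg]
    exact fun h => hS ((Finset.subset_insert _ _).trans h)

theorem ost_vv_psd {d : ℕ} (v : Fin d → ℝ) : (vecMulVec v v).PosSemidef := by
  have := Matrix.posSemidef_vecMulVec_self_star v
  simpa using this

def ostQ {E : Type*} {d : ℕ} (v : E → Fin d → ℝ) (S : Finset E) : Matrix (Fin d) (Fin d) ℝ :=
  ∑ e ∈ S, vecMulVec (v e) (v e)

theorem ostQ_psd {E : Type*} {d : ℕ} (v : E → Fin d → ℝ) (S : Finset E) :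
    (ostQ v S).PosSemidef :=
  Matrix.posSemidef_sum _ fun _ _ => ost_vv_psd _

def ostF {E : Type*} {d : ℕ} (v : E → Fin d → ℝ) (p : ℕ) (S : Finset E) : ℝ :=
  (((p : ℝ) • 1 + ostQ v S) ^ p).trace

theorem ostF_eq {E : Type*} {d : ℕ} (v : E → Fin d → ℝ) (p : ℕ) (S : Finset E) :
    ∃ (U : Matrix (Fin d) (Fin d) ℝ) (l : Fin d → ℝ), U * Uᵀ = 1 ∧ Uᵀ * U = 1 ∧
      ostQ v S = U * Matrix.diagonal l * Uᵀ ∧ (∀ k, 0 ≤ l k) ∧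
      ostF v p S = ∑ k, ((p : ℝ) + l k) ^ p := by
  obtain ⟨U, l, h1, h2, h3, h4⟩ := ost_spectral (ostQ_psd v S)
  refine ⟨U, l, h1, h2, h3, h4, ?_⟩
  rw [ostF, ost_pow h1 h2 h3, Matrix.trace_mul_cycle, h2, Matrix.one_mul, Matrix.trace_diagonal]

theorem ostF_nonneg {E : Type*} {d : ℕ} (v : E → Fin d → ℝ) (p : ℕ) (S : Finset E) :
    0 ≤ ostF v p S := by
  obtain ⟨U, l, h1, h2, h3, h4, h5⟩ := ostF_eq v p S
  rw [h5]
  exact Finset.sum_nonneg fun k _ => pow_nonneg (add_nonneg (Nat.cast_nonneg _) (h4 k)) _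

theorem ostF_large {E : Type*} {d : ℕ} (v : E → Fin d → ℝ) (p : ℕ) (S : Finset E) {κ : ℝ}
    (hκ : 0 ≤ κ) (h : ¬ (κ • (1 : Matrix (Fin d) (Fin d) ℝ) - ostQ v S).PosSemidef) :
    ((p : ℝ) + κ) ^ p ≤ ostF v p S := by
  obtain ⟨U, l, h1, h2, h3, h4, h5⟩ := ostF_eq v p S
  by_cases hl : ∃ k, κ < l k
  · obtain ⟨k, hk⟩ := hl
    rw [h5]
    have hn : (0 : ℝ) ≤ p := Nat.cast_nonneg _
    calc ((p : ℝ) + κ) ^ p ≤ ((p : ℝ) + l k) ^ p := by gcongr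
      _ ≤ _ := Finset.single_le_sum (f := fun k => ((p : ℝ) + l k) ^ p)
          (fun k _ => pow_nonneg (add_nonneg hn (h4 k)) _) (Finset.mem_univ k)
  · exfalso
    apply h
    push Not at hl
    have e : κ • (1 : Matrix (Fin d) (Fin d) ℝ) - ostQ v S =
        U * Matrix.diagonal (fun k => κ - l k) * Uᵀ := by
      have : (Matrix.diagonal (fun k => κ - l k)) = κ • 1 - Matrix.diagonal l := by
        ext a b
        by_cases hab : a = b
        · subst hab; simp
        · simp [hab]
      rw [this, Matrix.mul_sub, Matrix.sub_mul, h3]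
      simp [h1]
    rw [e]
    have hd : (Matrix.diagonal (fun k => κ - l k)).PosSemidef :=
      Matrix.PosSemidef.diagonal fun k => by simpa using hl k
    simpa using hd.mul_mul_conjTranspose_same U

theorem ost_conc {E : Type*} [Fintype E] {d : ℕ} (ν : Finset E → ℝ) (hν : ∀ F, 0 ≤ ν F) (k : ℕ)
    (hk : ∀ F, ν F ≠ 0 → F.card = k) (l : E → ℝ)
    (hneg : ∀ S e, e ∉ S → ostUp ν (insert e S) ≤ l e * ostUp ν S)
    (hl : ∀ e, 0 ≤ l e)
    (v : E → Fin d → ℝ) (hv : ∀ e, v e ⬝ᵥ v e ≤ 1)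
    (hsum : ∑ e, l e • vecMulVec (v e) (v e) = 1) (p : ℕ) (hp : 0 < p) :
    ∑ F, ν F * ostF v p F ≤ ((k + 2).choose 2 : ℝ) * ((∑ F, ν F) * (d * (p : ℝ) ^ p)) := by
  have hup : ∀ S, 0 ≤ ostUp ν S := fun S => Finset.sum_nonneg fun F _ => hν F
  set Ψ : ℕ → ℝ := fun i =>
    ∑ S ∈ Finset.powersetCard i (Finset.univ : Finset E), ostUp ν S * ostF v p S with hΨ
  have step : ∀ i, i ≤ k → ((i : ℝ) + 1) * Ψ (i + 1) ≤ ((k : ℝ) - i + 2) * Ψ i := by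
    intro i hi
    simp only [hΨ]
    rw [← ost_double (fun S => ostUp ν S * ostF v p S) i, Finset.mul_sum]
    refine Finset.sum_le_sum fun S hS => ?_
    have hSc : S.card = i := (Finset.mem_powersetCard.1 hS).2
    set P := ((p : ℝ) • 1 + ostQ v S) ^ p with hP
    have hm : ∀ u : Fin d → ℝ, 0 ≤ u ⬝ᵥ (P *ᵥ u) := by
      intro u
      obtain ⟨l, c, hl, hc, h⟩ := ost_moment (ostQ_psd v S) p u
      rw [h]
      exact Finset.sum_nonneg fun k _ =>
        mul_nonneg (pow_nonneg ((Nat.cast_nonneg p).trans (hl k)) _) (hc k)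
    have h1 : ∀ e ∈ Sᶜ, ostUp ν (insert e S) * ostF v p (insert e S) ≤
        ostUp ν (insert e S) * ostF v p S +
          2 * ostUp ν S * (l e * (v e ⬝ᵥ (P *ᵥ v e))) := by
      intro e he
      have he : e ∉ S := by simpa using he
      have hq : ostQ v (insert e S) = ostQ v S + vecMulVec (v e) (v e) := by
        rw [ostQ, Finset.sum_insert he, add_comm]; rfl
      have ht := ost_trace (ostQ_psd v S) hp (v e) (hv e)
      rw [add_assoc, ← hq] at ht
      have ht' : ostF v p (insert e S) ≤ ostF v p S + 2 * v e ⬝ᵥ (P *ᵥ v e) := ht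
      calc _ ≤ ostUp ν (insert e S) * (ostF v p S + 2 * v e ⬝ᵥ (P *ᵥ v e)) :=
            mul_le_mul_of_nonneg_left ht' (hup _)
        _ = ostUp ν (insert e S) * ostF v p S +
            2 * (ostUp ν (insert e S) * v e ⬝ᵥ (P *ᵥ v e)) := by ring
        _ ≤ ostUp ν (insert e S) * ostF v p S +
            2 * ((l e * ostUp ν S) * v e ⬝ᵥ (P *ᵥ v e)) := by
            have := mul_le_mul_of_nonneg_right (hneg S e he) (hm (v e))
            linarith
        _ = _ := by ring
    have h2 : ∑ e, l e * (v e ⬝ᵥ (P *ᵥ v e)) = ostF v p S := by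
      have : (P * ∑ e, l e • vecMulVec (v e) (v e)).trace = ostF v p S := by
        rw [hsum, Matrix.mul_one]; rfl
      rw [← this, Matrix.mul_sum, Matrix.trace_sum]
      refine Finset.sum_congr rfl fun e _ => ?_
      rw [Matrix.mul_smul, Matrix.trace_smul, Matrix.mul_vecMulVec, Matrix.trace_vecMulVec,
        dotProduct_comm, smul_eq_mul]
    have h3 : ∑ e ∈ Sᶜ, l e * (v e ⬝ᵥ (P *ᵥ v e)) ≤ ostF v p S := by
      rw [← h2]
      exact Finset.sum_le_sum_of_subset_of_nonneg (Finset.subset_univ _)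
        fun e _ _ => mul_nonneg (hl e) (hm _)
    refine (Finset.sum_le_sum h1).trans ?_
    rw [Finset.sum_add_distrib, ← Finset.sum_mul, ← Finset.mul_sum, ostUp_sum ν k hk, hSc]
    have := mul_le_mul_of_nonneg_left h3 (mul_nonneg zero_le_two (hup S))
    linarith
  have hΨnn : ∀ i, 0 ≤ Ψ i := fun i =>
    Finset.sum_nonneg fun S _ => mul_nonneg (hup S) (ostF_nonneg v p S)
  have bound : ∀ i, i ≤ k → Ψ i ≤ ((k + 2).choose i : ℝ) * Ψ 0 := by
    intro i
    induction i with
    | zero => intro _; simp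
    | succ i ih =>
      intro hi
      have a := ih (by omega)
      have b := step i (by omega)
      have c : ((k + 2).choose (i + 1) : ℝ) * ((i : ℝ) + 1) = ((k + 2).choose i : ℝ) * ((k : ℝ) - i + 2) := by
        have := Nat.choose_succ_right_eq (k + 2) i
        have h2 : ((k + 2 - i : ℕ) : ℝ) = (k : ℝ) - i + 2 := by
          rw [Nat.cast_sub (by omega)]; push_cast; ring
        rw [← h2]
        exact_mod_cast this
      have hpos : (0 : ℝ) < (i : ℝ) + 1 := by positivity
      have hki : (0 : ℝ) ≤ (k : ℝ) - i + 2 := by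
        have : ((i + 1 : ℕ) : ℝ) ≤ k := by exact_mod_cast hi
        push_cast at this; linarith
      refine le_of_mul_le_mul_left ?_ hpos
      calc _ ≤ _ := b
        _ ≤ ((k : ℝ) - i + 2) * (((k + 2).choose i : ℝ) * Ψ 0) := mul_le_mul_of_nonneg_left a hki
        _ = (((k + 2).choose i : ℝ) * ((k : ℝ) - i + 2)) * Ψ 0 := by ring
        _ = _ := by rw [← c]; ring
  have hend : Ψ k = ∑ F, ν F * ostF v p F := by
    have e1 : ∑ F, ν F * ostF v p F =
        ∑ F ∈ Finset.powersetCard k (Finset.univ : Finset E), ν F * ostF v p F := by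
      symm
      refine Finset.sum_subset (Finset.subset_univ _) fun F _ hF => ?_
      have : ν F = 0 := by
        by_contra h0
        exact hF (Finset.mem_powersetCard_univ.2 (hk F h0))
      simp [this]
    rw [e1]
    refine Finset.sum_congr rfl fun S hS => ?_
    congr 1
    have hS := Finset.mem_powersetCard_univ.1 hS
    refine Finset.sum_eq_single_of_mem S (by simp) fun F hF hne => ?_
    by_contra h0
    have hsub : S ⊆ F := (Finset.mem_filter.1 hF).2
    exact hne (Finset.eq_of_subset_of_card_le hsub (by rw [hk F h0, hS])).symm
  have h0 : Ψ 0 = (∑ F, ν F) * (d * (p : ℝ) ^ p) := by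
    simp only [hΨ, Finset.powersetCard_zero, Finset.sum_singleton]
    congr 1
    · simp [ostUp]
    · simp [ostF, ostQ, smul_pow]; ring
  have := bound k le_rfl
  rw [hend, h0] at this
  refine this.trans_eq ?_
  rw [Nat.choose_symm_add]

def ostM {E : Type*} [Fintype E] {d : ℕ} (u : E → Fin d → ℝ) (x : E → ℝ) :
    Matrix (Fin d) (Fin d) ℝ := ∑ e, x e • vecMulVec (u e) (u e)

def ostD {E : Type*} {d : ℕ} (u : E → Fin d → ℝ) (F : Finset E) : ℝ :=
  (ostQ u F).det

theorem ostM_ind {E : Type*} [Fintype E] {d : ℕ} (u : E → Fin d → ℝ) (F : Finset E) :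
    ostM u (fun e => if e ∈ F then 1 else 0) = ostQ u F := by
  simp [ostM, ostQ, ite_smul, Finset.sum_ite_mem]

theorem ostM_psd {E : Type*} [Fintype E] {d : ℕ} (u : E → Fin d → ℝ) (x : E → ℝ)
    (hx : ∀ e, 0 ≤ x e) : (ostM u x).PosSemidef :=
  Matrix.posSemidef_sum _ fun e _ => (ost_vv_psd _).smul (hx e)

theorem ost_cb_aux {E : Type*} [Fintype E] {d : ℕ} (u : E → Fin d → ℝ) :
    ∃ D : Finset E → ℝ, ∀ x : E → ℝ, (ostM u x).det =
      ∑ F ∈ Finset.powersetCard d (Finset.univ : Finset E), (∏ e ∈ F, x e) * D F := by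
  set g : (Fin d → E) → ℝ := fun r => (Matrix.of fun i => u (r i) i • u (r i)).det with hg
  refine ⟨fun F => ∑ r ∈ (Finset.univ.filter fun r : Fin d → E => Function.Injective r).filter
    (fun r => Finset.univ.image r = F), g r, fun x => ?_⟩
  have h1 : (ostM u x).det = ∑ r : Fin d → E, (∏ i, x (r i)) * g r := by
    have hrow : ostM u x = fun i => ∑ e, x e • (u e i • u e) := by
      ext i j
      simp [ostM, Matrix.sum_apply, vecMulVec_apply]
    have := (Matrix.detRowAlternating (R := ℝ) (n := Fin d)).toMultilinearMap.map_sum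
      (fun i e => x e • (u e i • u e))
    rw [hrow]
    refine this.trans ?_
    refine Finset.sum_congr rfl fun r _ => ?_
    exact MultilinearMap.map_smul_univ _ (fun i => x (r i)) (fun i => u (r i) i • u (r i))
  have h2 : ∀ r : Fin d → E, ¬ Function.Injective r → g r = 0 := by
    intro r hr
    simp only [Function.Injective, not_forall] at hr
    obtain ⟨i, j, hij, hne⟩ := hr
    have : g r = (∏ i, u (r i) i) * (Matrix.of fun i => u (r i)).det :=
      MultilinearMap.map_smul_univ
        (Matrix.detRowAlternating (R := ℝ) (n := Fin d)).toMultilinearMap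
        (fun i => u (r i) i) (fun i => u (r i))
    rw [this, Matrix.det_zero_of_row_eq hne, mul_zero]
    exact congrArg u hij
  rw [h1, ← Finset.sum_filter_add_sum_filter_not Finset.univ (fun r : Fin d → E => Function.Injective r)]
  have h3 : ∑ r ∈ Finset.univ.filter (fun r : Fin d → E => ¬ Function.Injective r),
      (∏ i, x (r i)) * g r = 0 :=
    Finset.sum_eq_zero fun r hr => by rw [h2 r (Finset.mem_filter.1 hr).2, mul_zero]
  rw [h3, add_zero]
  rw [← Finset.sum_fiberwise_of_maps_to (t := Finset.powersetCard d (Finset.univ : Finset E))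
    (g := fun r => Finset.univ.image r)]
  · refine Finset.sum_congr rfl fun F hF => ?_
    rw [Finset.mul_sum]
    refine Finset.sum_congr rfl fun r hr => ?_
    rw [Finset.mem_filter, Finset.mem_filter] at hr
    congr 1
    rw [← hr.2, Finset.prod_image]
    exact fun a _ b _ h => hr.1.2 h
  · intro r hr
    rw [Finset.mem_powersetCard_univ, Finset.card_image_of_injective _ (Finset.mem_filter.1 hr).2]
    simp

theorem ost_cb {E : Type*} [Fintype E] {d : ℕ} (u : E → Fin d → ℝ) (x : E → ℝ) :
    (ostM u x).det =
      ∑ F ∈ Finset.powersetCard d (Finset.univ : Finset E), (∏ e ∈ F, x e) * ostD u F := by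
  obtain ⟨D, hD⟩ := ost_cb_aux u
  rw [hD]
  refine Finset.sum_congr rfl fun F hF => ?_
  congr 1
  rw [ostD, ← ostM_ind, hD, Finset.sum_eq_single_of_mem F hF]
  · rw [Finset.prod_eq_one, one_mul]
    intro e he
    simp [he]
  · intro F' hF' hne
    have : ∃ e ∈ F', e ∉ F := by
      by_contra hcon
      push Not at hcon
      refine hne (Finset.eq_of_subset_of_card_le hcon ?_)
      rw [Finset.mem_powersetCard_univ.1 hF, Finset.mem_powersetCard_univ.1 hF']
    obtain ⟨e, he, he'⟩ := this
    rw [Finset.prod_eq_zero he (by simp [he']), zero_mul]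

/-- the determinantal (unnormalised) measure -/
def ostNu {E : Type*} {d : ℕ} (u : E → Fin d → ℝ) (x : E → ℝ) (F : Finset E) : ℝ :=
  if F.card = d then (∏ e ∈ F, x e) * ostD u F else 0

theorem ostNu_nonneg {E : Type*} {d : ℕ} (u : E → Fin d → ℝ) (x : E → ℝ)
    (hx : ∀ e, 0 ≤ x e) (F : Finset E) : 0 ≤ ostNu u x F := by
  unfold ostNu
  split_ifs
  · exact mul_nonneg (Finset.prod_nonneg fun e _ => hx e) (ostQ_psd u F).det_nonneg
  · exact le_rfl

theorem ostNu_sum {E : Type*} [Fintype E] {d : ℕ} (u : E → Fin d → ℝ) (x : E → ℝ) :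
    ∑ F, ostNu u x F = (ostM u x).det := by
  rw [ost_cb]
  unfold ostNu
  rw [← Finset.sum_filter]
  refine Finset.sum_congr ?_ fun _ _ => rfl
  ext F; simp

theorem ostNu_marg {E : Type*} [Fintype E] {d : ℕ} (u : E → Fin d → ℝ) (x : E → ℝ)
    (hM : (ostM u x).PosDef) (e : E) :
    ∑ F ∈ Finset.univ.filter (fun F => e ∈ F), ostNu u x F =
      (ostM u x).det * (x e * (u e ⬝ᵥ ((ostM u x)⁻¹ *ᵥ u e))) := by
  set y : E → ℝ := fun a => if a = e then 2 * x e else x a with hy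
  have hMy : ostM u y = ostM u x + vecMulVec (x e • u e) (u e) := by
    have : ∀ a, y a • vecMulVec (u a) (u a) = x a • vecMulVec (u a) (u a) +
        if a = e then x e • vecMulVec (u e) (u e) else 0 := by
      intro a
      by_cases ha : a = e
      · subst ha; simp [hy, two_mul, add_smul]
      · simp [hy, ha]
    simp only [ostM, this]
    rw [Finset.sum_add_distrib]
    simp [Matrix.smul_vecMulVec]
  have hν : ∀ F, ostNu u y F = ostNu u x F + if e ∈ F then ostNu u x F else 0 := by
    intro F
    unfold ostNu
    by_cases hc : F.card = d
    · by_cases he : e ∈ F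
      · have : ∏ a ∈ F, y a = 2 * ∏ a ∈ F, x a := by
          rw [← Finset.mul_prod_erase F y he, ← Finset.mul_prod_erase F x he]
          have : ∏ a ∈ F.erase e, y a = ∏ a ∈ F.erase e, x a :=
            Finset.prod_congr rfl fun a ha => by simp [hy, Finset.ne_of_mem_erase ha]
          rw [this]; simp [hy]; ring
        simp only [hc, he, this, if_true]; ring
      · have : ∏ a ∈ F, y a = ∏ a ∈ F, x a :=
          Finset.prod_congr rfl fun a ha => by
            have : a ≠ e := fun h => he (h ▸ ha)
            simp [hy, this]
        simp [hc, he, this]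
    · simp [hc]
  have hs : ∑ F, ostNu u y F = ∑ F, ostNu u x F +
      ∑ F ∈ Finset.univ.filter (fun F => e ∈ F), ostNu u x F := by
    rw [Finset.sum_filter, ← Finset.sum_add_distrib]
    exact Finset.sum_congr rfl fun F _ => hν F
  rw [ostNu_sum, ostNu_sum, hMy] at hs
  have hdet : (ostM u x + vecMulVec (x e • u e) (u e)).det =
      (ostM u x).det * (1 + x e * (u e ⬝ᵥ ((ostM u x)⁻¹ *ᵥ u e))) := by
    have hu : IsUnit (ostM u x).det := (isUnit_iff_ne_zero.2 hM.det_pos.ne')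
    have := Matrix.det_add_replicateCol_mul_replicateRow (ι := Unit) hu (x e • u e) (u e)
    rw [← Matrix.vecMulVec_eq] at this
    rw [this]
    congr 1
    rw [Matrix.det_unique, Matrix.add_apply, Matrix.one_apply_eq]
    congr 1
    rw [Matrix.mul_assoc, ← Matrix.replicateCol_mulVec, Matrix.replicateRow_mul_replicateCol_apply,
      Matrix.mulVec_smul, dotProduct_smul, smul_eq_mul]
  rw [hdet] at hs
  linarith

theorem ost_symm_dot {d : ℕ} {A : Matrix (Fin d) (Fin d) ℝ} (hA : A.IsHermitian)
    (x y : Fin d → ℝ) : x ⬝ᵥ (A *ᵥ y) = y ⬝ᵥ (A *ᵥ x) := by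
  have : Aᵀ = A := by simpa using hA.eq
  rw [Matrix.dotProduct_mulVec, ← Matrix.mulVec_transpose, this, dotProduct_comm]

theorem ost_psd_dot {d : ℕ} {A : Matrix (Fin d) (Fin d) ℝ} (hA : A.PosSemidef)
    (x : Fin d → ℝ) : 0 ≤ x ⬝ᵥ (A *ᵥ x) := by
  simpa using (Matrix.posSemidef_iff_dotProduct_mulVec.1 hA).2 x

theorem ost_inv_mono {d : ℕ} {A B : Matrix (Fin d) (Fin d) ℝ} (hA : A.PosDef) (hB : B.PosDef)
    (hAB : (B - A).PosSemidef) (u : Fin d → ℝ) : u ⬝ᵥ (B⁻¹ *ᵥ u) ≤ u ⬝ᵥ (A⁻¹ *ᵥ u) := by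
  have huA : IsUnit A.det := isUnit_iff_ne_zero.2 hA.det_pos.ne'
  have huB : IsUnit B.det := isUnit_iff_ne_zero.2 hB.det_pos.ne'
  set a := B⁻¹ *ᵥ u with ha
  set b := A⁻¹ *ᵥ u with hb
  have hBa : B *ᵥ a = u := by rw [ha, Matrix.mulVec_mulVec, Matrix.mul_nonsing_inv _ huB, Matrix.one_mulVec]
  have hAb : A *ᵥ b = u := by rw [hb, Matrix.mulVec_mulVec, Matrix.mul_nonsing_inv _ huA, Matrix.one_mulVec]
  have h1 := ost_psd_dot hAB a
  rw [Matrix.sub_mulVec, dotProduct_sub, hBa] at h1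
  have h2 := ost_psd_dot hA.posSemidef (a - b)
  rw [Matrix.mulVec_sub, dotProduct_sub, sub_dotProduct, sub_dotProduct, hAb,
    ost_symm_dot hA.1 b a, hAb] at h2
  rw [dotProduct_comm u a, dotProduct_comm u b]
  linarith

theorem ost_poly {ι : Type*} (s : Finset ι) (a : ι → ℝ) (k : ι → ℕ) (m : ℕ)
    (hk : ∀ i ∈ s, k i ≤ m) (h : ∀ t : ℝ, 1 ≤ t → 0 ≤ ∑ i ∈ s, a i * t ^ (k i)) :
    0 ≤ ∑ i ∈ s, (if k i = m then a i else 0) := by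
  have hlim : Filter.Tendsto (fun t : ℝ => ∑ i ∈ s, a i * (t⁻¹) ^ (m - k i)) Filter.atTop
      (nhds (∑ i ∈ s, (if k i = m then a i else 0))) := by
    refine tendsto_finsetSum _ fun i hi => ?_
    by_cases hi' : k i = m
    · simp [hi']
    · have h0 : m - k i ≠ 0 := by have := hk i hi; omega
      have := ((tendsto_inv_atTop_zero (𝕜 := ℝ)).pow (m - k i)).const_mul (a i)
      simpa [hi', h0] using this
  refine ge_of_tendsto hlim ?_
  filter_upwards [Filter.eventually_ge_atTop (1 : ℝ)] with t ht
  have ht0 : 0 < t := by linarith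
  have : ∑ i ∈ s, a i * (t⁻¹) ^ (m - k i) = (t⁻¹) ^ m * ∑ i ∈ s, a i * t ^ (k i) := by
    rw [Finset.mul_sum]
    refine Finset.sum_congr rfl fun i hi => ?_
    have e : m = (m - k i) + k i := by have := hk i hi; omega
    conv_rhs => rw [e, pow_add]
    have : (t⁻¹) ^ (k i) * t ^ (k i) = 1 := by
      rw [← mul_pow, inv_mul_cancel₀ ht0.ne', one_pow]
    calc _ = a i * t⁻¹ ^ (m - k i) * ((t⁻¹) ^ (k i) * t ^ (k i)) := by rw [this, mul_one]
      _ = _ := by ring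
  rw [this]
  exact mul_nonneg (by positivity) (h t ht)

def ostL {E : Type*} [Fintype E] {d : ℕ} (u : E → Fin d → ℝ) (x : E → ℝ) (e : E) : ℝ :=
  x e * (u e ⬝ᵥ ((ostM u x)⁻¹ *ᵥ u e))

theorem ost_neg {E : Type*} [Fintype E] {d : ℕ} (u : E → Fin d → ℝ) (x : E → ℝ)
    (hx : ∀ e, 0 ≤ x e) (hM : (ostM u x).PosDef) (S : Finset E) (e : E) (he : e ∉ S) :
    ostUp (ostNu u x) (insert e S) ≤ ostL u x e * ostUp (ostNu u x) S := by
  have key : ∀ t : ℝ, 1 ≤ t → 0 ≤ ∑ F : Finset E,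
      ((ostL u x e - if e ∈ F then 1 else 0) * ostNu u x F) * t ^ (F ∩ S).card := by
    intro t ht
    set y : E → ℝ := fun a => if a ∈ S then t * x a else x a with hy
    have hxy : ∀ a, x a ≤ y a := by
      intro a
      simp only [hy]
      split_ifs
      · exact le_mul_of_one_le_left (hx a) ht
      · exact le_rfl
    have hMM : (ostM u y - ostM u x).PosSemidef := by
      have : ostM u y - ostM u x = ostM u (fun a => y a - x a) := by
        simp only [ostM, sub_smul, Finset.sum_sub_distrib]
      rw [this]
      exact ostM_psd u _ fun a => sub_nonneg.2 (hxy a)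
    have hMy : (ostM u y).PosDef := by
      have := hM.add_posSemidef hMM
      simpa using this
    have hν : ∀ F, ostNu u y F = ostNu u x F * t ^ (F ∩ S).card := by
      intro F
      unfold ostNu
      split_ifs
      · have : ∏ a ∈ F, y a = (∏ a ∈ F, x a) * t ^ (F ∩ S).card := by
          have : ∀ a, y a = x a * if a ∈ S then t else 1 := by
            intro a; simp only [hy]; split_ifs <;> ring
          simp only [this]
          rw [Finset.prod_mul_distrib, Finset.prod_ite_mem, Finset.prod_const]
        rw [this]; ring
      · simp
    have hm := ostNu_marg u y hMy e
    have hye : y e = x e := by simp [hy, he]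
    have hinv := ost_inv_mono hM hMy hMM (u e)
    have hle : ∑ F ∈ Finset.univ.filter (fun F => e ∈ F), ostNu u y F ≤
        (∑ F, ostNu u y F) * ostL u x e := by
      rw [hm, hye, ostNu_sum]
      exact mul_le_mul_of_nonneg_left (mul_le_mul_of_nonneg_left hinv (hx e)) hMy.det_pos.le
    rw [Finset.sum_filter, Finset.sum_mul] at hle
    have : ∑ F : Finset E, ((ostL u x e - if e ∈ F then 1 else 0) * ostNu u x F) * t ^ (F ∩ S).card
        = ∑ F, ostNu u y F * ostL u x e - ∑ F, if e ∈ F then ostNu u y F else 0 := by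
      rw [← Finset.sum_sub_distrib]
      refine Finset.sum_congr rfl fun F _ => ?_
      rw [hν]
      split_ifs <;> ring
    rw [this]
    linarith
  have := ost_poly Finset.univ (fun F => (ostL u x e - if e ∈ F then 1 else 0) * ostNu u x F)
    (fun F => (F ∩ S).card) S.card (fun F _ => Finset.card_le_card Finset.inter_subset_right) key
  have e2 : ∑ F : Finset E, (if (F ∩ S).card = S.card then
      (ostL u x e - if e ∈ F then 1 else 0) * ostNu u x F else 0) =
      ostL u x e * ostUp (ostNu u x) S - ostUp (ostNu u x) (insert e S) := by
    unfold ostUp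
    rw [Finset.sum_filter, Finset.sum_filter, Finset.mul_sum, ← Finset.sum_sub_distrib]
    refine Finset.sum_congr rfl fun F _ => ?_
    have hiff : (F ∩ S).card = S.card ↔ S ⊆ F := by
      constructor
      · intro h
        have := Finset.eq_of_subset_of_card_le (Finset.inter_subset_right (s₁ := F) (s₂ := S)) h.ge
        rw [← this]; exact Finset.inter_subset_left
      · intro h; rw [Finset.inter_eq_right.2 h]
    simp only [hiff, Finset.insert_subset_iff]
    by_cases h1 : S ⊆ F <;> by_cases h2 : e ∈ F <;> (simp [h1, h2]; try ring)
  rw [e2] at this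
  linarith

theorem ost_factor {d : ℕ} {A : Matrix (Fin d) (Fin d) ℝ} (hA : A.PosSemidef) :
    ∃ C : Matrix (Fin d) (Fin d) ℝ, A = Cᵀ * C := by
  obtain ⟨U, l, h1, h2, h3, h4⟩ := ost_spectral hA
  refine ⟨Matrix.diagonal (fun k => Real.sqrt (l k)) * Uᵀ, ?_⟩
  rw [Matrix.transpose_mul, Matrix.transpose_transpose, Matrix.diagonal_transpose,
    Matrix.mul_assoc U, ← Matrix.mul_assoc (Matrix.diagonal _), Matrix.diagonal_mul_diagonal,
    ← Matrix.mul_assoc]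
  simp only [Real.mul_self_sqrt (h4 _)]
  exact h3

theorem ost_det {E : Type*} [Fintype E] {d : ℕ} (u : E → Fin d → ℝ) (x : E → ℝ)
    (hx : ∀ e, 0 ≤ x e) (hM : (ostM u x).PosDef) {κ : ℝ} (hκ : 0 ≤ κ) (p : ℕ) (hp : 0 < p) :
    (∑ F ∈ Finset.univ.filter (fun F : Finset E => ¬ (κ • ostM u x -
        ∑ e ∈ F, (x e / ostL u x e) • vecMulVec (u e) (u e)).PosSemidef), ostNu u x F) *
      ((p : ℝ) + κ) ^ p ≤
      ((d + 2).choose 2 : ℝ) * ((ostM u x).det * (d * (p : ℝ) ^ p)) := by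
  obtain ⟨C, hC⟩ := ost_factor hM.posSemidef
  have hCu : IsUnit C.det := by
    refine isUnit_iff_ne_zero.2 fun h => hM.det_pos.ne' ?_
    rw [hC, Matrix.det_mul, h, mul_zero]
  have hCi : C * C⁻¹ = 1 := Matrix.mul_nonsing_inv _ hCu
  have hCi' : C⁻¹ * C = 1 := Matrix.nonsing_inv_mul _ hCu
  have hCt : (C⁻¹)ᵀ * Cᵀ = 1 := by rw [← Matrix.transpose_mul, hCi, Matrix.transpose_one]
  have hCt' : Cᵀ * (C⁻¹)ᵀ = 1 := by rw [← Matrix.transpose_mul, hCi', Matrix.transpose_one]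
  have hMi : (ostM u x)⁻¹ = C⁻¹ * (C⁻¹)ᵀ := by
    rw [hC, Matrix.mul_inv_rev, Matrix.transpose_nonsing_inv]
  have hLn : ∀ e, 0 ≤ u e ⬝ᵥ ((ostM u x)⁻¹ *ᵥ u e) := fun e => ost_psd_dot hM.inv.posSemidef _
  have hL : ∀ e, 0 ≤ ostL u x e := fun e => mul_nonneg (hx e) (hLn e)
  set c : E → ℝ := fun e => x e / ostL u x e with hc
  have hcn : ∀ e, 0 ≤ c e := fun e => div_nonneg (hx e) (hL e)
  set v : E → Fin d → ℝ := fun e => Real.sqrt (c e) • ((C⁻¹)ᵀ *ᵥ u e) with hv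
  have hnorm : ∀ e, ((C⁻¹)ᵀ *ᵥ u e) ⬝ᵥ ((C⁻¹)ᵀ *ᵥ u e) = u e ⬝ᵥ ((ostM u x)⁻¹ *ᵥ u e) := by
    intro e
    rw [hMi, ← Matrix.mulVec_mulVec, Matrix.dotProduct_mulVec (u e), ← Matrix.mulVec_transpose]
  have hvv : ∀ e, vecMulVec (v e) (v e) = c e • ((C⁻¹)ᵀ * vecMulVec (u e) (u e) * C⁻¹) := by
    intro e
    simp only [hv]
    rw [Matrix.smul_vecMulVec, Matrix.vecMulVec_smul, smul_smul, Real.mul_self_sqrt (hcn e),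
      Matrix.mul_vecMulVec, Matrix.vecMulVec_mul, ← Matrix.mulVec_transpose]
  have hv1 : ∀ e, v e ⬝ᵥ v e ≤ 1 := by
    intro e
    simp only [hv]
    rw [smul_dotProduct, dotProduct_smul, smul_smul, Real.mul_self_sqrt (hcn e), hnorm, smul_eq_mul,
      hc]
    simp only
    rw [div_mul_eq_mul_div]
    exact div_self_le_one _
  have hsum : ∑ e, ostL u x e • vecMulVec (v e) (v e) = 1 := by
    have h1 : ∀ e, ostL u x e • vecMulVec (v e) (v e) =
        (C⁻¹)ᵀ * (x e • vecMulVec (u e) (u e)) * C⁻¹ := by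
      intro e
      rw [hvv, smul_smul]
      by_cases h0 : ostL u x e = 0
      · rw [h0, zero_mul, zero_smul]
        rcases mul_eq_zero.1 h0 with h | h
        · simp [h]
        · have : (C⁻¹)ᵀ *ᵥ u e = 0 := by
            rw [← hnorm] at h
            exact dotProduct_self_eq_zero.1 h
          rw [Matrix.mul_smul, Matrix.mul_vecMulVec, this]
          simp
      · rw [hc]
        simp only
        rw [mul_div_cancel₀ _ h0, Matrix.mul_smul, Matrix.smul_mul]
    simp only [h1]
    rw [← Finset.sum_mul, ← Finset.mul_sum]
    change (C⁻¹)ᵀ * ostM u x * C⁻¹ = 1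
    rw [hC, ← Matrix.mul_assoc, hCt, Matrix.one_mul, hCi]
  have hconc := ost_conc (ostNu u x) (ostNu_nonneg u x hx) d
    (fun F hF => by by_contra h; exact hF (by simp [ostNu, h]))
    (ostL u x) (fun S e he => ost_neg u x hx hM S e he) hL v hv1 hsum p hp
  rw [ostNu_sum] at hconc
  refine le_trans ?_ hconc
  rw [Finset.sum_mul, Finset.sum_filter]
  refine Finset.sum_le_sum fun F _ => ?_
  have hnu := ostNu_nonneg u x hx F
  split_ifs with h
  · exact mul_nonneg hnu (ostF_nonneg v p F)
  · refine mul_le_mul_of_nonneg_left (ostF_large v p F hκ fun hpsd => h ?_) hnu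
    have := hpsd.conjTranspose_mul_mul_same C
    rw [Matrix.conjTranspose_eq_transpose_of_trivial] at this
    convert this using 1
    rw [Matrix.mul_sub, Matrix.sub_mul, Matrix.mul_smul, Matrix.smul_mul, Matrix.mul_one, ← hC]
    congr 1
    rw [ostQ, Finset.mul_sum, Finset.sum_mul]
    refine Finset.sum_congr rfl fun e _ => ?_
    rw [hvv, Matrix.mul_smul, Matrix.smul_mul]
    congr 1
    rw [show Cᵀ * ((C⁻¹)ᵀ * vecMulVec (u e) (u e) * C⁻¹) * C =
      (Cᵀ * (C⁻¹)ᵀ) * vecMulVec (u e) (u e) * (C⁻¹ * C) by simp only [Matrix.mul_assoc], hCt', hCi',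
      Matrix.one_mul, Matrix.mul_one]

/-- signed incidence vector of an edge; a loop gives a coordinate vector -/
def ostZ (n : ℕ) (e : Sym2 (Fin n)) : Fin n → ℤ :=
  if (Quot.out e).1 = (Quot.out e).2 then Pi.single (Quot.out e).1 1
  else Pi.single (Quot.out e).1 1 - Pi.single (Quot.out e).2 1

def ostU (n : ℕ) (e : Sym2 (Fin n)) : Fin n → ℝ := fun i => (ostZ n e i : ℝ)

theorem ostZ_loop (n : ℕ) (a : Fin n) : ostZ n s(a, a) = Pi.single a 1 := by
  have h : s((Quot.out s(a, a)).1, (Quot.out s(a, a)).2) = s(a, a) := Quot.out_eq _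
  rw [Sym2.eq_iff] at h
  have h1 : (Quot.out s(a, a)).1 = a := by tauto
  have h2 : (Quot.out s(a, a)).2 = a := by tauto
  simp [ostZ, h1, h2]

theorem ostZ_edge (n : ℕ) (a b : Fin n) (hab : a ≠ b) :
    ostZ n s(a, b) = Pi.single a 1 - Pi.single b 1 ∨
      ostZ n s(a, b) = Pi.single b 1 - Pi.single a 1 := by
  have h : s((Quot.out s(a, b)).1, (Quot.out s(a, b)).2) = s(a, b) := Quot.out_eq _
  rw [Sym2.eq_iff] at h
  rcases h with ⟨h1, h2⟩ | ⟨h1, h2⟩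
  · left; simp [ostZ, h1, h2, hab]
  · right; simp [ostZ, h1, h2, hab.symm]

theorem ostU_loop (n : ℕ) (a : Fin n) : ostU n s(a, a) = Pi.single a 1 := by
  ext i
  rw [ostU, ostZ_loop]
  by_cases h : i = a
  · subst h; simp
  · simp [h]

theorem ostU_edge (n : ℕ) (a b : Fin n) (hab : a ≠ b) :
    ostU n s(a, b) = Pi.single a 1 - Pi.single b 1 ∨
      ostU n s(a, b) = Pi.single b 1 - Pi.single a 1 := by
  have hs : ∀ a i : Fin n, (((Pi.single a 1 : Fin n → ℤ) i : ℤ) : ℝ) = (Pi.single a 1 : Fin n → ℝ) i := by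
    intro a i
    by_cases h : i = a
    · subst h; simp
    · simp [h]
  rcases ostZ_edge n a b hab with h | h
  · left; ext i; rw [ostU, h]; simp [hs]
  · right; ext i; rw [ostU, h]; simp [hs]

theorem ostU_mat (n : ℕ) (e : Sym2 (Fin n)) : vecMulVec (ostU n e) (ostU n e) = edgeMat n e := by
  induction e using Sym2.ind with
  | _ a b =>
    ext i j
    by_cases hab : a = b
    · subst hab
      rw [ostU_loop, vecMulVec_apply, edgeMat]
      simp only [Pi.single_apply, Sym2.mem_iff, or_self]
      by_cases h1 : i = a <;> by_cases h2 : j = a <;> simp_all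
      · intro h; exact absurd h.symm h2
    · rw [vecMulVec_apply, edgeMat]
      have hba : b ≠ a := fun h => hab h.symm
      rcases ostU_edge n a b hab with h | h <;> rw [h] <;>
      simp only [Pi.sub_apply, Pi.single_apply, Sym2.mem_iff] <;>
      by_cases h1 : i = a <;> by_cases h2 : j = a <;> by_cases h3 : i = b <;> by_cases h4 : j = b <;>
        simp_all <;> grind

theorem ostU_dot (n : ℕ) (a b : Fin n) (hab : a ≠ b) (z : Fin n → ℝ) (hz : z a = z b) :
    ostU n s(a, b) ⬝ᵥ z = 0 := by
  rcases ostU_edge n a b hab with h | h <;> rw [h, sub_dotProduct] <;> simp [hz]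

theorem ostD_zero {E : Type*} {d : ℕ} (u : E → Fin d → ℝ) (F : Finset E) (z : Fin d → ℝ)
    (hz : z ≠ 0) (h : ∀ e ∈ F, u e ⬝ᵥ z = 0) : ostD u F = 0 := by
  refine Matrix.exists_mulVec_eq_zero_iff.1 ⟨z, hz, ?_⟩
  rw [ostQ, Matrix.sum_mulVec]
  refine Finset.sum_eq_zero fun e he => ?_
  rw [Matrix.vecMulVec_mulVec, h e he]
  simp

theorem ostD_one (n : ℕ) (F : Finset (Sym2 (Fin n))) (hF : F.card = n) (r : Fin n)
    (hr : s(r, r) ∈ F)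
    (hc : (SimpleGraph.fromEdgeSet (↑(F.erase s(r, r)) : Set (Sym2 (Fin n)))).Connected) :
    ostD (ostU n) F = 1 := by
  set f := (Finset.equivFinOfCardEq hF).symm with hf
  set A : Matrix (Fin n) (Fin n) ℤ := Matrix.of fun i => ostZ n (f i) with hA
  have hrange : ∀ e ∈ F, ostZ n e ∈ LinearMap.range A.vecMulLinear := by
    intro e he
    refine ⟨Pi.single (f.symm ⟨e, he⟩) 1, ?_⟩
    rw [Matrix.vecMulLinear_apply, Matrix.single_one_vecMul]
    ext i
    simp [hA, Matrix.row]
  have hsingle : ∀ a : Fin n, (Pi.single a 1 : Fin n → ℤ) ∈ LinearMap.range A.vecMulLinear := by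
    intro a
    have := hc.preconnected r a
    rw [SimpleGraph.reachable_iff_reflTransGen] at this
    induction this with
    | refl => rw [← ostZ_loop]; exact hrange _ hr
    | @tail b c _ hbc ih =>
      rw [SimpleGraph.fromEdgeSet_adj] at hbc
      have hm : s(b, c) ∈ F := Finset.mem_of_mem_erase (Finset.mem_coe.1 hbc.1)
      have h1 := hrange _ hm
      rcases ostZ_edge n b c hbc.2 with h | h
      · rw [h] at h1
        have := Submodule.sub_mem _ ih h1
        simpa using this
      · rw [h] at h1
        have := Submodule.add_mem _ h1 ih
        simpa using this
  have hsurj : Function.Surjective A.vecMul := by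
    intro z
    have : z ∈ LinearMap.range A.vecMulLinear := by
      have hz : z = ∑ a, z a • (Pi.single a 1 : Fin n → ℤ) := by
        ext i; simp [Finset.sum_apply, Pi.single_apply]
      rw [hz]
      exact Submodule.sum_mem _ fun a _ => Submodule.smul_mem _ _ (hsingle a)
    obtain ⟨y, hy⟩ := this
    exact ⟨y, hy⟩
  have hu : IsUnit A := Matrix.vecMul_surjective_iff_isUnit.1 hsurj
  have hdet : A.det * A.det = 1 := by
    rw [Matrix.isUnit_iff_isUnit_det] at hu
    rcases Int.isUnit_iff.1 hu with h | h <;> rw [h] <;> norm_num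
  have hQ : ostQ (ostU n) F = (A.map (Int.castRingHom ℝ))ᵀ * A.map (Int.castRingHom ℝ) := by
    ext i j
    rw [ostQ, Matrix.sum_apply, Matrix.mul_apply, ← Finset.sum_coe_sort, ← Equiv.sum_comp f]
    refine Finset.sum_congr rfl fun k _ => ?_
    simp [hA, vecMulVec_apply, ostU]
  rw [ostD, hQ, Matrix.det_mul, Matrix.det_transpose, ← RingHom.mapMatrix_apply, ← RingHom.map_det,
    ← map_mul, hdet, map_one]

def ostX (n : ℕ) (G : SimpleGraph (Fin n)) (w : Sym2 (Fin n) → ℝ) (r : Fin n)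
    (e : Sym2 (Fin n)) : ℝ :=
  if e ∈ G.edgeSet then w e else if e = s(r, r) then 1 else 0

theorem ost_loop_notMem {n : ℕ} (G : SimpleGraph (Fin n)) (r : Fin n) : s(r, r) ∉ G.edgeSet := by
  simp

theorem ostNu_tree (n : ℕ) (G : SimpleGraph (Fin n)) (w : Sym2 (Fin n) → ℝ) (r : Fin n)
    (F : Finset (Sym2 (Fin n))) :
    ostNu (ostU n) (ostX n G w r) F =
      if s(r, r) ∈ F ∧ IsSpanningTree n G (F.erase s(r, r)) then treeWt n w (F.erase s(r, r))
      else 0 := by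
  have hn : 0 < n := r.pos
  by_cases hsub : ∀ e ∈ F, e ∈ G.edgeSet ∨ e = s(r, r)
  · have hone : (1 : Fin n → ℝ) ≠ 0 := fun h => by simpa using congrFun h r
    by_cases hr : s(r, r) ∈ F
    · have hT : (↑(F.erase s(r, r)) : Set (Sym2 (Fin n))) ⊆ G.edgeSet := by
        intro e he
        have he := Finset.mem_erase.1 (Finset.mem_coe.1 he)
        exact (hsub e he.2).resolve_right he.1
      have hprod : ∏ e ∈ F, ostX n G w r e = treeWt n w (F.erase s(r, r)) := by
        rw [← Finset.mul_prod_erase F _ hr, treeWt]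
        have h1 : ostX n G w r s(r, r) = 1 := by simp [ostX]
        rw [h1, one_mul]
        refine Finset.prod_congr rfl fun e he => ?_
        have : e ∈ G.edgeSet := hT he
        simp [ostX, this]
      by_cases hcard : F.card = n
      · have hcard' : (F.erase s(r, r)).card = n - 1 := by rw [Finset.card_erase_of_mem hr, hcard]
        by_cases hc : (SimpleGraph.fromEdgeSet (↑(F.erase s(r, r)) : Set (Sym2 (Fin n)))).Connected
        · rw [if_pos ⟨hr, hT, hc, hcard'⟩, ostNu, if_pos hcard, hprod, ostD_one n F hcard r hr hc,
            mul_one]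
        · rw [if_neg (fun h => hc h.2.2.1), ostNu, if_pos hcard]
          set H := SimpleGraph.fromEdgeSet (↑(F.erase s(r, r)) : Set (Sym2 (Fin n))) with hH
          have hex : ∃ a, ¬ H.Reachable r a := by
            by_contra hcon
            push Not at hcon
            have : Nonempty (Fin n) := ⟨r⟩
            exact hc ⟨fun a b => (hcon a).symm.trans (hcon b)⟩
          obtain ⟨a, ha⟩ := hex
          rw [ostD_zero (ostU n) F (fun b => if H.Reachable r b then 0 else 1), mul_zero]
          · intro h
            have := congrFun h a
            simp [ha] at this
          · intro e he
            by_cases her : e = s(r, r)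
            · subst her
              rw [ostU_loop]
              simp
            · induction e using Sym2.ind with
              | _ b c =>
                have hG : s(b, c) ∈ G.edgeSet := (hsub _ he).resolve_right her
                have hbc : b ≠ c := (G.mem_edgeSet.1 hG).ne
                have hadj : H.Adj b c := by
                  rw [hH, SimpleGraph.fromEdgeSet_adj]
                  exact ⟨Finset.mem_coe.2 (Finset.mem_erase.2 ⟨her, he⟩), hbc⟩
                apply ostU_dot n b c hbc
                have : H.Reachable r b ↔ H.Reachable r c :=
                  ⟨fun h => h.trans hadj.reachable, fun h => h.trans hadj.symm.reachable⟩
                simp only [this]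
      · rw [ostNu, if_neg hcard, if_neg]
        rintro ⟨_, _, _, h⟩
        rw [Finset.card_erase_of_mem hr] at h
        have : 0 < F.card := Finset.card_pos.2 ⟨_, hr⟩
        omega
    · rw [if_neg (fun h => hr h.1), ostNu]
      split_ifs
      · rw [ostD_zero (ostU n) F 1 hone, mul_zero]
        intro e he
        induction e using Sym2.ind with
        | _ b c =>
          have hG : s(b, c) ∈ G.edgeSet := (hsub _ he).resolve_right (fun h => hr (h ▸ he))
          exact ostU_dot n b c (G.mem_edgeSet.1 hG).ne 1 rfl
      · rfl
  · push Not at hsub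
    obtain ⟨e, he, h1, h2⟩ := hsub
    rw [if_neg, ostNu]
    · split_ifs
      · rw [Finset.prod_eq_zero he (by simp [ostX, h1, h2]), zero_mul]
      · rfl
    · rintro ⟨_, h, _⟩
      exact h1 (h (Finset.mem_coe.2 (Finset.mem_erase.2 ⟨h2, he⟩)))

theorem ost_transport (n : ℕ) (G : SimpleGraph (Fin n)) (w : Sym2 (Fin n) → ℝ) (r : Fin n)
    (g : Finset (Sym2 (Fin n)) → ℝ) :
    ∑ F, ostNu (ostU n) (ostX n G w r) F * g F =
      ∑ T ∈ Finset.univ.filter (fun T => IsSpanningTree n G T),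
        treeWt n w T * g (insert s(r, r) T) := by
  have : ∀ F, ostNu (ostU n) (ostX n G w r) F * g F =
      if s(r, r) ∈ F ∧ IsSpanningTree n G (F.erase s(r, r)) then
        treeWt n w (F.erase s(r, r)) * g F else 0 := by
    intro F; rw [ostNu_tree]; split_ifs <;> simp
  simp only [this]
  rw [← Finset.sum_filter]
  have hnot : ∀ T, IsSpanningTree n G T → s(r, r) ∉ T :=
    fun T hT h => ost_loop_notMem G r (hT.1 (Finset.mem_coe.2 h))
  refine Finset.sum_bij' (fun F _ => F.erase s(r, r)) (fun T _ => insert s(r, r) T) ?_ ?_ ?_ ?_ ?_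
  · intro F hF
    simp only [Finset.mem_filter, Finset.mem_univ, true_and] at hF ⊢
    exact hF.2
  · intro T hT
    simp only [Finset.mem_filter, Finset.mem_univ, true_and] at hT ⊢
    rw [Finset.erase_insert (hnot T hT)]
    exact ⟨Finset.mem_insert_self _ _, hT⟩
  · intro F hF
    simp only [Finset.mem_filter, Finset.mem_univ, true_and] at hF
    exact Finset.insert_erase hF.1
  · intro T hT
    simp only [Finset.mem_filter, Finset.mem_univ, true_and] at hT
    exact Finset.erase_insert (hnot T hT)
  · intro F hF
    simp only [Finset.mem_filter, Finset.mem_univ, true_and] at hF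
    rw [Finset.insert_erase hF.1]

theorem ostM_eq (n : ℕ) (G : SimpleGraph (Fin n)) (w : Sym2 (Fin n) → ℝ) (r : Fin n) :
    ostM (ostU n) (ostX n G w r) = lap n G w + edgeMat n s(r, r) := by
  have h : ∀ e : Sym2 (Fin n), ostX n G w r e • vecMulVec (ostU n e) (ostU n e) =
      (if e ∈ G.edgeSet then w e else 0) • edgeMat n e +
        (if e = s(r, r) then edgeMat n e else 0) := by
    intro e
    rw [ostU_mat, ostX]
    by_cases h1 : e ∈ G.edgeSet
    · have h2 : e ≠ s(r, r) := fun h => ost_loop_notMem G r (h ▸ h1)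
      rw [if_pos h1, if_pos h1, if_neg h2, add_zero]
    · rw [if_neg h1, if_neg h1, zero_smul, zero_add]
      by_cases h2 : e = s(r, r)
      · rw [if_pos h2, if_pos h2, one_smul]
      · rw [if_neg h2, if_neg h2, zero_smul]
  rw [ostM, lap, Finset.sum_congr rfl fun e _ => h e, Finset.sum_add_distrib]
  congr 1
  rw [Finset.sum_ite_eq' Finset.univ s(r, r) (fun e => edgeMat n e), if_pos (Finset.mem_univ _)]

theorem ost_tree_exists (n : ℕ) (G : SimpleGraph (Fin n)) (hG : G.Connected) :
    ∃ T, IsSpanningTree n G T := by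
  obtain ⟨H, hle, hH⟩ := hG.exists_isTree_le
  refine ⟨H.edgeFinset, ?_, ?_, ?_⟩
  · rw [SimpleGraph.coe_edgeFinset]
    exact SimpleGraph.edgeSet_mono hle
  · rw [SimpleGraph.coe_edgeFinset, SimpleGraph.fromEdgeSet_edgeSet]
    exact hH.connected
  · have := hH.card_edgeFinset
    rw [Fintype.card_fin] at this
    omega

def ostTot (n : ℕ) (G : SimpleGraph (Fin n)) (w : Sym2 (Fin n) → ℝ) : ℝ :=
  ∑ T' ∈ Finset.univ.filter (fun T' => IsSpanningTree n G T'), treeWt n w T'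

theorem ost_wt_pos (n : ℕ) (G : SimpleGraph (Fin n)) (w : Sym2 (Fin n) → ℝ)
    (hw : ∀ e ∈ G.edgeSet, 0 < w e) (T) (hT : IsSpanningTree n G T) : 0 < treeWt n w T :=
  Finset.prod_pos fun e he => hw e (hT.1 (Finset.mem_coe.2 he))

theorem ostTot_pos (n : ℕ) (G : SimpleGraph (Fin n)) (hG : G.Connected) (w : Sym2 (Fin n) → ℝ)
    (hw : ∀ e ∈ G.edgeSet, 0 < w e) : 0 < ostTot n G w := by
  obtain ⟨T, hT⟩ := ost_tree_exists n G hG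
  refine Finset.sum_pos (fun T hT => ost_wt_pos n G w hw T (Finset.mem_filter.1 hT).2)
    ⟨T, Finset.mem_filter.2 ⟨Finset.mem_univ _, hT⟩⟩

theorem ost_det_tot (n : ℕ) (G : SimpleGraph (Fin n)) (w : Sym2 (Fin n) → ℝ) (r : Fin n) :
    (ostM (ostU n) (ostX n G w r)).det = ostTot n G w := by
  have := ost_transport n G w r (fun _ => 1)
  simp only [mul_one] at this
  rw [← ostNu_sum, this, ostTot]

theorem ostX_nonneg (n : ℕ) (G : SimpleGraph (Fin n)) (w : Sym2 (Fin n) → ℝ)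
    (hw : ∀ e ∈ G.edgeSet, 0 < w e) (r : Fin n) (e : Sym2 (Fin n)) : 0 ≤ ostX n G w r e := by
  rw [ostX]
  split_ifs with h
  · exact (hw e h).le
  · exact zero_le_one
  · exact le_rfl

theorem ostM_pd (n : ℕ) (G : SimpleGraph (Fin n)) (hG : G.Connected) (w : Sym2 (Fin n) → ℝ)
    (hw : ∀ e ∈ G.edgeSet, 0 < w e) (r : Fin n) : (ostM (ostU n) (ostX n G w r)).PosDef := by
  rw [Matrix.PosSemidef.posDef_iff_det_ne_zero (ostM_psd _ _ (ostX_nonneg n G w hw r)),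
    ost_det_tot]
  exact (ostTot_pos n G hG w hw).ne'

theorem ostL_lev (n : ℕ) (G : SimpleGraph (Fin n)) (hG : G.Connected) (w : Sym2 (Fin n) → ℝ)
    (hw : ∀ e ∈ G.edgeSet, 0 < w e) (r : Fin n) (e : Sym2 (Fin n)) (he : e ≠ s(r, r)) :
    ostL (ostU n) (ostX n G w r) e = lev n G w e := by
  have hpos := ostTot_pos n G hG w hw
  have h1 := ostNu_marg (ostU n) (ostX n G w r) (ostM_pd n G hG w hw r) e
  have h2 := ost_transport n G w r (fun F => if e ∈ F then 1 else 0)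
  have h3 : ∑ F, ostNu (ostU n) (ostX n G w r) F * (if e ∈ F then 1 else 0) =
      ostTot n G w * ostL (ostU n) (ostX n G w r) e := by
    rw [ostL, ← ost_det_tot n G w r, ← h1, Finset.sum_filter]
    refine Finset.sum_congr rfl fun F _ => ?_
    by_cases h : e ∈ F <;> simp [h]
  have h4 : lev n G w e = (∑ T ∈ Finset.univ.filter (fun T => IsSpanningTree n G T),
        treeWt n w T * (if e ∈ insert s(r, r) T then 1 else 0)) / ostTot n G w := by
    rw [lev, Finset.sum_div, Finset.sum_filter, Finset.sum_filter]
    refine Finset.sum_congr rfl fun T _ => ?_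
    rw [treeProb, ← ostTot]
    by_cases h : IsSpanningTree n G T <;> by_cases h' : e ∈ T <;> simp [h, h', he]
  rw [h4, ← h2, h3, mul_div_cancel_left₀ _ hpos.ne']

theorem ost_proj (n : ℕ) (r : Fin n) (A : Matrix (Fin n) (Fin n) ℝ)
    (hA : A = 1 - vecMulVec 1 (Pi.single r 1)) (e : Sym2 (Fin n)) :
    Aᵀ *ᵥ ostU n e = if e.IsDiag then Aᵀ *ᵥ ostU n e else ostU n e := by
  split_ifs with h
  · rfl
  · induction e using Sym2.ind with
    | _ a b =>
      have hab : a ≠ b := by simpa using h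
      rw [hA, Matrix.transpose_sub, Matrix.transpose_one, Matrix.sub_mulVec, Matrix.one_mulVec,
        Matrix.transpose_vecMulVec, Matrix.vecMulVec_mulVec, dotProduct_comm,
        ostU_dot n a b hab 1 rfl]
      simp

theorem ost_proj_mat (n : ℕ) (r : Fin n) (A : Matrix (Fin n) (Fin n) ℝ)
    (hA : A = 1 - vecMulVec 1 (Pi.single r 1)) (e : Sym2 (Fin n)) (he : ¬ e.IsDiag) :
    Aᵀ * edgeMat n e * A = edgeMat n e := by
  have := ost_proj n r A hA e
  rw [if_neg he] at this
  rw [← ostU_mat, Matrix.mul_vecMulVec, this, Matrix.vecMulVec_mul, ← Matrix.mulVec_transpose, this]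

theorem ost_proj_loop (n : ℕ) (r : Fin n) (A : Matrix (Fin n) (Fin n) ℝ)
    (hA : A = 1 - vecMulVec 1 (Pi.single r 1)) :
    Aᵀ * edgeMat n s(r, r) * A = 0 := by
  have : Aᵀ *ᵥ ostU n s(r, r) = 0 := by
    rw [ostU_loop, hA, Matrix.transpose_sub, Matrix.transpose_one, Matrix.sub_mulVec,
      Matrix.one_mulVec, Matrix.transpose_vecMulVec, Matrix.vecMulVec_mulVec]
    simp
  rw [← ostU_mat, Matrix.mul_vecMulVec, this]
  simp

theorem ost_reduce (n : ℕ) (G : SimpleGraph (Fin n)) (hG : G.Connected) (w : Sym2 (Fin n) → ℝ)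
    (hw : ∀ e ∈ G.edgeSet, 0 < w e) (r : Fin n) (κ : ℝ) (T) (hT : IsSpanningTree n G T)
    (h : (κ • ostM (ostU n) (ostX n G w r) - ∑ e ∈ insert s(r, r) T,
      (ostX n G w r e / ostL (ostU n) (ostX n G w r) e) •
        vecMulVec (ostU n e) (ostU n e)).PosSemidef) :
    (κ • lap n G w - treeLap n G w T).PosSemidef := by
  obtain ⟨A, hA⟩ : ∃ A : Matrix (Fin n) (Fin n) ℝ, A = 1 - vecMulVec 1 (Pi.single r 1) :=
    ⟨_, rfl⟩
  have hnd : ∀ e ∈ G.edgeSet, ¬ e.IsDiag := fun e he => G.not_isDiag_of_mem_edgeSet he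
  have := h.conjTranspose_mul_mul_same A
  rw [Matrix.conjTranspose_eq_transpose_of_trivial] at this
  convert this using 1
  rw [Matrix.mul_sub, Matrix.sub_mul, Matrix.mul_smul, Matrix.smul_mul, ostM_eq, Matrix.mul_add,
    Matrix.add_mul, ost_proj_loop n r A hA, add_zero]
  have hnot : s(r, r) ∉ T := fun h => ost_loop_notMem G r (hT.1 (Finset.mem_coe.2 h))
  congr 1
  · congr 1
    rw [lap, Finset.mul_sum, Finset.sum_mul]
    refine Finset.sum_congr rfl fun e _ => ?_
    by_cases he : e ∈ G.edgeSet
    · rw [if_pos he, Matrix.mul_smul, Matrix.smul_mul, ost_proj_mat n r A hA e (hnd e he)]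
    · rw [if_neg he]; simp
  · rw [Finset.sum_insert hnot, Matrix.mul_add, Matrix.add_mul, ostU_mat, Matrix.mul_smul,
      Matrix.smul_mul, ost_proj_loop n r A hA, smul_zero, zero_add, treeLap, Finset.mul_sum,
      Finset.sum_mul]
    refine Finset.sum_congr rfl fun e he => ?_
    have heG : e ∈ G.edgeSet := hT.1 (Finset.mem_coe.2 he)
    have hne : e ≠ s(r, r) := fun h => hnot (h ▸ he)
    rw [ostU_mat, Matrix.mul_smul, Matrix.smul_mul, ost_proj_mat n r A hA e (hnd e heG),
      ostL_lev n G hG w hw r e hne, ostX, if_pos heG]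

theorem ost_num (n : ℕ) (hn : 2 ≤ n) (B Z : ℝ) (hB : 0 ≤ B) (hZ : 0 < Z)
    (h : ∀ p : ℕ, 0 < p → B * ((p : ℝ) + 400 * Real.log n) ^ p ≤
      ((n + 2).choose 2 : ℝ) * (Z * (n * (p : ℝ) ^ p))) : B / Z ≤ (n : ℝ)⁻¹ := by
  have hn' : (2 : ℝ) ≤ n := by exact_mod_cast hn
  have hlog : (0.69 : ℝ) ≤ Real.log n := by
    have h1 := Real.log_two_gt_d9
    have h2 := Real.log_le_log (by norm_num) hn'
    linarith
  set p := ⌈Real.log n⌉₊ with hp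
  have hp0 : 0 < p := Nat.ceil_pos.2 (by linarith)
  have hp1 : Real.log n ≤ p := Nat.le_ceil _
  have hp2 : (p : ℝ) < Real.log n + 1 := Nat.ceil_lt_add_one (by linarith)
  have hpp : (0 : ℝ) < (p : ℝ) ^ p := by positivity
  have h1 := h p hp0
  have h2 : (n : ℝ) ^ 5 * (p : ℝ) ^ p ≤ ((p : ℝ) + 400 * Real.log n) ^ p := by
    have ha : (n : ℝ) ^ 5 ≤ 150 ^ p := by
      have hb : Real.exp 5 ≤ 150 := by
        have := Real.exp_one_lt_d9
        have h5 : Real.exp 5 = Real.exp 1 ^ 5 := by rw [← Real.exp_nat_mul]; norm_num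
        rw [h5]
        calc Real.exp 1 ^ 5 ≤ 2.72 ^ 5 :=
              pow_le_pow_left₀ (Real.exp_pos 1).le (by linarith) 5
          _ ≤ 150 := by norm_num
      calc (n : ℝ) ^ 5 = Real.exp (Real.log n) ^ 5 := by rw [Real.exp_log (by linarith)]
        _ ≤ Real.exp p ^ 5 := pow_le_pow_left₀ (Real.exp_pos _).le (Real.exp_le_exp.2 hp1) 5
        _ = Real.exp 5 ^ p := by rw [← Real.exp_nat_mul, ← Real.exp_nat_mul]; congr 1; push_cast; ring
        _ ≤ 150 ^ p := pow_le_pow_left₀ (Real.exp_pos 5).le hb p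
    calc (n : ℝ) ^ 5 * (p : ℝ) ^ p ≤ 150 ^ p * (p : ℝ) ^ p :=
          mul_le_mul_of_nonneg_right ha hpp.le
      _ = (150 * (p : ℝ)) ^ p := (mul_pow _ _ _).symm
      _ ≤ _ := pow_le_pow_left₀ (by positivity) (by linarith) p
  have h3 : ((n + 2).choose 2 : ℝ) * n ≤ (n : ℝ) ^ 4 := by
    have : ((n + 2).choose 2 : ℝ) = (n + 2) * (n + 1) / 2 := by
      rw [Nat.cast_choose_two]; push_cast; ring
    rw [this]
    have : ((n : ℝ) + 2) * (n + 1) / 2 ≤ (n : ℝ) ^ 3 := by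
      nlinarith [mul_nonneg (sub_nonneg.2 hn') (sub_nonneg.2 hn'),
        mul_nonneg (mul_nonneg (sub_nonneg.2 hn') (sub_nonneg.2 hn')) (by linarith : (0 : ℝ) ≤ n)]
    calc _ ≤ (n : ℝ) ^ 3 * n := mul_le_mul_of_nonneg_right this (by linarith)
      _ = _ := by ring
  have h4 : B * n ^ 5 ≤ n ^ 4 * Z := by
    refine le_of_mul_le_mul_right ?_ hpp
    calc B * n ^ 5 * (p : ℝ) ^ p = B * (n ^ 5 * (p : ℝ) ^ p) := by ring
      _ ≤ _ := mul_le_mul_of_nonneg_left h2 hB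
      _ ≤ _ := h1
      _ = (((n + 2).choose 2 : ℝ) * n) * (Z * (p : ℝ) ^ p) := by ring
      _ ≤ n ^ 4 * (Z * (p : ℝ) ^ p) := mul_le_mul_of_nonneg_right h3 (by positivity)
      _ = _ := by ring
  have hn0 : (0 : ℝ) < n := by linarith
  rw [div_le_iff₀ hZ, inv_mul_eq_div, le_div_iff₀ hn0]
  refine le_of_mul_le_mul_right ?_ (pow_pos hn0 4)
  calc B * n * (n : ℝ) ^ 4 = B * n ^ 5 := by ring
    _ ≤ _ := h4
    _ = _ := by ring

/-- a single inverse-leverage-score weighted random spanning tree satisfies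
L_T ⪯ C (ln n) L_G with high probability. -/
theorem one_spanning_tree_upper :
    ∃ C > (0:ℝ), ∃ c > (0:ℝ), ∀ n : ℕ, 2 ≤ n →
    ∀ G : SimpleGraph (Fin n), G.Connected →
    ∀ w : Sym2 (Fin n) → ℝ, (∀ e ∈ G.edgeSet, 0 < w e) →
    1 - (n : ℝ) ^ (-c) ≤
      ∑ T ∈ Finset.univ.filter (fun T : Finset (Sym2 (Fin n)) =>
        ((C * Real.log n) • lap n G w - treeLap n G w T).PosSemidef),
        treeProb n G w T := by
  refine ⟨400, by norm_num, 1, one_pos, fun n hn G hG w hw => ?_⟩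
  have r : Fin n := ⟨0, by omega⟩
  have hZ := ostTot_pos n G hG w hw
  have hκ : 0 ≤ 400 * Real.log n := by
    have := Real.log_natCast_nonneg n
    linarith
  rw [Real.rpow_neg_one]
  set κ := 400 * Real.log n with hκd
  set x := ostX n G w r with hx
  have hx0 := ostX_nonneg n G w hw r
  set B := ∑ F ∈ Finset.univ.filter (fun F => ¬ (κ • ostM (ostU n) x -
    ∑ e ∈ F, (x e / ostL (ostU n) x e) • vecMulVec (ostU n e) (ostU n e)).PosSemidef),
      ostNu (ostU n) x F with hB
  have hB0 : 0 ≤ B := Finset.sum_nonneg fun F _ => ostNu_nonneg _ _ hx0 F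
  have hnum := ost_num n hn B _ hB0 hZ (fun p hp => by
    have := ost_det (ostU n) x hx0 (ostM_pd n G hG w hw r) hκ p hp
    rw [ost_det_tot] at this
    exact this)
  have htot : ∑ T, treeProb n G w T = 1 := by
    simp only [treeProb]
    rw [← Finset.sum_div, ← Finset.sum_filter]
    exact div_self hZ.ne'
  rw [← Finset.sum_filter_add_sum_filter_not Finset.univ (fun T : Finset (Sym2 (Fin n)) =>
        (κ • lap n G w - treeLap n G w T).PosSemidef)] at htot
  have hbad : ∑ T ∈ Finset.univ.filter (fun T : Finset (Sym2 (Fin n)) =>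
        ¬ (κ • lap n G w - treeLap n G w T).PosSemidef), treeProb n G w T ≤ B / ostTot n G w := by
    have ht := ost_transport n G w r (fun F => if (κ • ostM (ostU n) x -
      ∑ e ∈ F, (x e / ostL (ostU n) x e) • vecMulVec (ostU n e) (ostU n e)).PosSemidef
        then 0 else 1)
    have hB' : B = ∑ F, ostNu (ostU n) x F * (if (κ • ostM (ostU n) x -
      ∑ e ∈ F, (x e / ostL (ostU n) x e) • vecMulVec (ostU n e) (ostU n e)).PosSemidef
        then 0 else 1) := by
      rw [hB, Finset.sum_filter]
      refine Finset.sum_congr rfl fun F _ => ?_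
      rw [ite_not, mul_ite, mul_zero, mul_one]
    rw [hB', ht, Finset.sum_div, Finset.sum_filter, Finset.sum_filter]
    refine Finset.sum_le_sum fun T _ => ?_
    rw [treeProb, ← ostTot]
    by_cases hT : IsSpanningTree n G T
    · rw [if_pos hT, if_pos hT]
      have hwt := ost_wt_pos n G w hw T hT
      by_cases h2 : (κ • ostM (ostU n) x - ∑ e ∈ insert s(r, r) T,
          (x e / ostL (ostU n) x e) • vecMulVec (ostU n e) (ostU n e)).PosSemidef
      · rw [if_pos h2, if_neg (not_not.2 (ost_reduce n G hG w hw r κ T hT h2))]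
        simp
      · rw [if_neg h2, mul_one]
        split_ifs
        · positivity
        · exact le_rfl
    · rw [if_neg hT, if_neg hT]
      simp
  linarith

end
end
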